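/- arXiv:math/0404192 — 3 statements merged into one kernel-verified Lean document; each statement's English description precedes it below -/
import Mathlib

section
/- Let F be a class of real-valued functions on a set Ω and let t > 0. Assume there exist positive numbers v and α ≤ 1 such that v(F, t x) ≤ v·x^{−α} for all x ≥ 1. Then D(F, C t) ≤ (C/α)·v, where C is an absolute constant. -/
open MeasureTheory Filter
open scoped ENNReal NNReal Pointwise BigOperators

/-- A finite subset `σ` of `Ω` is `t`-shattered by the class `F`: there is a level function `h`
such that for every partition of `σ` (given by the subset `τ = σ₊`) some `f ∈ F` lies below `h`
on `σ₋ = σ \ τ` and above `h + t` on `σ₊ = τ`. -/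
def Shatters {Ω : Type*} (F : Set (Ω → ℝ)) (t : ℝ) (σ : Finset Ω) : Prop :=
  ∃ h : Ω → ℝ, ∀ τ : Finset Ω, τ ⊆ σ →
    ∃ f ∈ F, (∀ x ∈ σ, x ∉ τ → f x ≤ h x) ∧ (∀ x ∈ τ, h x + t ≤ f x)

/-- The combinatorial dimension `v(F,t)`: the maximal cardinality of a `t`-shattered set. -/
noncomputable def combDim {Ω : Type*} (F : Set (Ω → ℝ)) (t : ℝ) : ℝ≥0∞ :=
  ⨆ (σ : Finset Ω) (_ : Shatters F t σ), (σ.card : ℝ≥0∞)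

/-- There are `m` functions in `F` that are pairwise `t`-separated in `L₂(μ)` for some
probability measure `μ` supported on a finite subset of `Ω` (given by weights `w` on `s`). -/
def KPSeparated {Ω : Type*} (F : Set (Ω → ℝ)) (t : ℝ) (m : ℕ) : Prop :=
  ∃ (s : Finset Ω) (w : Ω → ℝ) (f : Fin m → Ω → ℝ),
    (∀ x, 0 ≤ w x) ∧ (∑ x ∈ s, w x = 1) ∧ (∀ i, f i ∈ F) ∧
    ∀ i j : Fin m, i < j → t ^ 2 ≤ ∑ x ∈ s, w x * (f i x - f j x) ^ 2

/-- The Koltchinskii–Pollard entropy `D(F,t) = log sup { m : KPSeparated F t m }`. -/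
noncomputable def KPentropy {Ω : Type*} (F : Set (Ω → ℝ)) (t : ℝ) : ℝ≥0∞ :=
  ⨆ (m : ℕ) (_ : KPSeparated F t m), ENNReal.ofReal (Real.log m)


/-- Cell shattering. -/
def CellSh {ι J : Type*} (G : ι → J → ℝ) (B : Finset ι) (c : J → Option ℤ) : Prop :=
  ∀ s : J → Bool, ∃ a ∈ B, ∀ j z, c j = some z →
    (s j = true → (z : ℝ) + 1 ≤ G a j) ∧ (s j = false → G a j ≤ z)

lemma CellSh.mono {ι J : Type*} {G : ι → J → ℝ} {B B' : Finset ι} {c : J → Option ℤ}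
    (h : CellSh G B c) (hB : B ⊆ B') : CellSh G B' c := by
  intro s
  obtain ⟨a, ha, h2⟩ := h s
  exact ⟨a, hB ha, h2⟩

open Classical in
lemma tree_lemma {ι J : Type*} (G : ι → J → ℝ) (n : ℕ) : ∀ (B : Finset ι), B.card ≤ n →
    (∀ B' ⊆ B, 2 ≤ B'.card → ∃ (j : J) (z : ℤ),
      (B'.filter (fun a => G a j ≤ z)).Nonempty ∧
      (B'.filter (fun a => (z : ℝ) + 1 ≤ G a j)).Nonempty ∧
      √(B'.card : ℝ) ≤ √((B'.filter (fun a => G a j ≤ z)).card : ℝ)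
        + √((B'.filter (fun a => (z : ℝ) + 1 ≤ G a j)).card : ℝ)) →
    ∃ S : Finset (J → Option ℤ), (∀ c ∈ S, CellSh G B c) ∧ √(B.card : ℝ) ≤ S.card := by
  induction n with
  | zero =>
    intro B hB _
    refine ⟨∅, by simp, ?_⟩
    have : B.card = 0 := by omega
    simp [this]
  | succ n ih =>
    intro B hB hsplit
    rcases Nat.lt_or_ge B.card 2 with h2 | h2
    · rcases Nat.eq_zero_or_pos B.card with h0 | h0
      · exact ⟨∅, by simp, by simp [h0]⟩
      · have h1 : B.card = 1 := by omega
        obtain ⟨a, ha⟩ := Finset.card_pos.1 h0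
        refine ⟨{fun _ => none}, ?_, by simp [h1]⟩
        intro c hc s
        refine ⟨a, ha, ?_⟩
        intro j z hz
        simp at hc
        simp [hc] at hz
    · obtain ⟨j, z, hne1, hne2, hsq⟩ := hsplit B subset_rfl h2
      set B1 := B.filter (fun a => G a j ≤ z) with hB1
      set B2 := B.filter (fun a => (z : ℝ) + 1 ≤ G a j) with hB2
      have hs1 : B1 ⊆ B := Finset.filter_subset _ _
      have hs2 : B2 ⊆ B := Finset.filter_subset _ _
      have hdis : Disjoint B1 B2 := by
        rw [Finset.disjoint_left]
        intro a h1 h2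
        simp only [hB1, hB2, Finset.mem_filter] at h1 h2
        linarith [h1.2, h2.2]
      have hcard : B1.card + B2.card ≤ B.card := by
        rw [← Finset.card_union_of_disjoint hdis]
        exact Finset.card_le_card (Finset.union_subset hs1 hs2)
      have hp1 := Finset.card_pos.2 hne1
      have hp2 := Finset.card_pos.2 hne2
      obtain ⟨S1, hS1, hc1⟩ := ih B1 (by omega) (fun B' hB' => hsplit B' (hB'.trans hs1))
      obtain ⟨S2, hS2, hc2⟩ := ih B2 (by omega) (fun B' hB' => hsplit B' (hB'.trans hs2))
      have hm1 : ∀ a ∈ B1, G a j ≤ z := fun a ha => (Finset.mem_filter.1 ha).2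
      have hm2 : ∀ a ∈ B2, (z : ℝ) + 1 ≤ G a j := fun a ha => (Finset.mem_filter.1 ha).2
      have hnone : ∀ c ∈ S1 ∩ S2, c j = none := by
        intro c hc
        rw [Finset.mem_inter] at hc
        by_contra hcn
        obtain ⟨z', hz'⟩ := Option.ne_none_iff_exists'.1 hcn
        obtain ⟨a, ha, h⟩ := hS1 c hc.1 (fun _ => true)
        obtain ⟨b, hb, h'⟩ := hS2 c hc.2 (fun _ => false)
        have e1 := (h j z' hz').1 rfl
        have e2 := (h' j z' hz').2 rfl
        linarith [hm1 a ha, hm2 b hb]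
      let up : (J → Option ℤ) → (J → Option ℤ) := fun c => Function.update c j (some z)
      have hinj : Set.InjOn up (S1 ∩ S2 : Finset _) := by
        intro c hc c' hc' he
        funext i
        by_cases hi : i = j
        · subst hi
          rw [hnone c hc, hnone c' hc']
        · have := congrFun he i
          simpa [up, hi] using this
      have hdis2 : Disjoint (S1 ∪ S2) ((S1 ∩ S2).image up) := by
        rw [Finset.disjoint_right]
        intro c hc hc'
        obtain ⟨d, hd, rfl⟩ := Finset.mem_image.1 hc
        have hj : up d j = some z := by simp [up]
        rcases Finset.mem_union.1 hc' with h | h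
        · obtain ⟨a, ha, h⟩ := hS1 _ h (fun _ => true)
          linarith [(h j z hj).1 rfl, hm1 a ha]
        · obtain ⟨a, ha, h⟩ := hS2 _ h (fun _ => false)
          linarith [(h j z hj).2 rfl, hm2 a ha]
      refine ⟨(S1 ∪ S2) ∪ (S1 ∩ S2).image up, ?_, ?_⟩
      · intro c hc
        rcases Finset.mem_union.1 hc with hc | hc
        · rcases Finset.mem_union.1 hc with hc | hc
          · exact (hS1 c hc).mono hs1
          · exact (hS2 c hc).mono hs2
        · obtain ⟨d, hd, rfl⟩ := Finset.mem_image.1 hc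
          have hdn := hnone d hd
          rw [Finset.mem_inter] at hd
          intro s
          cases hsj : s j with
          | true =>
            obtain ⟨a, ha, h⟩ := hS2 d hd.2 s
            refine ⟨a, hs2 ha, ?_⟩
            intro i z' hz'
            by_cases hi : i = j
            · subst hi
              simp [up] at hz'
              subst hz'
              exact ⟨fun _ => hm2 a ha, fun hf => by simp [hsj] at hf⟩
            · simp [up, hi] at hz'
              exact h i z' hz'
          | false =>
            obtain ⟨a, ha, h⟩ := hS1 d hd.1 s
            refine ⟨a, hs1 ha, ?_⟩
            intro i z' hz'
            by_cases hi : i = j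
            · subst hi
              simp [up] at hz'
              subst hz'
              exact ⟨fun hf => by simp [hsj] at hf, fun _ => hm1 a ha⟩
            · simp [up, hi] at hz'
              exact h i z' hz'
      · rw [Finset.card_union_of_disjoint hdis2, Finset.card_image_of_injOn hinj,
          Finset.card_union_add_card_inter]
        push_cast
        linarith

lemma one_sided {ι : Type*} (B : Finset ι) (X : ι → ℝ) (m : ℕ) (z0 : ℤ) (hm : m ≠ 0) (hB : 0 < B.card)
    (h0 : 2 * ((B.filter (fun a => (z0 : ℝ) < X a)).card : ℝ) ≤ B.card)
    (hr : (B.card : ℝ) ≤ 2 ^ m * ((B.filter (fun a => (z0 : ℝ) + m ≤ X a)).card : ℝ)) :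
    ∃ z : ℤ, (B.filter (fun a => X a ≤ z)).Nonempty ∧
      (B.filter (fun a => (z : ℝ) + 1 ≤ X a)).Nonempty ∧
      √(B.card : ℝ) ≤ √((B.filter (fun a => X a ≤ z)).card : ℝ)
        + √((B.filter (fun a => (z : ℝ) + 1 ≤ X a)).card : ℝ) := by
  by_contra hcon
  have hBr : (0 : ℝ) < B.card := by exact_mod_cast hB
  have hrpos : 0 < (B.filter (fun a => (z0 : ℝ) + m ≤ X a)).card := by
    rcases Nat.eq_zero_or_pos (B.filter (fun a => (z0 : ℝ) + m ≤ X a)).card with h | h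
    · rw [h] at hr; simp at hr; simp [hr] at hB
    · exact h
  have step : ∀ z : ℤ, z0 ≤ z → z + 1 ≤ z0 + m →
      2 * ((B.filter (fun a => (z : ℝ) < X a)).card : ℝ) ≤ B.card →
      2 * ((B.filter (fun a => (z : ℝ) + 1 ≤ X a)).card : ℝ) ≤
        ((B.filter (fun a => (z : ℝ) < X a)).card : ℝ) ∧
      0 < ((B.filter (fun a => (z : ℝ) < X a)).card : ℝ) := by
    intro z hz hz1 hT
    set T : ℝ := ((B.filter (fun a => (z : ℝ) < X a)).card : ℝ) with hTd
    set r : ℝ := ((B.filter (fun a => (z : ℝ) + 1 ≤ X a)).card : ℝ) with hrd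
    set l : ℝ := ((B.filter (fun a => X a ≤ z)).card : ℝ) with hld
    have hlT : l + T = B.card := by
      rw [hld, hTd]
      have := Finset.card_filter_add_card_filter_not (s := B) (fun a => X a ≤ z)
      simp only [not_le] at this
      exact_mod_cast this
    have hzr : (z : ℝ) + 1 ≤ z0 + m := by exact_mod_cast hz1
    have hrne : (B.filter (fun a => (z : ℝ) + 1 ≤ X a)).Nonempty := by
      rw [← Finset.card_pos]
      refine lt_of_lt_of_le hrpos (Finset.card_le_card ?_)
      intro a
      simp only [Finset.mem_filter]
      rintro ⟨h1, h2⟩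
      exact ⟨h1, by linarith⟩
    have hlne : (B.filter (fun a => X a ≤ z)).Nonempty := by
      rw [← Finset.card_pos]
      have : 0 < l := by linarith
      rw [hld] at this
      exact_mod_cast this
    have hlt : √l + √r < √(B.card : ℝ) := by
      by_contra hh
      exact hcon ⟨z, hlne, hrne, not_lt.1 hh⟩
    have hrp : 0 < r := by rw [hrd]; exact_mod_cast Finset.card_pos.2 hrne
    have hrT : r ≤ T := by
      rw [hrd, hTd]
      have : (B.filter (fun a => (z : ℝ) + 1 ≤ X a)) ⊆ (B.filter (fun a => (z : ℝ) < X a)) := by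
        intro a
        simp only [Finset.mem_filter]
        rintro ⟨h1, h2⟩
        exact ⟨h1, by linarith⟩
      exact_mod_cast Finset.card_le_card this
    refine ⟨?_, by linarith⟩
    by_contra hh
    push Not at hh
    have hl0 : 0 ≤ l := by linarith
    have : √(B.card : ℝ) ≤ √l + √r := by
      have a1 := Real.sq_sqrt hl0
      have a2 := Real.sq_sqrt hrp.le
      have a3 := Real.sqrt_nonneg l
      have a4 := Real.sqrt_nonneg r
      apply Real.sqrt_le_iff.2
      refine ⟨by positivity, ?_⟩
      have : r ≤ √l * √r := by
        have : √r ≤ √l := Real.sqrt_le_sqrt (by linarith)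
        nlinarith
      nlinarith
    linarith
  have hdec : ∀ i : ℕ, i < m →
      2 ^ (i + 1) * ((B.filter (fun a => ((z0 + i : ℤ) : ℝ) < X a)).card : ℝ) ≤ B.card := by
    intro i
    induction i with
    | zero => intro _; simpa using h0
    | succ i ih =>
      intro hi
      have h1 := ih (by omega)
      have h2 := step (z0 + i) (by omega) (by omega) (by
        refine le_trans ?_ h1
        gcongr
        rw [pow_succ]
        nlinarith [one_le_pow₀ (one_le_two : (1 : ℝ) ≤ 2) (n := i)])
      have h3 : ((B.filter (fun a => ((z0 + (i + 1 : ℕ) : ℤ) : ℝ) < X a)).card : ℝ) ≤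
          ((B.filter (fun a => ((z0 + i : ℤ) : ℝ) + 1 ≤ X a)).card : ℝ) := by
        have : (B.filter (fun a => ((z0 + (i + 1 : ℕ) : ℤ) : ℝ) < X a)) ⊆
            (B.filter (fun a => ((z0 + i : ℤ) : ℝ) + 1 ≤ X a)) := by
          intro a
          simp only [Finset.mem_filter]
          rintro ⟨h1, h2⟩
          refine ⟨h1, ?_⟩
          push_cast at h2 ⊢
          linarith
        exact_mod_cast Finset.card_le_card this
      have hp : (0 : ℝ) < 2 ^ (i + 1) := by positivity
      calc _ = 2 ^ (i + 1) * (2 * ((B.filter (fun a => ((z0 + (i + 1 : ℕ) : ℤ) : ℝ) < X a)).card : ℝ)) := by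
              rw [pow_succ _ (i + 1)]; ring
        _ ≤ 2 ^ (i + 1) * ((B.filter (fun a => ((z0 + i : ℤ) : ℝ) < X a)).card : ℝ) := by
              gcongr; linarith [h2.1]
        _ ≤ _ := h1
  rcases m with _ | m
  · exact hm rfl
  · have h1 := hdec m (by omega)
    have h2 := step (z0 + m) (by omega) (by push_cast; omega) (by
        refine le_trans ?_ h1
        gcongr
        rw [pow_succ]
        nlinarith [one_le_pow₀ (one_le_two : (1 : ℝ) ≤ 2) (n := m)])
    have e : (B.filter (fun a => ((z0 + m : ℤ) : ℝ) + 1 ≤ X a)) =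
        (B.filter (fun a => (z0 : ℝ) + (m + 1 : ℕ) ≤ X a)) := by
      congr 1
      ext a
      push_cast
      rw [add_assoc]
    rw [e] at h2
    have hp : (0 : ℝ) < 2 ^ (m + 1) := by positivity
    have := mul_le_mul_of_nonneg_left h2.1 hp.le
    nlinarith

lemma split_lemma {ι : Type*} (B : Finset ι) (X : ι → ℝ) (m : ℕ) (hm : m ≠ 0) (hB : 0 < B.card)
    (hp : 4 * (B.card : ℝ) ^ 2 ≤
      2 ^ m * (((B ×ˢ B).filter (fun p => 2 * (m : ℝ) + 1 ≤ |X p.1 - X p.2|)).card : ℝ)) :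
    ∃ z : ℤ, (B.filter (fun a => X a ≤ z)).Nonempty ∧
      (B.filter (fun a => (z : ℝ) + 1 ≤ X a)).Nonempty ∧
      √(B.card : ℝ) ≤ √((B.filter (fun a => X a ≤ z)).card : ℝ)
        + √((B.filter (fun a => (z : ℝ) + 1 ≤ X a)).card : ℝ) := by
  classical
  have hBr : (0 : ℝ) < B.card := by exact_mod_cast hB
  obtain ⟨M, hM⟩ : ∃ M : ℤ, ∀ a ∈ B, |X a| ≤ M := by
    obtain ⟨M, hM⟩ := (B.finite_toSet.image (fun a => |X a|)).bddAbove
    refine ⟨⌈M⌉, fun a ha => (hM ⟨a, ha, rfl⟩).trans (Int.le_ceil _)⟩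
  let P : ℤ → Prop := fun z => 2 * ((B.filter (fun a => (z : ℝ) < X a)).card : ℝ) ≤ B.card
  obtain ⟨z0, hz0, hmin⟩ := Int.exists_least_of_bdd (P := P) (by
    refine ⟨-M - 1, fun z hz => ?_⟩
    by_contra hlt
    push Not at hlt
    have : B.filter (fun a => (z : ℝ) < X a) = B := by
      rw [Finset.filter_eq_self]
      intro a ha
      have h1 := (abs_le.1 (hM a ha)).1
      have : (z : ℝ) < -M - 1 := by exact_mod_cast hlt
      linarith
    simp only [P, this] at hz
    linarith) (by
    refine ⟨M, ?_⟩
    have : B.filter (fun a => (M : ℝ) < X a) = ∅ := by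
      rw [Finset.filter_eq_empty_iff]
      intro a ha
      have h1 := (abs_le.1 (hM a ha)).2
      linarith
    simp [P, this])
  have hlow : 2 * ((B.filter (fun a => (((1 - z0 : ℤ)) : ℝ) < -X a)).card : ℝ) ≤ B.card := by
    have h1 : ¬ P (z0 - 1) := fun h => by have := hmin _ h; omega
    simp only [P, not_le] at h1
    have h2 : ((B.filter (fun a => (((1 - z0 : ℤ)) : ℝ) < -X a)).card : ℝ) +
        ((B.filter (fun a => ((z0 - 1 : ℤ) : ℝ) < X a)).card : ℝ) ≤ B.card := by
      rw [← Nat.cast_add, ← Finset.card_union_of_disjoint]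
      · exact_mod_cast Finset.card_le_card
          (Finset.union_subset (Finset.filter_subset _ _) (Finset.filter_subset _ _))
      · rw [Finset.disjoint_left]
        intro a h1 h2
        simp only [Finset.mem_filter] at h1 h2
        have e1 := h1.2
        have e2 := h2.2
        push_cast at e1 e2
        linarith
    linarith
  set U := B.filter (fun a => (z0 : ℝ) + m ≤ X a) with hU
  set D := B.filter (fun a => ((1 - z0 : ℤ) : ℝ) + m ≤ -X a) with hD
  have hsub : (B ×ˢ B).filter (fun p => 2 * (m : ℝ) + 1 ≤ |X p.1 - X p.2|) ⊆
      ((U ∪ D) ×ˢ B) ∪ (B ×ˢ (U ∪ D)) := by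
    rintro ⟨a, b⟩ hab
    simp only [Finset.mem_filter, Finset.mem_product] at hab
    obtain ⟨⟨ha, hb⟩, hd⟩ := hab
    simp only [Finset.mem_union, Finset.mem_product, hU, hD, Finset.mem_filter, ha, hb, true_and,
      and_true]
    by_contra hc
    push Not at hc
    obtain ⟨⟨h1, h2⟩, h3, h4⟩ := hc
    push_cast at h2 h4
    have : |X a - X b| < 2 * (m : ℝ) + 1 := by
      rw [abs_lt]; constructor <;> linarith
    linarith
  have hcard : (((B ×ˢ B).filter (fun p => 2 * (m : ℝ) + 1 ≤ |X p.1 - X p.2|)).card : ℝ) ≤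
      2 * B.card * ((U.card : ℝ) + D.card) := by
    have h1 := (Finset.card_le_card hsub).trans (Finset.card_union_le _ _)
    rw [Finset.card_product, Finset.card_product] at h1
    have h2 := Finset.card_union_le U D
    have h1' : (((B ×ˢ B).filter (fun p => 2 * (m : ℝ) + 1 ≤ |X p.1 - X p.2|)).card : ℝ) ≤
      ((U ∪ D).card : ℝ) * B.card + B.card * ((U ∪ D).card : ℝ) := by exact_mod_cast h1
    have h2' : ((U ∪ D).card : ℝ) ≤ U.card + D.card := by exact_mod_cast h2
    nlinarith
  have h2m : (0 : ℝ) < 2 ^ m := by positivity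
  have hsum : 2 * (B.card : ℝ) ≤ 2 ^ m * ((U.card : ℝ) + D.card) := by
    have := hp.trans (mul_le_mul_of_nonneg_left hcard h2m.le)
    have h3 : (2 * (B.card : ℝ)) * (2 * (B.card : ℝ)) ≤
      (2 * (B.card : ℝ)) * (2 ^ m * ((U.card : ℝ) + D.card)) := by linarith
    exact le_of_mul_le_mul_left h3 (by positivity)
  by_cases hUc : (B.card : ℝ) ≤ 2 ^ m * U.card
  · exact one_sided B X m z0 hm hB hz0 hUc
  · have hDc : (B.card : ℝ) ≤ 2 ^ m * D.card := by
      push Not at hUc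
      linarith
    obtain ⟨z, h1, h2, h3⟩ := one_sided B (fun a => -X a) m (1 - z0) hm hB hlow hDc
    have e1 : B.filter (fun a => -X a ≤ z) = B.filter (fun a => ((-z - 1 : ℤ) : ℝ) + 1 ≤ X a) := by
      congr 1
      ext a
      push_cast
      constructor <;> intro h <;> linarith
    have e2 : B.filter (fun a => (z : ℝ) + 1 ≤ -X a) =
        B.filter (fun a => X a ≤ ((-z - 1 : ℤ) : ℝ)) := by
      congr 1
      ext a
      push_cast
      constructor <;> intro h <;> linarith
    rw [e1] at h1 h3
    rw [e2] at h2 h3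
    exact ⟨-z - 1, h2, h1, by linarith⟩

/-- Greedy sampling. -/
lemma sampling_aux {Ω π : Type*} (s : Finset Ω) (w : Ω → ℝ) (hw : ∀ x, 0 ≤ w x)
    (hw1 : ∑ x ∈ s, w x = 1) (P : Finset π) (E : π → Ω → Prop) [∀ p, DecidablePred (E p)] (ρ : ℝ)
    (hρ : ∀ p ∈ P, ρ ≤ ∑ x ∈ s with E p x, w x) (hρ2 : ρ ≤ 2) (n : ℕ) :
    ∃ x : Fin n → Ω, ∑ p ∈ P, ((1 : ℝ) / 2) ^ (Finset.univ.filter (fun i => E p (x i))).card ≤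
      P.card * (1 - ρ / 2) ^ n := by
  induction n with
  | zero => exact ⟨fun i => i.elim0, by simp⟩
  | succ n ih =>
    obtain ⟨x, hx⟩ := ih
    set φ : π → ℝ := fun p => ((1 : ℝ) / 2) ^ (Finset.univ.filter (fun i => E p (x i))).card with hφ
    have hφ0 : ∀ p, 0 ≤ φ p := fun p => by positivity
    have key : ∑ y ∈ s, w y * (∑ p ∈ P, φ p * (if E p y then 1 / 2 else 1)) ≤
        ∑ y ∈ s, w y * ((1 - ρ / 2) * ∑ p ∈ P, φ p) := by
      rw [← Finset.sum_mul, hw1, one_mul]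
      simp_rw [Finset.mul_sum]
      rw [Finset.sum_comm]
      apply Finset.sum_le_sum
      intro p hp
      have : ∑ y ∈ s, w y * (φ p * (if E p y then 1 / 2 else 1)) =
          φ p * (∑ y ∈ s, w y - 1 / 2 * ∑ y ∈ s with E p y, w y) := by
        rw [Finset.sum_filter, Finset.mul_sum, ← Finset.sum_sub_distrib, Finset.mul_sum]
        apply Finset.sum_congr rfl
        intro y _
        split_ifs <;> ring
      rw [this, hw1, mul_comm]
      apply mul_le_mul_of_nonneg_right _ (hφ0 p)
      linarith [hρ p hp]
    have hne : s.Nonempty := by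
      rw [Finset.nonempty_iff_ne_empty]
      rintro rfl
      simp at hw1
    obtain ⟨y, hy, hwy, hle⟩ : ∃ y ∈ s, 0 < w y ∧ ∑ p ∈ P, φ p * (if E p y then 1 / 2 else 1) ≤
        (1 - ρ / 2) * ∑ p ∈ P, φ p := by
      by_contra hc
      push Not at hc
      obtain ⟨y0, hy0, hwy0⟩ : ∃ y ∈ s, 0 < w y := by
        by_contra h
        push Not at h
        have := Finset.sum_nonpos h
        linarith
      have : ∑ y ∈ s, w y * ((1 - ρ / 2) * ∑ p ∈ P, φ p) <
          ∑ y ∈ s, w y * (∑ p ∈ P, φ p * (if E p y then 1 / 2 else 1)) := by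
        apply Finset.sum_lt_sum
        · intro y hy
          rcases (hw y).eq_or_lt with h | h
          · simp [← h]
          · exact mul_le_mul_of_nonneg_left (hc y hy h).le h.le
        · exact ⟨y0, hy0, mul_lt_mul_of_pos_left (hc y0 hy0 hwy0) hwy0⟩
      linarith
    refine ⟨Fin.cons y x, ?_⟩
    have hcount : ∀ p, (Finset.univ.filter (fun i : Fin (n + 1) => E p
        ((Fin.cons y x : Fin (n + 1) → Ω) i))).card =
        (if E p y then 1 else 0) + (Finset.univ.filter (fun i => E p (x i))).card := by
      intro p
      rw [Finset.card_filter, Fin.sum_univ_succ, Finset.card_filter]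
      simp
    calc _ = ∑ p ∈ P, φ p * (if E p y then 1 / 2 else 1) := by
          apply Finset.sum_congr rfl
          intro p _
          rw [hcount, pow_add, mul_comm]
          congr 1
          split_ifs <;> simp
      _ ≤ _ := hle
      _ ≤ (1 - ρ / 2) * (P.card * (1 - ρ / 2) ^ n) :=
          mul_le_mul_of_nonneg_left hx (by linarith)
      _ = _ := by rw [pow_succ]; ring

lemma sampling {Ω π : Type*} (s : Finset Ω) (w : Ω → ℝ) (hw : ∀ x, 0 ≤ w x)
    (hw1 : ∑ x ∈ s, w x = 1) (P : Finset π) (E : π → Ω → Prop) [∀ p, DecidablePred (E p)] (ρ : ℝ)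
    (hρ : ∀ p ∈ P, ρ ≤ ∑ x ∈ s with E p x, w x) (hρ2 : ρ ≤ 2) (n : ℕ) (L : ℝ)
    (hP : (P.card : ℝ) ≤ Real.exp L) (hL : 4 * L ≤ ρ * n) :
    ∃ x : Fin n → Ω, ∀ p ∈ P,
      ρ * n ≤ 4 * ((Finset.univ.filter (fun i => E p (x i))).card : ℝ) := by
  obtain ⟨x, hx⟩ := sampling_aux s w hw hw1 P E ρ hρ hρ2 n
  refine ⟨x, fun p hp => ?_⟩
  have h1 : ((1 : ℝ) / 2) ^ (Finset.univ.filter (fun i => E p (x i))).card ≤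
      P.card * (1 - ρ / 2) ^ n :=
    (Finset.single_le_sum (f := fun p => ((1 : ℝ) / 2) ^
      (Finset.univ.filter (fun i => E p (x i))).card) (fun q _ => by positivity) hp).trans hx
  set c := (Finset.univ.filter (fun i => E p (x i))).card
  have h2 : (1 - ρ / 2) ^ n ≤ Real.exp (-(ρ / 2) * n) := by
    rw [mul_comm, Real.exp_nat_mul]
    apply pow_le_pow_left₀ (by linarith)
    linarith [Real.add_one_le_exp (-(ρ / 2))]
  have h3 : Real.exp (-(c : ℝ)) ≤ ((1 : ℝ) / 2) ^ c := by
    have : Real.exp (-(c : ℝ)) = Real.exp (-1) ^ c := by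
      rw [← Real.exp_nat_mul]; congr 1; ring
    rw [this]
    apply pow_le_pow_left₀ (Real.exp_pos _).le
    rw [Real.exp_neg, one_div]
    apply inv_anti₀ (by norm_num)
    linarith [Real.add_one_le_exp (1 : ℝ)]
  have h4 : Real.exp (-(c : ℝ)) ≤ Real.exp (L + -(ρ / 2) * n) := by
    rw [Real.exp_add]
    refine h3.trans (h1.trans ?_)
    have h5 : 0 ≤ (1 - ρ / 2) ^ n := pow_nonneg (by linarith) _
    exact mul_le_mul hP h2 h5 (Real.exp_pos _).le
  have := Real.exp_le_exp.1 h4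
  linarith

lemma dyadic_bound (D y : ℝ) (hD : 0 < D) (hy : 0 ≤ y) (K : ℕ) (h : y < D * 4 ^ K) :
    y ^ 2 ≤ D ^ 2 + ∑ k ∈ Finset.range K, D ^ 2 * 16 ^ (k + 1) * (if D * 4 ^ k ≤ y then 1 else 0) := by
  induction K with
  | zero => simp at h ⊢; nlinarith
  | succ K ih =>
    rw [Finset.sum_range_succ]
    by_cases hK : D * 4 ^ K ≤ y
    · have : 0 ≤ ∑ k ∈ Finset.range K, D ^ 2 * 16 ^ (k + 1) * (if D * 4 ^ k ≤ y then (1 : ℝ) else 0) := by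
        apply Finset.sum_nonneg
        intro k _
        split_ifs <;> positivity
      rw [if_pos hK]
      have e : D ^ 2 * 16 ^ (K + 1) = (D * 4 ^ (K + 1)) ^ 2 := by
        rw [mul_pow, ← pow_mul, mul_comm (K + 1) 2, pow_mul]; norm_num
      rw [e, mul_one]
      have : y ^ 2 ≤ (D * 4 ^ (K + 1)) ^ 2 := pow_le_pow_left₀ hy h.le 2
      nlinarith [sq_nonneg D]
    · rw [if_neg hK]
      push Not at hK
      simpa using ih hK

/-- Separated pair: some scale is charged. -/
lemma pair_lemma {Ω : Type*} (s : Finset Ω) (w : Ω → ℝ) (hw : ∀ x, 0 ≤ w x)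
    (hw1 : ∑ x ∈ s, w x = 1) (g h : Ω → ℝ) (D Q : ℝ) (hD : 0 < D) (hQ : 0 < Q) (K : ℕ)
    (hK : ∀ x ∈ s, |g x - h x| < D * 4 ^ K)
    (hsep : 81 * D ^ 2 ≤ ∑ x ∈ s, w x * (g x - h x) ^ 2)
    (hg : ∑ x ∈ s, w x * g x ^ 2 ≤ Q ^ 2) (hh : ∑ x ∈ s, w x * h x ^ 2 ≤ Q ^ 2) :
    ∃ k < K, ((1 : ℝ) / 64) ^ k ≤ ∑ x ∈ s with
      (D * 4 ^ k ≤ |g x - h x| ∧ |g x| ≤ Q * 8 ^ k ∧ |h x| ≤ Q * 8 ^ k), w x := by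
  by_contra hc
  push Not at hc
  have cheb : ∀ (u : Ω → ℝ), ∑ x ∈ s, w x * u x ^ 2 ≤ Q ^ 2 → ∀ k : ℕ,
      ∑ x ∈ s, w x * (if |u x| ≤ Q * 8 ^ k then 0 else 1) ≤ ((1 : ℝ) / 64) ^ k := by
    intro u hu k
    have hq : 0 < Q ^ 2 * 64 ^ k := by positivity
    have : ∑ x ∈ s, (Q ^ 2 * 64 ^ k) * (w x * (if |u x| ≤ Q * 8 ^ k then 0 else 1)) ≤
        ∑ x ∈ s, w x * u x ^ 2 := by
      apply Finset.sum_le_sum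
      intro x _
      split_ifs with hx
      · simp; exact mul_nonneg (hw x) (sq_nonneg _)
      · push Not at hx
        have h1 : (Q * 8 ^ k) ^ 2 ≤ u x ^ 2 := by
          rw [← sq_abs (u x)]
          exact pow_le_pow_left₀ (by positivity) hx.le 2
        have e : (Q * 8 ^ k) ^ 2 = Q ^ 2 * 64 ^ k := by
          rw [mul_pow, ← pow_mul, mul_comm k 2, pow_mul]; norm_num
        rw [e] at h1
        nlinarith [mul_le_mul_of_nonneg_left h1 (hw x)]
    rw [← Finset.mul_sum] at this
    have h2 := this.trans hu
    have h3 : 64 ^ k * ∑ x ∈ s, w x * (if |u x| ≤ Q * 8 ^ k then (0 : ℝ) else 1) ≤ 1 := by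
      rw [mul_assoc] at h2
      have hQ2 : 0 < Q ^ 2 := by positivity
      nlinarith
    rw [one_div, inv_pow, ← one_div, le_div_iff₀ (by positivity)]
    linarith
  have hmass : ∀ k < K, ∑ x ∈ s, w x * (if D * 4 ^ k ≤ |g x - h x| then 1 else 0) ≤
      3 * ((1 : ℝ) / 64) ^ k := by
    intro k hk
    have h1 := hc k hk
    have h2 := cheb g hg k
    have h3 := cheb h hh k
    rw [Finset.sum_filter] at h1
    have : ∑ x ∈ s, w x * (if D * 4 ^ k ≤ |g x - h x| then (1 : ℝ) else 0) ≤
        ∑ x ∈ s, ((if (D * 4 ^ k ≤ |g x - h x| ∧ |g x| ≤ Q * 8 ^ k ∧ |h x| ≤ Q * 8 ^ k) then w x else 0)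
          + w x * (if |g x| ≤ Q * 8 ^ k then 0 else 1)
          + w x * (if |h x| ≤ Q * 8 ^ k then 0 else 1)) := by
      apply Finset.sum_le_sum
      intro x _
      have := hw x
      by_cases c1 : D * 4 ^ k ≤ |g x - h x| <;> by_cases c2 : |g x| ≤ Q * 8 ^ k <;>
        by_cases c3 : |h x| ≤ Q * 8 ^ k <;> simp [c1, c2, c3, this]
    rw [Finset.sum_add_distrib, Finset.sum_add_distrib] at this
    linarith
  have htot : ∑ x ∈ s, w x * (g x - h x) ^ 2 ≤ D ^ 2 +
      ∑ k ∈ Finset.range K, D ^ 2 * 16 ^ (k + 1) * (3 * ((1 : ℝ) / 64) ^ k) := by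
    calc ∑ x ∈ s, w x * (g x - h x) ^ 2 ≤ ∑ x ∈ s, w x * (D ^ 2 + ∑ k ∈ Finset.range K,
          D ^ 2 * 16 ^ (k + 1) * (if D * 4 ^ k ≤ |g x - h x| then 1 else 0)) := by
          apply Finset.sum_le_sum
          intro x hx
          apply mul_le_mul_of_nonneg_left _ (hw x)
          rw [← sq_abs]
          exact dyadic_bound D _ hD (abs_nonneg _) K (hK x hx)
      _ = D ^ 2 + ∑ k ∈ Finset.range K, D ^ 2 * 16 ^ (k + 1) *
          ∑ x ∈ s, w x * (if D * 4 ^ k ≤ |g x - h x| then 1 else 0) := by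
          simp_rw [mul_add, Finset.sum_add_distrib, ← Finset.sum_mul, hw1, one_mul, Finset.mul_sum]
          rw [Finset.sum_comm]
          congr 1
          apply Finset.sum_congr rfl; intro k _
          apply Finset.sum_congr rfl; intro x _
          ring
      _ ≤ _ := by
          gcongr with k hk
          exact hmass k (Finset.mem_range.1 hk)
  have hgeo : ∑ k ∈ Finset.range K, D ^ 2 * 16 ^ (k + 1) * (3 * ((1 : ℝ) / 64) ^ k) ≤ 64 * D ^ 2 := by
    have : ∀ k ∈ Finset.range K, D ^ 2 * 16 ^ (k + 1) * (3 * ((1 : ℝ) / 64) ^ k) =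
        48 * D ^ 2 * (1 / 4) ^ k := by
      intro k _
      have : ((1 : ℝ) / 4) ^ k = 16 ^ k * (1 / 64) ^ k := by rw [← mul_pow]; norm_num
      rw [this, pow_succ]; ring
    rw [Finset.sum_congr rfl this, ← Finset.mul_sum, geom_sum_eq (by norm_num)]
    have : (0 : ℝ) ≤ (1 / 4) ^ K := by positivity
    have hD2 : 0 < D ^ 2 := by positivity
    have h43 : (((1 : ℝ) / 4) ^ K - 1) / (1 / 4 - 1) ≤ 4 / 3 := by
      rw [div_le_iff_of_neg (by norm_num)]
      linarith
    nlinarith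
  nlinarith [sq_pos_of_pos hD]

/-- Quantitative dimension hypothesis at unit scale. -/
def DimHyp {Ω : Type*} (F : Set (Ω → ℝ)) (v α : ℝ) : Prop :=
  ∀ x : ℝ, 1 ≤ x → ∀ σ : Finset Ω, Shatters F x σ → (σ.card : ℝ) ≤ v * x ^ (-α)

lemma clamp_le {Z y z : ℝ} (h : max (-Z) (min Z y) ≤ z) (hz : z < Z) : y ≤ z := by
  have := (le_max_right _ _).trans h
  rcases min_le_iff.1 this with h | h
  · linarith
  · exact h

lemma le_clamp {Z y z : ℝ} (h : z ≤ max (-Z) (min Z y)) (hz : -Z < z) : z ≤ y := by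
  rcases le_max_iff.1 h with h | h
  · linarith
  · exact h.trans (min_le_right _ _)

lemma cell_range {ι J : Type*} {G : ι → J → ℝ} {B : Finset ι} {c : J → Option ℤ}
    (h : CellSh G B c) (Z : J → ℝ) (hZ : ∀ a j, |G a j| ≤ Z j) (j : J) (z : ℤ)
    (hz : c j = some z) : -Z j ≤ z ∧ (z : ℝ) + 1 ≤ Z j := by
  obtain ⟨a, _, ha⟩ := h (fun _ => true)
  obtain ⟨b, _, hb⟩ := h (fun _ => false)
  have h1 := (ha j z hz).1 rfl
  have h2 := (hb j z hz).2 rfl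
  have h3 := abs_le.1 (hZ a j)
  have h4 := abs_le.1 (hZ b j)
  constructor <;> linarith

lemma clamp_abs {Z y : ℝ} (hZ : 0 ≤ Z) : |max (-Z) (min Z y)| ≤ Z := by
  rw [abs_le]
  refine ⟨le_max_left _ _, max_le (by linarith) (min_le_left _ _)⟩

lemma clamp_eq {Z y : ℝ} (h : |y| ≤ Z) : max (-Z) (min Z y) = y := by
  rw [abs_le] at h
  rw [min_eq_right h.2, max_eq_right h.1]

lemma cell_dim {Ω J : Type*} [Fintype J] (F : Set (Ω → ℝ)) (v α : ℝ) (hF : DimHyp F v α)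
    (A : Finset (Ω → ℝ)) (hA : ∀ f ∈ A, f ∈ F) (f0 : Ω → ℝ) (pt : J → Ω) (kk : J → ℕ) (Z : J → ℝ)
    (hZ : ∀ j, 0 ≤ Z j) (c : J → Option ℤ)
    (hc : CellSh (fun (f : Ω → ℝ) j =>
      max (-Z j) (min (Z j) ((f (pt j) - f0 (pt j)) / 2 ^ kk j))) A c) (l : ℕ) :
    ((Finset.univ.filter (fun j => c j ≠ none ∧ l ≤ kk j)).card : ℝ) ≤ v * ((2 : ℝ) ^ l) ^ (-α) := by
  classical
  have hc' : ∀ s : J → Bool, ∃ a ∈ A, ∀ j z, c j = some z →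
      (s j = true → ((z : ℝ) + 1) * 2 ^ kk j ≤ a (pt j) - f0 (pt j)) ∧
      (s j = false → a (pt j) - f0 (pt j) ≤ (z : ℝ) * 2 ^ kk j) := by
    intro s
    obtain ⟨a, ha, h⟩ := hc s
    refine ⟨a, ha, fun j z hz => ?_⟩
    have hr := cell_range hc Z (fun a j => clamp_abs (hZ j)) j z hz
    have h2 : (0 : ℝ) < 2 ^ kk j := by positivity
    refine ⟨fun hs => ?_, fun hs => ?_⟩
    · have := le_clamp ((h j z hz).1 hs) (by linarith [hr.1])
      rwa [le_div_iff₀ h2] at this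
    · have := clamp_le ((h j z hz).2 hs) (by linarith [hr.2])
      rwa [div_le_iff₀ h2] at this
  set I := Finset.univ.filter (fun j => c j ≠ none ∧ l ≤ kk j) with hI
  have hIm : ∀ j ∈ I, (∃ z, c j = some z) ∧ l ≤ kk j := by
    intro j hj
    have := (Finset.mem_filter.1 hj).2
    exact ⟨Option.ne_none_iff_exists'.1 this.1, this.2⟩
  have hinj : Set.InjOn pt (I : Set J) := by
    intro j hj j' hj' he
    by_contra hne
    obtain ⟨⟨z, hz⟩, _⟩ := hIm j hj
    obtain ⟨⟨z', hz'⟩, _⟩ := hIm j' hj'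
    obtain ⟨a, _, ha⟩ := hc' (fun i => decide (i = j))
    obtain ⟨b, _, hb⟩ := hc' (fun i => decide (i = j'))
    have a1 := (ha j z hz).1 (by simp)
    have a2 := (ha j' z' hz').2 (by simp [Ne.symm hne])
    have b1 := (hb j' z' hz').1 (by simp)
    have b2 := (hb j z hz).2 (by simp [hne])
    rw [he] at a1 b2
    have p1 : (0 : ℝ) < 2 ^ kk j := by positivity
    have p2 : (0 : ℝ) < 2 ^ kk j' := by positivity
    nlinarith
  rw [← Finset.card_image_of_injOn hinj]
  apply hF _ (one_le_pow₀ one_le_two)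
  -- level function
  have hsel : ∀ x ∈ I.image pt, ∃ j ∈ I, pt j = x := fun x hx => Finset.mem_image.1 hx
  refine ⟨fun x => if hx : x ∈ I.image pt then
    f0 x + ((c (hsel x hx).choose).getD 0 : ℝ) * 2 ^ kk (hsel x hx).choose else 0, ?_⟩
  intro τ hτ
  obtain ⟨a, ha, h⟩ := hc' (fun j => decide (pt j ∈ τ))
  refine ⟨a, hA a ha, ?_, ?_⟩
  · intro x hx hxτ
    simp only [dif_pos hx]
    obtain ⟨hj, hjx⟩ := (hsel x hx).choose_spec
    set j := (hsel x hx).choose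
    obtain ⟨⟨z, hz⟩, _⟩ := hIm j hj
    have := (h j z hz).2 (by simp [hjx, hxτ])
    rw [hjx] at this
    simp only [hz, Option.getD_some]
    linarith
  · intro x hxτ
    have hx := hτ hxτ
    simp only [dif_pos hx]
    obtain ⟨hj, hjx⟩ := (hsel x hx).choose_spec
    set j := (hsel x hx).choose
    obtain ⟨⟨z, hz⟩, hl⟩ := hIm j hj
    have := (h j z hz).1 (by simp [hjx, hxτ])
    rw [hjx] at this
    simp only [hz, Option.getD_some]
    have : (2 : ℝ) ^ l ≤ 2 ^ kk j := pow_le_pow_right₀ one_le_two hl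
    linarith

lemma geom_alpha (α : ℝ) (hα : 0 < α) (K : ℕ) :
    ∑ l ∈ Finset.range K, ((2 : ℝ) ^ (l + 1)) ^ (-α) ≤ 2 / α := by
  set r : ℝ := (2 : ℝ) ^ (-α) with hr
  have h1 : ∀ l : ℕ, ((2 : ℝ) ^ (l + 1)) ^ (-α) = r * r ^ l := by
    intro l
    rw [hr, ← pow_succ', ← Real.rpow_natCast, ← Real.rpow_natCast, ← Real.rpow_mul (by norm_num),
      ← Real.rpow_mul (by norm_num), mul_comm]
  simp_rw [h1]
  rw [← Finset.mul_sum]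
  have hr0 : 0 < r := by positivity
  have h2 : (2 : ℝ) ^ α * r = 1 := by
    rw [hr, ← Real.rpow_add (by norm_num)]; simp
  have h3 : 1 + α * Real.log 2 ≤ (2 : ℝ) ^ α := by
    rw [Real.rpow_def_of_pos (by norm_num)]
    linarith [Real.add_one_le_exp (Real.log 2 * α)]
  have hl2 : (1 : ℝ) / 2 ≤ Real.log 2 := by linarith [Real.log_two_gt_d9]
  have h4 : r * (1 + α / 2) ≤ 1 := by
    have : 1 + α / 2 ≤ (2 : ℝ) ^ α := by nlinarith
    nlinarith [mul_le_mul_of_nonneg_right this hr0.le]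
  have hr1 : r < 1 := by nlinarith
  have h5 : ∑ i ∈ Finset.range K, r ^ i ≤ (1 - r)⁻¹ := by
    rw [geom_sum_eq hr1.ne, ← neg_div_neg_eq, ← one_div]
    have : 0 ≤ r ^ K := by positivity
    apply div_le_div₀ <;> linarith
  calc r * ∑ i ∈ Finset.range K, r ^ i ≤ r * (1 - r)⁻¹ := by gcongr
    _ ≤ 2 / α := by
      rw [← div_eq_mul_inv, div_le_div_iff₀ (by linarith) hα]
      nlinarith

lemma sum_scales {J : Type*} (I : Finset J) (kk : J → ℕ) (K : ℕ) (hK : ∀ j, kk j ≤ K) (v α : ℝ)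
    (hv : 0 ≤ v) (hα : 0 < α)
    (h : ∀ l : ℕ, ((I.filter (fun j => l ≤ kk j)).card : ℝ) ≤ v * ((2 : ℝ) ^ l) ^ (-α)) :
    ∑ j ∈ I, (kk j : ℝ) ≤ v * (2 / α) := by
  have h1 : ∀ j ∈ I, (kk j : ℝ) = ∑ l ∈ Finset.range K, if l + 1 ≤ kk j then (1 : ℝ) else 0 := by
    intro j _
    rw [← Finset.sum_filter, Finset.sum_const, nsmul_eq_mul, mul_one]
    congr 1
    have : (Finset.range K).filter (fun l => l + 1 ≤ kk j) = Finset.range (kk j) := by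
      ext l
      have := hK j
      simp only [Finset.mem_filter, Finset.mem_range]
      omega
    rw [this, Finset.card_range]
  rw [Finset.sum_congr rfl h1, Finset.sum_comm]
  calc _ ≤ ∑ l ∈ Finset.range K, v * ((2 : ℝ) ^ (l + 1)) ^ (-α) := by
        apply Finset.sum_le_sum
        intro l _
        rw [← Finset.sum_filter, Finset.sum_const, nsmul_eq_mul, mul_one]
        exact h (l + 1)
    _ ≤ _ := by
        rw [← Finset.mul_sum]
        exact mul_le_mul_of_nonneg_left (geom_alpha α hα K) hv

lemma count_cells {J : Type*} [Fintype J] [DecidableEq J] (S : Finset (J → Option ℤ))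
    (Zs : J → Finset ℤ) (y : J → ℝ) (hy : ∀ j, 0 ≤ y j)
    (hS : ∀ c ∈ S, ∀ j z, c j = some z → z ∈ Zs j) (b : ℝ)
    (hb : ∀ c ∈ S, Real.exp (-b) ≤ ∏ j, (if c j = none then 1 else y j)) :
    (S.card : ℝ) ≤ Real.exp (b + ∑ j, ((Zs j).card : ℝ) * y j) := by
  have h1 : (S.card : ℝ) * Real.exp (-b) ≤ ∑ c ∈ S, ∏ j, (if c j = none then 1 else y j) := by
    rw [← nsmul_eq_mul]
    exact Finset.card_nsmul_le_sum _ _ _ hb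
  have h2 : ∑ c ∈ S, ∏ j, (if c j = none then 1 else y j) ≤
      ∑ c ∈ Fintype.piFinset (fun j => Finset.insertNone (Zs j)),
        ∏ j, (if c j = none then 1 else y j) := by
    apply Finset.sum_le_sum_of_subset_of_nonneg
    · intro c hc
      rw [Fintype.mem_piFinset]
      intro j
      rw [Finset.mem_insertNone]
      intro z hz
      exact hS c hc j z hz
    · intro c _ _
      apply Finset.prod_nonneg
      intro j _
      split_ifs
      · exact zero_le_one
      · exact hy j
  have h3 : ∑ c ∈ Fintype.piFinset (fun j => Finset.insertNone (Zs j)),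
        ∏ j, (if c j = none then 1 else y j) = ∏ j, (1 + ((Zs j).card : ℝ) * y j) := by
    rw [← Finset.prod_univ_sum (fun j => Finset.insertNone (Zs j))
      (fun j o => if o = none then 1 else y j)]
    apply Finset.prod_congr rfl
    intro j _
    simp [Finset.sum_insertNone]
  have h4 : ∏ j, (1 + ((Zs j).card : ℝ) * y j) ≤ Real.exp (∑ j, ((Zs j).card : ℝ) * y j) := by
    rw [Real.exp_sum]
    apply Finset.prod_le_prod
    · intro j _
      have := hy j
      positivity
    · intro j _
      linarith [Real.add_one_le_exp (((Zs j).card : ℝ) * y j)]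
  rw [Real.exp_add]
  have h5 : Real.exp (-b) * Real.exp b = 1 := by rw [← Real.exp_add]; simp
  have h6 := (h1.trans h2).trans (h3.le.trans h4)
  have h7 := mul_le_mul_of_nonneg_right h6 (Real.exp_pos b).le
  rw [mul_assoc, h5, mul_one] at h7
  linarith

lemma node_lemma {ι : Type*} (B : Finset ι) (K q : ℕ) (hq : 0 < q)
    (G : ι → (Σ k : Fin K, Fin (64 ^ (k : ℕ) * q)) → ℝ) (h2 : 2 ≤ B.card)
    (hits : ∀ a ∈ B, ∀ b ∈ B, a ≠ b → ∃ k : Fin K, (q : ℝ) ≤ 4 * ((Finset.univ.filter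
      (fun i : Fin (64 ^ (k : ℕ) * q) => 2 * ((7 * (k : ℕ) + 6 : ℕ) : ℝ) + 1 ≤
        |G a ⟨k, i⟩ - G b ⟨k, i⟩|)).card : ℝ)) :
    ∃ (j : Σ k : Fin K, Fin (64 ^ (k : ℕ) * q)) (z : ℤ),
      (B.filter (fun a => G a j ≤ z)).Nonempty ∧
      (B.filter (fun a => (z : ℝ) + 1 ≤ G a j)).Nonempty ∧
      √(B.card : ℝ) ≤ √((B.filter (fun a => G a j ≤ z)).card : ℝ)
        + √((B.filter (fun a => (z : ℝ) + 1 ≤ G a j)).card : ℝ) := by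
  classical
  by_contra hcon
  let cnt : (Σ k : Fin K, Fin (64 ^ (k : ℕ) * q)) → ℝ := fun j =>
    (((B ×ˢ B).filter (fun p => 2 * ((7 * (j.1 : ℕ) + 6 : ℕ) : ℝ) + 1 ≤
      |G p.1 j - G p.2 j|)).card : ℝ)
  have hcnt : ∀ j, 2 ^ (7 * (j.1 : ℕ) + 6) * cnt j ≤ 4 * (B.card : ℝ) ^ 2 := by
    intro j
    by_contra hlt
    push Not at hlt
    obtain ⟨z, hz⟩ := split_lemma B (fun a => G a j) (7 * (j.1 : ℕ) + 6) (by omega) (by omega) hlt.le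
    exact hcon ⟨j, z, hz⟩
  have hqr : (0 : ℝ) < q := by exact_mod_cast hq
  have hBr : (2 : ℝ) ≤ B.card := by exact_mod_cast h2
  have hupper : ∑ j, cnt j < (q : ℝ) * (B.card : ℝ) ^ 2 / 8 := by
    have h1 : ∀ j : (Σ k : Fin K, Fin (64 ^ (k : ℕ) * q)),
        cnt j ≤ 4 * (B.card : ℝ) ^ 2 / 2 ^ (7 * (j.1 : ℕ) + 6) := by
      intro j
      rw [le_div_iff₀ (by positivity), mul_comm]
      exact hcnt j
    calc ∑ j, cnt j ≤ ∑ j : (Σ k : Fin K, Fin (64 ^ (k : ℕ) * q)),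
          4 * (B.card : ℝ) ^ 2 / 2 ^ (7 * (j.1 : ℕ) + 6) := Finset.sum_le_sum fun j _ => h1 j
      _ = ∑ k : Fin K, (q : ℝ) * (B.card : ℝ) ^ 2 / 16 * (1 / 2) ^ (k : ℕ) := by
          rw [Fintype.sum_sigma]
          apply Finset.sum_congr rfl
          intro k _
          dsimp only
          rw [Finset.sum_const, Finset.card_univ, Fintype.card_fin, nsmul_eq_mul]
          push_cast
          have e : (2 : ℝ) ^ (7 * (k : ℕ) + 6) = 64 ^ (k : ℕ) * 2 ^ (k : ℕ) * 64 := by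
            rw [pow_add, pow_mul, ← mul_pow]; norm_num
          rw [e, one_div, inv_pow]
          field_simp
          ring
      _ = (q : ℝ) * (B.card : ℝ) ^ 2 / 16 * ∑ k ∈ Finset.range K, (1 / 2 : ℝ) ^ k := by
          rw [← Finset.mul_sum, Fin.sum_univ_eq_sum_range (fun k => (1 / 2 : ℝ) ^ k)]
      _ < (q : ℝ) * (B.card : ℝ) ^ 2 / 16 * 2 := by
          apply mul_lt_mul_of_pos_left _ (by positivity)
          rw [geom_sum_eq (by norm_num), div_lt_iff_of_neg (by norm_num)]
          have : (0 : ℝ) < (1 / 2) ^ K := by positivity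
          linarith
      _ = _ := by ring
  have hlower : (B.offDiag.card : ℝ) * q ≤ 4 * ∑ j, cnt j := by
    have e : ∑ j, cnt j = ∑ p ∈ B ×ˢ B, ∑ j : (Σ k : Fin K, Fin (64 ^ (k : ℕ) * q)),
        (if 2 * ((7 * (j.1 : ℕ) + 6 : ℕ) : ℝ) + 1 ≤ |G p.1 j - G p.2 j| then (1 : ℝ) else 0) := by
      rw [Finset.sum_comm]
      apply Finset.sum_congr rfl
      intro j _
      simp only [cnt]
      rw [Finset.card_filter]
      push_cast
      rfl
    rw [e, Finset.mul_sum]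
    have hsub : B.offDiag ⊆ B ×ˢ B := by
      intro p hp
      rw [Finset.mem_offDiag] at hp
      exact Finset.mem_product.2 ⟨hp.1, hp.2.1⟩
    refine le_trans ?_ (Finset.sum_le_sum_of_subset_of_nonneg hsub ?_)
    · rw [← nsmul_eq_mul]
      apply Finset.card_nsmul_le_sum
      intro p hp
      rw [Finset.mem_offDiag] at hp
      obtain ⟨k, hk⟩ := hits p.1 hp.1 p.2 hp.2.1 hp.2.2
      refine hk.trans ?_
      apply mul_le_mul_of_nonneg_left _ (by norm_num)
      rw [Fintype.sum_sigma, Finset.card_filter, Nat.cast_sum]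
      refine le_trans (le_of_eq ?_) (Finset.single_le_sum (f := fun k : Fin K =>
        ∑ i : Fin (64 ^ (k : ℕ) * q), (if 2 * ((7 * (k : ℕ) + 6 : ℕ) : ℝ) + 1 ≤
          |G p.1 ⟨k, i⟩ - G p.2 ⟨k, i⟩| then (1 : ℝ) else 0)) ?_ (Finset.mem_univ k))
      · apply Finset.sum_congr rfl
        intro i _
        split_ifs <;> simp
      · intro k _
        apply Finset.sum_nonneg
        intro i _
        split_ifs <;> norm_num
    · intro p _ _
      apply mul_nonneg (by norm_num)
      apply Finset.sum_nonneg
      intro i _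
      split_ifs <;> norm_num
  have hoff : (B.card : ℝ) ^ 2 / 2 ≤ B.offDiag.card := by
    rw [Finset.offDiag_card, Nat.cast_sub (Nat.le_mul_self _)]
    push_cast
    nlinarith
  nlinarith

lemma local_lemma {Ω : Type*} (F : Set (Ω → ℝ)) (v α : ℝ) (hv : 0 < v) (hα : 0 < α) (hα1 : α ≤ 1)
    (hF : DimHyp F v α) (s : Finset Ω) (w : Ω → ℝ) (hw : ∀ x, 0 ≤ w x)
    (hw1 : ∑ x ∈ s, w x = 1) (A : Finset (Ω → ℝ)) (hA : ∀ f ∈ A, f ∈ F) (f0 : Ω → ℝ)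
    (hsep : ∀ f ∈ A, ∀ g ∈ A, f ≠ g → (126 : ℝ) ^ 2 ≤ ∑ x ∈ s, w x * (f x - g x) ^ 2)
    (hball : ∀ f ∈ A, ∑ x ∈ s, w x * (f x - f0 x) ^ 2 ≤ (126 * (2 : ℝ) ^ (1 / α)) ^ 2) :
    Real.log A.card ≤ 136 * v / α := by
  classical
  rcases Nat.lt_or_ge A.card 2 with hN | hN
  · have : Real.log A.card ≤ 0 := by
      apply Real.log_nonpos (by positivity)
      exact_mod_cast (by omega : A.card ≤ 1)
    have : 0 < 136 * v / α := by positivity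
    linarith
  set R : ℝ := (2 : ℝ) ^ (1 / α) with hR
  have hR0 : 0 < R := by positivity
  have hR1 : 1 ≤ R := Real.one_le_rpow one_le_two (by positivity)
  set LN := Real.log A.card with hLN
  have hNr : (2 : ℝ) ≤ A.card := by exact_mod_cast hN
  have hlog2 : (1 : ℝ) / 2 ≤ Real.log 2 := by linarith [Real.log_two_gt_d9]
  have hlog2' : Real.log 2 ≤ 1 := by linarith [Real.log_two_lt_d9]
  have hLN2 : 1 / 2 ≤ LN := hlog2.trans (Real.log_le_log (by norm_num) hNr)
  set q := ⌈8 * LN⌉₊ with hqd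
  have hq1 : 8 * LN ≤ q := Nat.le_ceil _
  have hq2 : (q : ℝ) ≤ 10 * LN := by
    have := Nat.ceil_lt_add_one (show 0 ≤ 8 * LN by linarith)
    rw [← hqd] at this
    linarith
  have hq0 : 0 < q := by
    have : (0 : ℝ) < q := by linarith
    exact_mod_cast this
  obtain ⟨K, hK⟩ : ∃ K : ℕ, ∀ f ∈ A, ∀ g ∈ A, ∀ x ∈ s, |(f x - f0 x) - (g x - f0 x)| < 14 * 4 ^ K := by
    obtain ⟨M, hM⟩ := (((A ×ˢ A) ×ˢ s).finite_toSet.image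
      (fun p : ((Ω → ℝ) × (Ω → ℝ)) × Ω => |(p.1.1 p.2 - f0 p.2) - (p.1.2 p.2 - f0 p.2)|)).bddAbove
    obtain ⟨K, hK⟩ := pow_unbounded_of_one_lt M (show (1 : ℝ) < 4 by norm_num)
    refine ⟨K, fun f hf g hg x hx => ?_⟩
    have := hM ⟨((f, g), x), by simp [hf, hg, hx], rfl⟩
    have h4 : (0 : ℝ) < 4 ^ K := by positivity
    simp only at this
    linarith
  let E : ℕ → ((Ω → ℝ) × (Ω → ℝ)) → Ω → Prop := fun k p x =>
    (14 * 4 ^ k ≤ |(p.1 x - f0 x) - (p.2 x - f0 x)| ∧ |p.1 x - f0 x| ≤ 126 * R * 8 ^ k ∧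
      |p.2 x - f0 x| ≤ 126 * R * 8 ^ k)
  let P : ℕ → Finset ((Ω → ℝ) × (Ω → ℝ)) := fun k =>
    (A ×ˢ A).filter (fun p => ((1 : ℝ) / 64) ^ k ≤ ∑ x ∈ s with E k p x, w x)
  have hsamp : ∀ k : ℕ, ∃ x : Fin (64 ^ k * q) → Ω, ∀ p ∈ P k,
      (q : ℝ) ≤ 4 * ((Finset.univ.filter (fun i => E k p (x i))).card : ℝ) := by
    intro k
    have e : ((1 : ℝ) / 64) ^ k * ((64 ^ k * q : ℕ) : ℝ) = q := by
      push_cast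
      rw [← mul_assoc, ← mul_pow]
      norm_num
    obtain ⟨x, hx⟩ := sampling s w hw hw1 (P k) (E k) (((1 : ℝ) / 64) ^ k)
      (fun p hp => (Finset.mem_filter.1 hp).2)
      ((pow_le_one₀ (by norm_num) (by norm_num)).trans one_le_two) (64 ^ k * q) (2 * LN) (by
        have h1 : (P k).card ≤ A.card * A.card := by
          rw [← Finset.card_product]
          exact Finset.card_le_card (Finset.filter_subset _ _)
        have h2 : Real.exp (2 * LN) = A.card * A.card := by
          rw [two_mul, Real.exp_add, Real.exp_log (by linarith)]
        rw [h2]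
        exact_mod_cast h1) (by rw [e]; linarith)
    rw [e] at hx
    exact ⟨x, hx⟩
  choose x hx using hsamp
  let pt : (Σ k : Fin K, Fin (64 ^ (k : ℕ) * q)) → Ω := fun j => x j.1 j.2
  let kk : (Σ k : Fin K, Fin (64 ^ (k : ℕ) * q)) → ℕ := fun j => j.1
  let Z : (Σ k : Fin K, Fin (64 ^ (k : ℕ) * q)) → ℝ := fun j => 126 * R * 4 ^ kk j
  have hZ : ∀ j, 0 ≤ Z j := fun j => by positivity
  let G : (Ω → ℝ) → (Σ k : Fin K, Fin (64 ^ (k : ℕ) * q)) → ℝ := fun f j =>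
      max (-Z j) (min (Z j) ((f (pt j) - f0 (pt j)) / 2 ^ kk j))
  obtain ⟨S, hS, hScard⟩ := tree_lemma G A.card A le_rfl (by
    intro B hB hB2
    apply node_lemma B K q hq0 G hB2
    intro f hf g hg hfg
    obtain ⟨k, hkK, hk⟩ := pair_lemma s w hw hw1 (fun x => f x - f0 x) (fun x => g x - f0 x) 14
      (126 * R) (by norm_num) (by positivity) K (hK f (hB hf) g (hB hg)) (by
        have := hsep f (hB hf) g (hB hg) hfg
        simp only [sub_sub_sub_cancel_right]
        linarith) (hball f (hB hf)) (hball g (hB hg))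
    refine ⟨⟨k, hkK⟩, (hx k (f, g) ?_).trans ?_⟩
    · exact Finset.mem_filter.2 ⟨Finset.mem_product.2 ⟨hB hf, hB hg⟩, hk⟩
    · apply mul_le_mul_of_nonneg_left _ (by norm_num)
      norm_cast
      apply Finset.card_le_card
      intro i hi
      simp only [Finset.mem_filter, Finset.mem_univ, true_and] at hi ⊢
      obtain ⟨h1, h2, h3⟩ := hi
      have hp2 : (0 : ℝ) < 2 ^ k := by positivity
      have e8 : (8 : ℝ) ^ k = 4 ^ k * 2 ^ k := by rw [← mul_pow]; norm_num
      have e4 : (4 : ℝ) ^ k = 2 ^ k * 2 ^ k := by rw [← mul_pow]; norm_num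
      have c : ∀ u : Ω → ℝ, |u (x k i) - f0 (x k i)| ≤ 126 * R * 8 ^ k →
          G u ⟨⟨k, hkK⟩, i⟩ = (u (x k i) - f0 (x k i)) / 2 ^ k := by
        intro u hu
        apply clamp_eq
        rw [abs_div, abs_of_pos hp2, div_le_iff₀ hp2]
        simp only [Z, kk, pt]
        rw [e8] at hu
        linarith
      rw [c f h2, c g h3, ← sub_div, abs_div, abs_of_pos hp2, le_div_iff₀ hp2]
      simp only at h1
      refine le_trans ?_ h1
      rw [e4, ← mul_assoc]
      apply mul_le_mul_of_nonneg_right _ hp2.le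
      have : ((k : ℝ) + 1) ≤ 2 ^ k := by exact_mod_cast Nat.lt_two_pow_self (n := k)
      push_cast
      linarith)
  -- counting
  let e : (Σ k : Fin K, Fin (64 ^ (k : ℕ) * q)) → ℝ := fun j =>
    Real.log 2 * (15 + 1 / α + 9 * kk j)
  have hcount := count_cells S (fun j => Finset.Icc ⌈-Z j⌉ ⌊Z j⌋) (fun j => Real.exp (-e j))
    (fun j => (Real.exp_pos _).le) (by
      intro c hc j z hz
      have := cell_range (hS c hc) Z (fun a j => clamp_abs (hZ j)) j z hz
      rw [Finset.mem_Icc]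
      exact ⟨Int.ceil_le.2 this.1, Int.le_floor.2 (by linarith [this.2])⟩) (34 * v / α) (by
      intro c hc
      have hdim := cell_dim F v α hF A hA f0 pt kk Z hZ c (hS c hc)
      have e1 : ∏ j, (if c j = none then 1 else Real.exp (-e j)) =
          Real.exp (-∑ j ∈ Finset.univ.filter (fun j => c j ≠ none), e j) := by
        rw [← Finset.sum_neg_distrib, Real.exp_sum, Finset.prod_filter]
        apply Finset.prod_congr rfl
        intro j _
        by_cases h : c j = none <;> simp [h]
      rw [e1]
      apply Real.exp_le_exp.2
      apply neg_le_neg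
      have h0 : ((Finset.univ.filter (fun j => c j ≠ none)).card : ℝ) ≤ v := by
        have := hdim 0
        simpa using this
      have hs := sum_scales (Finset.univ.filter (fun j => c j ≠ none)) kk K
        (fun j => j.1.2.le) v α hv.le hα (by
          intro l
          rw [Finset.filter_filter]
          exact hdim l)
      simp only [e]
      rw [← Finset.mul_sum, Finset.sum_add_distrib, Finset.sum_const, nsmul_eq_mul,
        ← Finset.mul_sum]
      have hα' : 1 ≤ 1 / α := by rw [le_div_iff₀ hα]; linarith
      have h1 : ((Finset.univ.filter (fun j => c j ≠ none)).card : ℝ) * (15 + 1 / α) ≤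
          v * (16 * (1 / α)) :=
        mul_le_mul h0 (by linarith) (by positivity) hv.le
      have h3 : 0 ≤ ((Finset.univ.filter (fun j => c j ≠ none)).card : ℝ) * (15 + 1 / α) +
          9 * ∑ j ∈ Finset.univ.filter (fun j => c j ≠ none), (kk j : ℝ) := by positivity
      refine (mul_le_of_le_one_left h3 hlog2').trans ?_
      have e2 : v * (2 / α) = 2 * v / α := by ring
      have e3 : v * (16 * (1 / α)) = 16 * v / α := by ring
      have e4 : 34 * v / α = 16 * v / α + 9 * (2 * v / α) := by ring
      rw [e4]
      linarith)
  have hY : ∑ j, ((Finset.Icc ⌈-Z j⌉ ⌊Z j⌋).card : ℝ) * Real.exp (-e j) ≤ LN / 4 := by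
    have h1 : ∀ j, ((Finset.Icc ⌈-Z j⌉ ⌊Z j⌋).card : ℝ) * Real.exp (-e j) ≤
        378 / 32768 * (1 / 128) ^ kk j := by
      intro j
      have hc : ((Finset.Icc ⌈-Z j⌉ ⌊Z j⌋).card : ℝ) ≤ 3 * Z j := by
        have hZ1 : 1 ≤ Z j := by
          have : (1 : ℝ) ≤ 4 ^ kk j := one_le_pow₀ (by norm_num)
          simp only [Z]
          nlinarith
        rw [Int.card_Icc]
        have h0 : 0 ≤ ⌊Z j⌋ + 1 - ⌈-Z j⌉ := by
          rw [Int.ceil_neg]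
          have : 0 ≤ ⌊Z j⌋ := Int.floor_nonneg.2 (hZ j)
          omega
        have h2 : (((⌊Z j⌋ + 1 - ⌈-Z j⌉).toNat : ℕ) : ℝ) = ((⌊Z j⌋ + 1 - ⌈-Z j⌉ : ℤ) : ℝ) := by
          exact_mod_cast congrArg (Int.cast : ℤ → ℝ) (Int.toNat_of_nonneg h0)
        rw [h2, Int.ceil_neg]
        push_cast
        have := Int.floor_le (Z j)
        linarith
      have he : Real.exp (-e j) = 1 / (32768 * R * 512 ^ kk j) := by
        rw [Real.exp_neg, one_div]
        congr 1
        simp only [e]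
        rw [mul_add, mul_add, Real.exp_add, Real.exp_add]
        congr 1
        · congr 1
          · rw [← Real.rpow_def_of_pos (by norm_num)]
            norm_num
          · rw [← Real.rpow_def_of_pos (by norm_num)]
        · rw [← Real.rpow_def_of_pos (by norm_num), Real.rpow_mul (by norm_num),
            Real.rpow_natCast]
          norm_num
      rw [he]
      calc _ ≤ 3 * Z j * (1 / (32768 * R * 512 ^ kk j)) := by gcongr
        _ = _ := by
          simp only [Z]
          have : (512 : ℝ) ^ kk j = 4 ^ kk j * 128 ^ kk j := by rw [← mul_pow]; norm_num
          rw [this, one_div (128 : ℝ), inv_pow]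
          field_simp
          norm_num
    calc _ ≤ ∑ j, 378 / 32768 * (1 / 128 : ℝ) ^ kk j := Finset.sum_le_sum fun j _ => h1 j
      _ = ∑ k : Fin K, 378 / 32768 * (q : ℝ) * (1 / 2) ^ (k : ℕ) := by
          rw [Fintype.sum_sigma]
          apply Finset.sum_congr rfl
          intro k _
          simp only [kk]
          rw [Finset.sum_const, Finset.card_univ, Fintype.card_fin, nsmul_eq_mul]
          push_cast
          have : (1 / 2 : ℝ) ^ (k : ℕ) = 64 ^ (k : ℕ) * (1 / 128) ^ (k : ℕ) := by
            rw [← mul_pow]; norm_num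
          rw [this]; ring
      _ = 378 / 32768 * (q : ℝ) * ∑ k ∈ Finset.range K, (1 / 2 : ℝ) ^ k := by
          rw [← Finset.mul_sum, Fin.sum_univ_eq_sum_range (fun k => (1 / 2 : ℝ) ^ k)]
      _ ≤ 378 / 32768 * (q : ℝ) * 2 := by
          apply mul_le_mul_of_nonneg_left _ (by positivity)
          rw [geom_sum_eq (by norm_num), div_le_iff_of_neg (by norm_num)]
          have : (0 : ℝ) < (1 / 2) ^ K := by positivity
          linarith
      _ ≤ _ := by linarith
  have hfin := hScard.trans hcount
  have hsq : √(A.card : ℝ) = Real.exp (LN / 2) := by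
    rw [Real.exp_half, Real.exp_log (by linarith)]
  rw [hsq, Real.exp_le_exp] at hfin
  have e5 : 136 * v / α = 4 * (34 * v / α) := by ring
  rw [e5]
  linarith

lemma dimHyp_scale {Ω : Type*} (F : Set (Ω → ℝ)) (t : ℝ) (ht : 0 < t) (x : ℝ) (σ : Finset Ω)
    (h : Shatters ((fun f : Ω → ℝ => fun y => f y / t) '' F) x σ) : Shatters F (t * x) σ := by
  obtain ⟨h, hh⟩ := h
  refine ⟨fun y => t * h y, fun τ hτ => ?_⟩
  obtain ⟨_, ⟨f, hf, rfl⟩, h1, h2⟩ := hh τ hτ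
  refine ⟨f, hf, fun y hy hyτ => ?_, fun y hy => ?_⟩
  · have := h1 y hy hyτ
    rw [div_le_iff₀ ht] at this
    linarith
  · have := h2 y hy
    rw [le_div_iff₀ ht] at this
    linarith

lemma exists_max_sep {β : Type*} (A : Finset β) (r : β → β → Prop) (hsymm : ∀ a b, r a b → r b a) :
    ∃ A' ⊆ A, (∀ a ∈ A', ∀ b ∈ A', a ≠ b → r a b) ∧ ∀ a ∈ A, a ∉ A' → ∃ b ∈ A', ¬ r a b := by
  classical
  induction A using Finset.induction_on with
  | empty => exact ⟨∅, by simp⟩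
  | insert a A ha ih =>
    obtain ⟨A', hA', h1, h2⟩ := ih
    by_cases h : ∃ b ∈ A', ¬ r a b
    · refine ⟨A', hA'.trans (Finset.subset_insert _ _), h1, ?_⟩
      intro c hc hcA
      rcases Finset.mem_insert.1 hc with rfl | hc
      · exact h
      · exact h2 c hc hcA
    · push Not at h
      refine ⟨insert a A', Finset.insert_subset_insert _ hA', ?_, ?_⟩
      · intro c hc d hd hcd
        rcases Finset.mem_insert.1 hc with rfl | hc' <;> rcases Finset.mem_insert.1 hd with rfl | hd'
        · exact absurd rfl hcd
        · exact h d hd'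
        · exact hsymm _ _ (h c hc')
        · exact h1 c hc' d hd' hcd
      · intro c hc hcA
        rcases Finset.mem_insert.1 hc with rfl | hc
        · exact absurd (Finset.mem_insert_self _ _) hcA
        · obtain ⟨b, hb, hr⟩ := h2 c hc (fun hh => hcA (Finset.mem_insert_of_mem hh))
          exact ⟨b, Finset.mem_insert_of_mem hb, hr⟩

lemma chain_lemma {Ω : Type*} (α : ℝ) (hα : 0 < α) (hα1 : α ≤ 1) (s : Finset Ω) (w : Ω → ℝ)
    (hw : ∀ x, 0 ≤ w x) (hw1 : ∑ x ∈ s, w x = 1) (n : ℕ) :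
    ∀ (F : Set (Ω → ℝ)) (v : ℝ), 0 < v → v < 2 ^ n → DimHyp F v α →
    ∀ (A : Finset (Ω → ℝ)), (∀ f ∈ A, f ∈ F) →
    (∀ f ∈ A, ∀ g ∈ A, f ≠ g → (126 : ℝ) ^ 2 ≤ ∑ x ∈ s, w x * (f x - g x) ^ 2) →
    Real.log A.card ≤ 272 * v / α := by
  classical
  induction n with
  | zero =>
    intro F v hv hv1 hF A hA hsep
    have hle : A.card ≤ 1 := by
      by_contra hlt
      push Not at hlt
      obtain ⟨f, hf, g, hg, hfg⟩ := Finset.one_lt_card.1 hlt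
      have h1 := hsep f hf g hg hfg
      obtain ⟨x, hx, hx1⟩ : ∃ x ∈ s, 1 ≤ |f x - g x| := by
        by_contra hc
        push Not at hc
        have : ∑ x ∈ s, w x * (f x - g x) ^ 2 ≤ ∑ x ∈ s, w x := by
          apply Finset.sum_le_sum
          intro x hx
          apply mul_le_of_le_one_right (hw x)
          rw [← sq_abs]
          exact pow_le_one₀ (abs_nonneg _) (hc x hx).le
        rw [hw1] at this
        norm_num at h1
        linarith
      have key : ∀ f ∈ F, ∀ g ∈ F, 1 ≤ f x - g x → False := by
        intro f hf g hg hd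
        have := hF 1 le_rfl {x} ⟨g, by
          intro τ hτ
          by_cases hxt : x ∈ τ
          · refine ⟨f, hf, ?_, ?_⟩
            · intro y hy hyt
              rw [Finset.mem_singleton] at hy
              subst hy
              exact absurd hxt hyt
            · intro y hy
              have := Finset.mem_singleton.1 (hτ hy)
              subst this
              linarith
          · refine ⟨g, hg, ?_, ?_⟩
            · intro y hy _
              exact le_rfl
            · intro y hy
              have := Finset.mem_singleton.1 (hτ hy)
              subst this
              exact absurd hy hxt⟩
        simp at this hv1
        linarith
      rcases le_abs.1 hx1 with h | h
      · exact key f (hA f hf) g (hA g hg) h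
      · exact key g (hA g hg) f (hA f hf) (by linarith)
    have : Real.log A.card ≤ 0 := by
      apply Real.log_nonpos (by positivity)
      exact_mod_cast hle
    have : 0 < 272 * v / α := by positivity
    linarith
  | succ n ih =>
    intro F v hv hvn hF A hA hsep
    rcases A.eq_empty_or_nonempty with rfl | hAne
    · simp
      positivity
    set R : ℝ := (2 : ℝ) ^ (1 / α) with hR
    have hR0 : 0 < R := by positivity
    have hR1 : 1 ≤ R := Real.one_le_rpow one_le_two (by positivity)
    have hRα : R ^ (-α) = 1 / 2 := by
      rw [hR, ← Real.rpow_mul (by norm_num)]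
      have : 1 / α * -α = -1 := by field_simp
      rw [this, Real.rpow_neg_one]
      norm_num
    let r : (Ω → ℝ) → (Ω → ℝ) → Prop := fun f g =>
      (126 * R) ^ 2 ≤ ∑ x ∈ s, w x * (f x - g x) ^ 2
    obtain ⟨A', hA', h1, h2⟩ := exists_max_sep A r (by
      intro f g h
      simp only [r] at h ⊢
      refine h.trans (le_of_eq ?_)
      apply Finset.sum_congr rfl
      intro x _
      ring)
    let sc : (Ω → ℝ) → (Ω → ℝ) := fun f y => f y / R
    have hscinj : Function.Injective sc := by
      intro f g h
      funext y
      have := congrFun h y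
      simp only [sc] at this
      field_simp at this
      exact this
    have hF' : DimHyp (sc '' F) (v / 2) α := by
      intro x hx σ hσ
      have h := hF (R * x) (by nlinarith) σ (dimHyp_scale F R hR0 x σ hσ)
      rw [Real.mul_rpow hR0.le (by linarith), hRα] at h
      linarith
    have hB := ih (sc '' F) (v / 2) (by linarith) (by rw [pow_succ] at hvn; linarith) hF'
      (A'.image sc) (by
        intro f hf
        obtain ⟨g, hg, rfl⟩ := Finset.mem_image.1 hf
        exact ⟨g, hA g (hA' hg), rfl⟩) (by
        intro f hf g hg hfg
        obtain ⟨f, hf', rfl⟩ := Finset.mem_image.1 hf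
        obtain ⟨g, hg', rfl⟩ := Finset.mem_image.1 hg
        have := h1 f hf' g hg' (fun h => hfg (by rw [h]))
        simp only [r] at this
        have e : ∑ x ∈ s, w x * (sc f x - sc g x) ^ 2 =
            (∑ x ∈ s, w x * (f x - g x) ^ 2) / R ^ 2 := by
          rw [Finset.sum_div]
          apply Finset.sum_congr rfl
          intro x _
          simp only [sc]
          field_simp
        rw [e, le_div_iff₀ (by positivity)]
        rw [mul_pow] at this
        exact this)
    rw [Finset.card_image_of_injective _ hscinj] at hB
    let Ab : (Ω → ℝ) → Finset (Ω → ℝ) := fun f0 =>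
      A.filter (fun f => ∑ x ∈ s, w x * (f x - f0 x) ^ 2 ≤ (126 * R) ^ 2)
    have hAb : ∀ f0, ((Ab f0).card : ℝ) ≤ Real.exp (136 * v / α) := by
      intro f0
      have h := local_lemma F v α hv hα hα1 hF s w hw hw1 (Ab f0)
        (fun f hf => hA f (Finset.mem_filter.1 hf).1) f0
        (fun f hf g hg => hsep f (Finset.mem_filter.1 hf).1 g (Finset.mem_filter.1 hg).1)
        (fun f hf => (Finset.mem_filter.1 hf).2)
      rcases Nat.eq_zero_or_pos (Ab f0).card with h0 | h0
      · rw [h0]; simp; positivity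
      · exact (Real.log_le_iff_le_exp (by exact_mod_cast h0)).1 h
    have hcover : A ⊆ A'.biUnion Ab := by
      intro f hf
      rw [Finset.mem_biUnion]
      by_cases hfA : f ∈ A'
      · refine ⟨f, hfA, Finset.mem_filter.2 ⟨hf, ?_⟩⟩
        simp
        positivity
      · obtain ⟨g, hg, hr⟩ := h2 f hf hfA
        simp only [r, not_le] at hr
        exact ⟨g, hg, Finset.mem_filter.2 ⟨hf, hr.le⟩⟩
    have hA'ne : 0 < A'.card := by
      rw [Finset.card_pos, Finset.nonempty_iff_ne_empty]
      rintro rfl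
      obtain ⟨a, ha⟩ := hAne
      have := hcover ha
      simp at this
    have hA'r : (0 : ℝ) < A'.card := by exact_mod_cast hA'ne
    have hcard : (A.card : ℝ) ≤ A'.card * Real.exp (136 * v / α) := by
      have h := (Finset.card_le_card hcover).trans Finset.card_biUnion_le
      have h' : (A.card : ℝ) ≤ ∑ f0 ∈ A', ((Ab f0).card : ℝ) := by exact_mod_cast h
      refine h'.trans ?_
      rw [← nsmul_eq_mul]
      exact Finset.sum_le_card_nsmul _ _ _ (fun f _ => hAb f)
    have hApos : (0 : ℝ) < A.card := by exact_mod_cast Finset.card_pos.2 hAne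
    have hl := Real.log_le_log hApos hcard
    rw [Real.log_mul hA'r.ne' (Real.exp_pos _).ne', Real.log_exp] at hl
    have e : 272 * v / α = 272 * (v / 2) / α + 136 * v / α := by ring
    rw [e]
    linarith

/-- If `v(F, t x) ≤ v·x^{-α}` for all `x ≥ 1` (with `0 < v`, `0 < α ≤ 1`),
then `D(F, C t) ≤ (C/α)·v`, where `C` is an absolute constant. -/
theorem entropy_le_of_polynomial_dimension :
    ∃ C > (0 : ℝ), ∀ (Ω : Type) (F : Set (Ω → ℝ)) (t v α : ℝ),
      0 < t → 0 < v → 0 < α → α ≤ 1 →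
      (∀ x : ℝ, 1 ≤ x → combDim F (t * x) ≤ ENNReal.ofReal (v * x ^ (-α))) →
      KPentropy F (C * t) ≤ ENNReal.ofReal ((C / α) * v) := by
  refine ⟨272, by norm_num, ?_⟩
  intro Ω F t v α ht hv hα hα1 hdim
  classical
  apply iSup₂_le
  rintro m ⟨s, w, f, hw, hw1, hf, hsep⟩
  apply ENNReal.ofReal_le_ofReal
  let sc : (Ω → ℝ) → (Ω → ℝ) := fun f y => f y / t
  have hH : DimHyp (sc '' F) v α := by
    intro x hx σ hσ
    have h1 := dimHyp_scale F t ht x σ hσ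
    have h2 : (σ.card : ℝ≥0∞) ≤ combDim F (t * x) :=
      le_iSup₂ (f := fun (σ : Finset Ω) (_ : Shatters F (t * x) σ) => (σ.card : ℝ≥0∞)) σ h1
    have h3 := h2.trans (hdim x hx)
    have h4 : 0 ≤ v * x ^ (-α) := by positivity
    rw [← ENNReal.ofReal_natCast] at h3
    exact (ENNReal.ofReal_le_ofReal_iff h4).1 h3
  have hsc : ∀ g h : Ω → ℝ, ∑ x ∈ s, w x * (sc g x - sc h x) ^ 2 =
      (∑ x ∈ s, w x * (g x - h x) ^ 2) / t ^ 2 := by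
    intro g h
    rw [Finset.sum_div]
    apply Finset.sum_congr rfl
    intro x _
    simp only [sc]
    field_simp
  have hlt : ∀ i j : Fin m, i < j →
      (126 : ℝ) ^ 2 ≤ ∑ x ∈ s, w x * (sc (f i) x - sc (f j) x) ^ 2 := by
    intro i j hij
    rw [hsc, le_div_iff₀ (by positivity)]
    refine le_trans ?_ (hsep i j hij)
    nlinarith [sq_pos_of_pos ht]
  have hne : ∀ i j : Fin m, i ≠ j →
      (126 : ℝ) ^ 2 ≤ ∑ x ∈ s, w x * (sc (f i) x - sc (f j) x) ^ 2 := by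
    intro i j hij
    rcases lt_or_gt_of_ne hij with h | h
    · exact hlt i j h
    · refine (hlt j i h).trans (le_of_eq ?_)
      apply Finset.sum_congr rfl
      intro x _
      ring
  have hinj : Function.Injective (fun i => sc (f i)) := by
    intro i j hij
    by_contra h
    have h1 := hne i j h
    simp only at hij
    rw [hij] at h1
    norm_num at h1
  obtain ⟨n, hn⟩ := pow_unbounded_of_one_lt v (one_lt_two : (1 : ℝ) < 2)
  have := chain_lemma α hα hα1 s w hw hw1 n (sc '' F) v hv hn hH
    (Finset.univ.image (fun i => sc (f i))) (by
      intro g hg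
      obtain ⟨i, _, rfl⟩ := Finset.mem_image.1 hg
      exact ⟨f i, hf i, rfl⟩) (by
      intro g hg h hh hgh
      obtain ⟨i, _, rfl⟩ := Finset.mem_image.1 hg
      obtain ⟨j, _, rfl⟩ := Finset.mem_image.1 hh
      exact hne i j (fun e => hgh (by rw [e])))
  rw [Finset.card_image_of_injective _ hinj, Finset.card_univ, Fintype.card_fin] at this
  refine this.trans (le_of_eq ?_)
  ring
end

section
/- Let a > 2 and let F be a class of real-valued functions on a set Ω. Then for all t > 0, D(F, t) ≤ C·(log a)·Σ_{j=0}^∞ 4^j · v(F, c·a^j·t), where C, c > 0 are absolute constants. -/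
open MeasureTheory Filter
open scoped ENNReal NNReal Pointwise BigOperators

open Classical in
noncomputable def cells {α ι : Type*} (lo hi : ι → α → Prop) (P : Finset ι) (A : Finset α) :
    Finset (Finset ι) :=
  P.powerset.filter (fun S => ∀ U ⊆ S, ∃ f ∈ A, ∀ p ∈ S, (p ∈ U → hi p f) ∧ (p ∉ U → lo p f))

lemma cells_mono {α ι : Type*} (lo hi : ι → α → Prop) (P : Finset ι) {A B : Finset α}
    (h : A ⊆ B) : cells lo hi P A ⊆ cells lo hi P B := by
  intro S hS
  simp only [cells, Finset.mem_filter] at hS ⊢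
  refine ⟨hS.1, fun U hU => ?_⟩
  obtain ⟨f, hf, h2⟩ := hS.2 U hU
  exact ⟨f, h hf, h2⟩

open Classical in
lemma cells_split {α ι : Type*} (lo hi : ι → α → Prop) (P : Finset ι)
    (hd : ∀ p f, lo p f → hi p f → False) (A : Finset α) (p : ι) (hp : p ∈ P) :
    (cells lo hi P (A.filter (lo p))).card + (cells lo hi P (A.filter (hi p))).card
      ≤ (cells lo hi P A).card := by
  set X := cells lo hi P (A.filter (lo p)) with hX
  set Y := cells lo hi P (A.filter (hi p)) with hY
  have hpX : ∀ S ∈ X, p ∉ S := by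
    intro S hS hpS
    simp only [hX, cells, Finset.mem_filter] at hS
    obtain ⟨f, hf, h2⟩ := hS.2 S (Finset.Subset.refl _)
    exact hd p f hf.2 ((h2 p hpS).1 hpS)
  have hpY : ∀ S ∈ Y, p ∉ S := by
    intro S hS hpS
    simp only [hY, cells, Finset.mem_filter] at hS
    obtain ⟨f, hf, h2⟩ := hS.2 ∅ (Finset.empty_subset _)
    exact hd p f ((h2 p hpS).2 (Finset.notMem_empty _)) hf.2
  have hinj : ((X ∩ Y).image (insert p)).card = (X ∩ Y).card := by
    apply Finset.card_image_of_injOn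
    intro S hS T hT hST
    have h1 := hpX S (Finset.mem_inter.1 hS).1
    have h2 := hpX T (Finset.mem_inter.1 hT).1
    have h3 : (insert p S).erase p = (insert p T).erase p := by
      have : insert p S = insert p T := hST
      rw [this]
    rwa [Finset.erase_insert h1, Finset.erase_insert h2] at h3
  have hdisj : Disjoint (X ∪ Y) ((X ∩ Y).image (insert p)) := by
    rw [Finset.disjoint_left]
    intro S hS hS2
    obtain ⟨T, hT, rfl⟩ := Finset.mem_image.1 hS2
    rcases Finset.mem_union.1 hS with h | h
    · exact hpX _ h (Finset.mem_insert_self _ _)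
    · exact hpY _ h (Finset.mem_insert_self _ _)
  have hsub : (X ∪ Y) ∪ ((X ∩ Y).image (insert p)) ⊆ cells lo hi P A := by
    apply Finset.union_subset
    · apply Finset.union_subset
      · exact cells_mono _ _ _ (Finset.filter_subset _ _)
      · exact cells_mono _ _ _ (Finset.filter_subset _ _)
    · intro S hS
      obtain ⟨T, hT, rfl⟩ := Finset.mem_image.1 hS
      have hTX := (Finset.mem_inter.1 hT).1
      have hTY := (Finset.mem_inter.1 hT).2
      have hpT := hpX T hTX
      simp only [hX, hY, cells, Finset.mem_filter, Finset.mem_powerset] at hTX hTY ⊢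
      refine ⟨Finset.insert_subset hp hTX.1, fun U hU => ?_⟩
      have hU' : U.erase p ⊆ T := by
        intro q hq
        have := hU (Finset.mem_of_mem_erase hq)
        exact (Finset.mem_insert.1 this).resolve_left (Finset.ne_of_mem_erase hq)
      by_cases hpU : p ∈ U
      · obtain ⟨f, hf, h2⟩ := hTY.2 _ hU'
        refine ⟨f, hf.1, fun q hq => ?_⟩
        rcases Finset.mem_insert.1 hq with rfl | hq
        · exact ⟨fun _ => hf.2, fun h => absurd hpU h⟩
        · have hqp : q ≠ p := fun h => hpT (h ▸ hq)
          exact ⟨fun h => (h2 q hq).1 (Finset.mem_erase.2 ⟨hqp, h⟩),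
            fun h => (h2 q hq).2 (fun h' => h (Finset.mem_of_mem_erase h'))⟩
      · obtain ⟨f, hf, h2⟩ := hTX.2 _ hU'
        refine ⟨f, hf.1, fun q hq => ?_⟩
        rcases Finset.mem_insert.1 hq with rfl | hq
        · exact ⟨fun h => absurd h hpU, fun _ => hf.2⟩
        · have hqp : q ≠ p := fun h => hpT (h ▸ hq)
          exact ⟨fun h => (h2 q hq).1 (Finset.mem_erase.2 ⟨hqp, h⟩),
            fun h => (h2 q hq).2 (fun h' => h (Finset.mem_of_mem_erase h'))⟩
  have := Finset.card_le_card hsub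
  rw [Finset.card_union_of_disjoint hdisj, hinj, Finset.card_union_add_card_inter] at this
  exact this

open Classical in
lemma tree_bound {α ι : Type*} (lo hi : ι → α → Prop) (P : Finset ι)
    (hd : ∀ p f, lo p f → hi p f → False) (G : Finset α)
    (hG : ∀ A ⊆ G, 2 ≤ A.card → ∃ p ∈ P, (A.filter (lo p)).Nonempty ∧ (A.filter (hi p)).Nonempty ∧
      √(A.card : ℝ) ≤ √((A.filter (lo p)).card : ℝ) + √((A.filter (hi p)).card : ℝ)) :
    ∀ (n : ℕ), ∀ A ⊆ G, A.card = n → √(A.card : ℝ) ≤ ((cells lo hi P A).card : ℝ) := by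
  intro n
  induction n using Nat.strong_induction_on with
  | _ n ih =>
    intro A hA hn
    rcases Nat.lt_or_ge A.card 2 with h | h
    · rcases Finset.eq_empty_or_nonempty A with h0 | ⟨f, hf⟩
      · subst h0; simp
      · have : A.card = 1 := by
          have := Finset.card_pos.2 ⟨f, hf⟩; omega
        rw [this]
        have : (∅ : Finset ι) ∈ cells lo hi P A := by
          simp only [cells, Finset.mem_filter, Finset.mem_powerset]
          exact ⟨Finset.empty_subset _, fun U _ => ⟨f, hf, by simp⟩⟩
        have := Finset.card_pos.2 ⟨_, this⟩
        simp only [Nat.cast_one, Real.sqrt_one]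
        exact_mod_cast this
    · obtain ⟨p, hp, ⟨f1, h1⟩, ⟨f2, h2⟩, h3⟩ := hG A hA h
      have hlt1 : (A.filter (lo p)).card < A.card := by
        apply Finset.card_lt_card
        refine ⟨Finset.filter_subset _ _, fun hh => ?_⟩
        have := hh (Finset.mem_filter.1 h2).1
        exact hd p f2 (Finset.mem_filter.1 this).2 (Finset.mem_filter.1 h2).2
      have hlt2 : (A.filter (hi p)).card < A.card := by
        apply Finset.card_lt_card
        refine ⟨Finset.filter_subset _ _, fun hh => ?_⟩
        have := hh (Finset.mem_filter.1 h1).1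
        exact hd p f1 (Finset.mem_filter.1 h1).2 (Finset.mem_filter.1 this).2
      have i1 := ih _ (hn ▸ hlt1) (A.filter (lo p)) ((Finset.filter_subset _ _).trans hA) rfl
      have i2 := ih _ (hn ▸ hlt2) (A.filter (hi p)) ((Finset.filter_subset _ _).trans hA) rfl
      have i3 : (((cells lo hi P (A.filter (lo p))).card + (cells lo hi P (A.filter (hi p))).card : ℕ) : ℝ)
        ≤ ((cells lo hi P A).card : ℝ) := by
          exact_mod_cast cells_split lo hi P hd A p hp
      push_cast at i3
      linarith

lemma count_bound {ι : Type*} (P : Finset ι) (T : Finset (Finset ι)) (hT : T ⊆ P.powerset)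
    (θ : ι → ℝ) (hθ : ∀ p, 0 ≤ θ p) (Θ : ℝ) (h : ∀ S ∈ T, Θ ≤ ∏ p ∈ S, θ p) :
    (T.card : ℝ) * Θ ≤ Real.exp (∑ p ∈ P, θ p) := by
  calc (T.card : ℝ) * Θ = ∑ S ∈ T, Θ := by simp
    _ ≤ ∑ S ∈ T, ∏ p ∈ S, θ p := Finset.sum_le_sum h
    _ ≤ ∑ S ∈ P.powerset, ∏ p ∈ S, θ p :=
        Finset.sum_le_sum_of_subset_of_nonneg hT (fun S _ _ => Finset.prod_nonneg fun p _ => hθ p)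
    _ = ∏ p ∈ P, (1 + θ p) := by rw [Finset.prod_one_add]
    _ ≤ ∏ p ∈ P, Real.exp (θ p) := by
        apply Finset.prod_le_prod
        · intro p _; have := hθ p; linarith
        · intro p _; rw [add_comm]; exact Real.add_one_le_exp _
    _ = _ := (Real.exp_sum _ _).symm

lemma exp_neg_bound {z : ℝ} (h0 : 0 ≤ z) (h1 : z ≤ 1) : Real.exp (-z) ≤ 1 - z / 2 := by
  rw [Real.exp_neg]
  have := Real.add_one_le_exp z
  rw [inv_le_comm₀ (Real.exp_pos _) (by linarith)]
  refine le_trans ?_ this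
  rw [inv_le_iff_one_le_mul₀ (by linarith)]
  nlinarith

lemma sampling_s3 {Ω Q : Type*} (s : Finset Ω) (w : Ω → ℝ) (hw : ∀ x, 0 ≤ w x)
    (hw1 : ∑ x ∈ s, w x = 1) (I : Finset Q) (Z : Q → Ω → ℝ) (hZ0 : ∀ q x, 0 ≤ Z q x)
    (hZ1 : ∀ q x, Z q x ≤ 1) (q0 : ℝ) (hq : ∀ q ∈ I, q0 ≤ ∑ x ∈ s, w x * Z q x) (n : ℕ)
    (hn : (I.card : ℝ) * Real.exp (-(n * q0 / 4)) < 1) :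
    ∃ x : ℕ → Ω, ∀ q ∈ I, n * q0 / 4 ≤ ∑ i ∈ Finset.range n, Z q (x i) := by
  classical
  obtain ⟨y0, hy0, hwy0⟩ : ∃ y ∈ s, 0 < w y := by
    by_contra hcon
    push Not at hcon
    have := Finset.sum_nonpos hcon
    linarith
  have key : ∀ m : ℕ, ∃ x : ℕ → Ω, ∑ q ∈ I, Real.exp (-∑ i ∈ Finset.range m, Z q (x i)) ≤
      (I.card : ℝ) * Real.exp (-(m * q0 / 2)) := by
    intro m
    induction m with
    | zero => exact ⟨fun _ => y0, by simp⟩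
    | succ m ih =>
      obtain ⟨x, hx⟩ := ih
      set c : Q → ℝ := fun q => Real.exp (-∑ i ∈ Finset.range m, Z q (x i)) with hc
      have hc0 : ∀ q, 0 ≤ c q := fun q => (Real.exp_pos _).le
      have havg : ∑ y ∈ s, w y * ∑ q ∈ I, c q * Real.exp (-Z q y) ≤
          (∑ q ∈ I, c q) * Real.exp (-(q0 / 2)) := by
        have e1 : ∑ y ∈ s, w y * ∑ q ∈ I, c q * Real.exp (-Z q y) =
            ∑ q ∈ I, c q * ∑ y ∈ s, w y * Real.exp (-Z q y) := by
          simp only [Finset.mul_sum]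
          rw [Finset.sum_comm]
          refine Finset.sum_congr rfl fun q _ => Finset.sum_congr rfl fun y _ => by ring
        rw [e1, Finset.sum_mul]
        apply Finset.sum_le_sum
        intro q hqI
        apply mul_le_mul_of_nonneg_left _ (hc0 q)
        calc ∑ y ∈ s, w y * Real.exp (-Z q y) ≤ ∑ y ∈ s, (w y - (w y * Z q y) / 2) := by
              apply Finset.sum_le_sum
              intro y _
              have := mul_le_mul_of_nonneg_left (exp_neg_bound (hZ0 q y) (hZ1 q y)) (hw y)
              linarith
          _ = 1 - (∑ y ∈ s, w y * Z q y) / 2 := by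
              rw [Finset.sum_sub_distrib, hw1, Finset.sum_div]
          _ ≤ 1 - q0 / 2 := by have := hq q hqI; linarith
          _ ≤ Real.exp (-(q0 / 2)) := by have := Real.add_one_le_exp (-(q0 / 2)); linarith
      obtain ⟨y, hy⟩ : ∃ y, ∑ q ∈ I, c q * Real.exp (-Z q y) ≤
          (∑ q ∈ I, c q) * Real.exp (-(q0 / 2)) := by
        by_contra hcon
        push Not at hcon
        have : ∑ y ∈ s, w y * ((∑ q ∈ I, c q) * Real.exp (-(q0 / 2))) <
            ∑ y ∈ s, w y * ∑ q ∈ I, c q * Real.exp (-Z q y) := by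
          apply Finset.sum_lt_sum
          · intro y _; exact mul_le_mul_of_nonneg_left (hcon y).le (hw y)
          · exact ⟨y0, hy0, mul_lt_mul_of_pos_left (hcon y0) hwy0⟩
        rw [← Finset.sum_mul, hw1, one_mul] at this
        linarith
      refine ⟨Function.update x m y, ?_⟩
      have e2 : ∀ q, Real.exp (-∑ i ∈ Finset.range (m + 1), Z q (Function.update x m y i)) =
          c q * Real.exp (-Z q y) := by
        intro q
        rw [Finset.sum_range_succ, Function.update_self, neg_add, Real.exp_add]
        congr 3
        apply Finset.sum_congr rfl
        intro i hi
        rw [Function.update_of_ne (Finset.mem_range.1 hi).ne]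
      simp only [e2]
      refine hy.trans ?_
      have := mul_le_mul_of_nonneg_right hx (Real.exp_pos (-(q0 / 2))).le
      refine this.trans (le_of_eq ?_)
      rw [mul_assoc, ← Real.exp_add]
      congr 2
      push_cast
      ring
  obtain ⟨x, hx⟩ := key n
  refine ⟨x, fun q hqI => ?_⟩
  by_contra hcon
  push Not at hcon
  have h1 : Real.exp (-∑ i ∈ Finset.range n, Z q (x i)) ≤
      ∑ q ∈ I, Real.exp (-∑ i ∈ Finset.range n, Z q (x i)) :=
    Finset.single_le_sum (f := fun q => Real.exp (-∑ i ∈ Finset.range n, Z q (x i)))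
      (fun q _ => (Real.exp_pos _).le) hqI
  have h2 : Real.exp (-(n * q0 / 4)) < Real.exp (-∑ i ∈ Finset.range n, Z q (x i)) :=
    Real.exp_lt_exp.2 (by linarith)
  have h3 : Real.exp (-(n * q0 / 2)) = Real.exp (-(n * q0 / 4)) * Real.exp (-(n * q0 / 4)) := by
    rw [← Real.exp_add]; congr 1; ring
  rw [h3] at hx
  have h4 := Real.exp_pos (-(n * q0 / 4))
  nlinarith

lemma half_step {N a b b' : ℝ} (hN : 0 < N) (hab : a + b = N) (hb0 : 0 ≤ b) (hb : 2 * b ≤ N)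
    (hb' : 0 ≤ b') (h : √a + √b' ≤ √N) : 2 * b' ≤ b := by
  have ha : 0 ≤ a := by linarith
  have h1 := Real.sq_sqrt ha
  have h2 := Real.sq_sqrt hb'
  have h3 := Real.sq_sqrt hN.le
  have p1 := Real.sqrt_nonneg a
  have p2 := Real.sqrt_nonneg b'
  have p3 := Real.sqrt_pos.2 hN
  have h4 : √a ≤ √N := Real.sqrt_le_sqrt (by linarith)
  have h5 : √N * √b' ≤ b := by nlinarith
  have h6 : N * b' ≤ b * b := by
    have := mul_le_mul h5 h5 (by positivity) hb0
    nlinarith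
  have h7 : N * (2 * b') ≤ N * b := by nlinarith
  exact le_of_mul_le_mul_left h7 hN

lemma chain_tail {α : Type*} (A : Finset α) (Z : α → ℤ) (hA : A.Nonempty)
    (h : ∀ m : ℤ, (A.filter (fun f => Z f < m)).card = 0 ∨
      (A.filter (fun f => m + 1 ≤ Z f)).card = 0 ∨
      √((A.filter (fun f => Z f < m)).card : ℝ) + √((A.filter (fun f => m + 1 ≤ Z f)).card : ℝ)
        < √(A.card : ℝ)) :
    ∃ k : ℤ, ∀ m : ℕ, ((A.filter (fun f => k + m ≤ Z f)).card : ℝ) * 2 ^ (m + 1) ≤ A.card ∧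
      ((A.filter (fun f => Z f < k - 1 - m)).card : ℝ) * 2 ^ (m + 1) ≤ A.card := by
  set b : ℤ → ℕ := fun m => (A.filter (fun f => m ≤ Z f)).card with hb
  set c : ℤ → ℕ := fun m => (A.filter (fun f => Z f < m)).card with hc
  have hbc : ∀ m, c m + b m = A.card := by
    intro m
    have := Finset.card_filter_add_card_filter_not (s := A) (fun f => Z f < m)
    simpa only [not_lt] using this
  have hN : 0 < A.card := Finset.card_pos.2 hA
  have hNr : (0 : ℝ) < A.card := by exact_mod_cast hN
  have hbcr : ∀ m, (c m : ℝ) + b m = A.card := fun m => by exact_mod_cast hbc m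
  have h' : ∀ m : ℤ, c m = 0 ∨ b (m + 1) = 0 ∨ √(c m : ℝ) + √(b (m + 1) : ℝ) < √(A.card : ℝ) := h
  have up : ∀ m, 2 * b m ≤ A.card → 2 * (b (m + 1) : ℝ) ≤ b m := by
    intro m hm
    have hmr : 2 * (b m : ℝ) ≤ A.card := by exact_mod_cast hm
    rcases h' m with h0 | h0 | h0
    · have := hbc m; omega
    · rw [h0]; simp
    · exact half_step hNr (hbcr m) (Nat.cast_nonneg _) hmr (Nat.cast_nonneg _) h0.le
  have down : ∀ m, 2 * c (m + 1) ≤ A.card → 2 * (c m : ℝ) ≤ c (m + 1) := by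
    intro m hm
    have hmr : 2 * (c (m + 1) : ℝ) ≤ A.card := by exact_mod_cast hm
    rcases h' m with h0 | h0 | h0
    · rw [h0]; simp
    · have := hbc (m + 1); omega
    · exact half_step hNr (by have := hbcr (m + 1); linarith) (Nat.cast_nonneg _) hmr
        (Nat.cast_nonneg _) (by linarith : √(b (m + 1) : ℝ) + √(c m : ℝ) ≤ _)
  obtain ⟨k, hk, hkmin⟩ : ∃ k : ℤ, 2 * b k ≤ A.card ∧ ∀ z : ℤ, 2 * b z ≤ A.card → k ≤ z := by
    apply Int.exists_least_of_bdd (P := fun k => 2 * b k ≤ A.card)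
    · obtain ⟨f0, hf0, hmin⟩ := Finset.exists_min_image A Z hA
      refine ⟨Z f0, fun z hz => ?_⟩
      by_contra hlt
      push Not at hlt
      have : b z = A.card := by
        simp only [hb]
        rw [Finset.filter_true_of_mem]
        intro f hf
        have := hmin f hf
        omega
      omega
    · obtain ⟨f0, hf0, hmax⟩ := Finset.exists_max_image A Z hA
      refine ⟨Z f0 + 1, ?_⟩
      have : b (Z f0 + 1) = 0 := by
        simp only [hb]
        rw [Finset.card_eq_zero, Finset.filter_eq_empty_iff]
        intro f hf
        have := hmax f hf
        omega
      omega
  have hk1 : 2 * c (k - 1) ≤ A.card := by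
    have h1 : ¬ (2 * b (k - 1) ≤ A.card) := fun hh => by have := hkmin _ hh; omega
    have := hbc (k - 1)
    omega
  refine ⟨k, fun m => ?_⟩
  change (b (k + m) : ℝ) * 2 ^ (m + 1) ≤ A.card ∧ (c (k - 1 - m) : ℝ) * 2 ^ (m + 1) ≤ A.card
  have two_pow : ∀ m : ℕ, (2 : ℝ) ≤ 2 ^ (m + 1) := fun m => by
    have : (1 : ℝ) ≤ 2 ^ m := one_le_pow₀ (by norm_num)
    rw [pow_succ]; linarith
  constructor
  · induction m with
    | zero =>
      have : 2 * (b k : ℝ) ≤ A.card := by exact_mod_cast hk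
      simp; linarith
    | succ m ih =>
      have h1 : 2 * (b (k + m) : ℝ) ≤ A.card := by
        have := mul_le_mul_of_nonneg_left (two_pow m) (Nat.cast_nonneg (b (k + m)) : (0:ℝ) ≤ _)
        linarith
      have h2 := up (k + m) (by exact_mod_cast h1)
      have e : k + ((m + 1 : ℕ) : ℤ) = k + m + 1 := by push_cast; ring
      rw [e, pow_succ]
      have : (0:ℝ) < 2 ^ (m + 1) := by positivity
      nlinarith
  · induction m with
    | zero =>
      have : 2 * (c (k - 1) : ℝ) ≤ A.card := by exact_mod_cast hk1
      simp; linarith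
    | succ m ih =>
      have h1 : 2 * (c (k - 1 - m) : ℝ) ≤ A.card := by
        have := mul_le_mul_of_nonneg_left (two_pow m) (Nat.cast_nonneg (c (k - 1 - m)) : (0:ℝ) ≤ _)
        linarith
      have e : k - 1 - m = k - 1 - ((m + 1 : ℕ) : ℤ) + 1 := by push_cast; ring
      have h2 := down (k - 1 - ((m + 1 : ℕ) : ℤ)) (by rw [← e]; exact_mod_cast h1)
      rw [← e] at h2
      rw [pow_succ]
      have : (0:ℝ) < 2 ^ (m + 1) := by positivity
      nlinarith

lemma six_bound (D : ℕ) : ((D : ℝ) + 1) ^ 6 ≤ 17 ^ 6 * (3 / 2 : ℝ) ^ D := by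
  have h1 : 1 + (D : ℝ) * (3 / 50) ≤ (1 + 3 / 50 : ℝ) ^ D :=
    one_add_mul_le_pow (by norm_num) D
  have h2 : (D : ℝ) + 1 ≤ 17 * (1 + 3 / 50 : ℝ) ^ D := by
    have : (0 : ℝ) ≤ D := Nat.cast_nonneg _
    linarith
  calc ((D : ℝ) + 1) ^ 6 ≤ (17 * (1 + 3 / 50 : ℝ) ^ D) ^ 6 := by gcongr
    _ = 17 ^ 6 * ((1 + 3 / 50 : ℝ) ^ 6) ^ D := by rw [mul_pow, ← pow_mul, ← pow_mul, mul_comm D]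
    _ ≤ 17 ^ 6 * (3 / 2 : ℝ) ^ D := by gcongr; norm_num

lemma pow_layer (B W : ℕ) (h : W ≤ B) : (3 / 2 : ℝ) ^ W =
    1 + ∑ m ∈ Finset.range B, if m + 1 ≤ W then (1 / 2) * (3 / 2 : ℝ) ^ m else 0 := by
  rw [← Finset.sum_filter]
  have : (Finset.range B).filter (fun m => m + 1 ≤ W) = Finset.range W := by
    ext m; simp; omega
  rw [this, ← Finset.mul_sum]
  have := geom_sum_eq (by norm_num : (3/2:ℝ) ≠ 1) W
  rw [this]; ring

lemma chain_moment {α : Type*} (A : Finset α) (Z : α → ℤ)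
    (h : ∀ m : ℤ, (A.filter (fun f => Z f < m)).card = 0 ∨
      (A.filter (fun f => m + 1 ≤ Z f)).card = 0 ∨
      √((A.filter (fun f => Z f < m)).card : ℝ) + √((A.filter (fun f => m + 1 ≤ Z f)).card : ℝ)
        < √(A.card : ℝ)) :
    ∑ f ∈ A, ∑ g ∈ A, (((Z f - Z g).natAbs : ℝ) + 1) ^ 6 ≤ 17 ^ 6 * 25 * (A.card : ℝ) ^ 2 := by
  classical
  rcases Finset.eq_empty_or_nonempty A with h0 | hA
  · subst h0; simp
  obtain ⟨k, hk⟩ := chain_tail A Z hA h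
  set W : α → ℕ := fun f => (Z f - k).natAbs with hW
  have hcard : ∀ m : ℕ, ((A.filter (fun f => m + 1 ≤ W f)).card : ℝ) * 2 ^ m ≤ 2 * A.card := by
    intro m
    have hsub : A.filter (fun f => m + 1 ≤ W f) ⊆
        A.filter (fun f => k + m ≤ Z f) ∪ A.filter (fun f => Z f < k - m) := by
      intro f hf
      simp only [Finset.mem_filter, Finset.mem_union, hW] at hf ⊢
      have := hf.2
      rcases le_or_gt (k + m) (Z f) with h1 | h1
      · left; exact ⟨hf.1, h1⟩
      · right; exact ⟨hf.1, by omega⟩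
    have h1 : ((A.filter (fun f => m + 1 ≤ W f)).card : ℝ) ≤
        (A.filter (fun f => k + m ≤ Z f)).card + (A.filter (fun f => Z f < k - m)).card := by
      exact_mod_cast (Finset.card_le_card hsub).trans (Finset.card_union_le _ _)
    have h2 := (hk m).1
    have h3 : ((A.filter (fun f => Z f < k - m)).card : ℝ) * 2 ^ m ≤ A.card := by
      cases m with
      | zero => simp only [pow_zero, mul_one]; exact_mod_cast Finset.card_filter_le _ _
      | succ m =>
        have := (hk m).2
        have e : k - 1 - (m : ℤ) = k - ((m + 1 : ℕ) : ℤ) := by push_cast; ring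
        rwa [e] at this
    have h4 : (0 : ℝ) ≤ (A.filter (fun f => k + m ≤ Z f)).card * 2 ^ m := by positivity
    rw [pow_succ] at h2
    have : (0:ℝ) < 2 ^ m := by positivity
    nlinarith
  obtain ⟨B, hB⟩ : ∃ B : ℕ, ∀ f ∈ A, W f ≤ B :=
    ⟨A.sup W, fun f hf => Finset.le_sup hf⟩
  have hsum : ∑ f ∈ A, (3 / 2 : ℝ) ^ W f ≤ 5 * A.card := by
    have e1 : ∑ f ∈ A, (3 / 2 : ℝ) ^ W f = A.card + ∑ m ∈ Finset.range B,
        ((A.filter (fun f => m + 1 ≤ W f)).card : ℝ) * ((1 / 2) * (3 / 2 : ℝ) ^ m) := by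
      rw [Finset.sum_congr rfl (fun f hf => pow_layer B (W f) (hB f hf)), Finset.sum_add_distrib,
        Finset.sum_comm]
      congr 1
      · simp
      · apply Finset.sum_congr rfl
        intro m _
        rw [← Finset.sum_filter, Finset.sum_const, nsmul_eq_mul]
    have e2 : ∀ m ∈ Finset.range B, ((A.filter (fun f => m + 1 ≤ W f)).card : ℝ) *
        ((1 / 2) * (3 / 2 : ℝ) ^ m) ≤ A.card * (3 / 4 : ℝ) ^ m := by
      intro m _
      have h1 := hcard m
      have e : (3 / 2 : ℝ) ^ m = 2 ^ m * (3 / 4 : ℝ) ^ m := by rw [← mul_pow]; norm_num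
      rw [e]
      have : (0:ℝ) < (3 / 4) ^ m := by positivity
      nlinarith
    have e3 : ∑ m ∈ Finset.range B, (3 / 4 : ℝ) ^ m ≤ 4 := by
      rw [geom_sum_eq (by norm_num)]
      have : (0:ℝ) < (3 / 4) ^ B := by positivity
      rw [div_le_iff_of_neg (by norm_num)]
      linarith
    have e4 := Finset.sum_le_sum e2
    rw [← Finset.mul_sum] at e4
    have : (0:ℝ) ≤ A.card := Nat.cast_nonneg _
    rw [e1]
    nlinarith
  calc ∑ f ∈ A, ∑ g ∈ A, (((Z f - Z g).natAbs : ℝ) + 1) ^ 6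
      ≤ ∑ f ∈ A, ∑ g ∈ A, 17 ^ 6 * ((3 / 2 : ℝ) ^ W f * (3 / 2 : ℝ) ^ W g) := by
        apply Finset.sum_le_sum; intro f _
        apply Finset.sum_le_sum; intro g _
        refine (six_bound _).trans ?_
        rw [← pow_add]
        gcongr
        · norm_num
        · simp only [hW]; omega
    _ = 17 ^ 6 * ((∑ f ∈ A, (3 / 2 : ℝ) ^ W f) * ∑ g ∈ A, (3 / 2 : ℝ) ^ W g) := by
        rw [Finset.sum_mul_sum, Finset.mul_sum]
        simp_rw [Finset.mul_sum]
    _ ≤ 17 ^ 6 * ((5 * A.card) * (5 * A.card)) := by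
        gcongr
    _ = _ := by ring

open Classical in
lemma coord_moment {α : Type*} (A : Finset α) (X : α → ℝ) (τ : ℝ) (hτ : 0 < τ) (K : ℕ)
    (h : ∀ m : ℤ, -(K : ℤ) ≤ m → m ≤ K → (A.filter (fun f => X f ≤ m * τ)).Nonempty →
      (A.filter (fun f => m * τ + τ ≤ X f)).Nonempty →
      √((A.filter (fun f => X f ≤ m * τ)).card : ℝ) +
        √((A.filter (fun f => m * τ + τ ≤ X f)).card : ℝ) < √(A.card : ℝ)) :
    ∑ f ∈ A, ∑ g ∈ A, (if |X f| ≤ K * τ ∧ |X g| ≤ K * τ then (|X f - X g| / τ) ^ 6 else 0)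
      ≤ 17 ^ 6 * 25 * (A.card : ℝ) ^ 2 := by
  set Y : α → ℝ := fun f => max (-(K * τ)) (min (K * τ) (X f)) with hY
  set Z : α → ℤ := fun f => ⌊Y f / τ⌋ with hZ
  have hKτ : 0 ≤ (K : ℝ) * τ := by positivity
  have hYle : ∀ f, Y f ≤ K * τ := fun f => max_le (by linarith) (min_le_left _ _)
  have hYge : ∀ f, -(K * τ) ≤ Y f := fun f => le_max_left _ _
  have hZge : ∀ f (m : ℤ), m ≤ Z f ↔ m * τ ≤ Y f := fun f m => by
    rw [hZ, Int.le_floor, le_div_iff₀ hτ]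
  have hZlt : ∀ f (m : ℤ), Z f < m ↔ Y f < m * τ := fun f m => by
    rw [hZ, Int.floor_lt, div_lt_iff₀ hτ]
  have hchain := chain_moment A Z (by
    intro m
    by_cases h1 : -(K : ℤ) ≤ m
    · by_cases h2 : m ≤ K
      · have s1 : A.filter (fun f => Z f < m) ⊆ A.filter (fun f => X f ≤ m * τ) := by
          intro f hf
          rw [Finset.mem_filter] at hf ⊢
          refine ⟨hf.1, ?_⟩
          have h3 := (hZlt f m).1 hf.2
          have h4 : (m : ℝ) * τ ≤ K * τ := by
            have : (m : ℝ) ≤ K := by exact_mod_cast h2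
            gcongr
          have h5 : min (K * τ) (X f) < m * τ := lt_of_le_of_lt (le_max_right _ _) h3
          rcases min_lt_iff.1 h5 with h6 | h6
          · linarith
          · exact h6.le
        have s2 : A.filter (fun f => m + 1 ≤ Z f) ⊆ A.filter (fun f => m * τ + τ ≤ X f) := by
          intro f hf
          rw [Finset.mem_filter] at hf ⊢
          refine ⟨hf.1, ?_⟩
          have h3 := (hZge f (m + 1)).1 hf.2
          push_cast at h3
          have h4 : -(K : ℝ) * τ ≤ m * τ := by
            have : -(K : ℝ) ≤ m := by exact_mod_cast h1
            gcongr
          rcases le_max_iff.1 h3 with h6 | h6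
          · linarith
          · have := h6.trans (min_le_right _ _); linarith
        by_cases e1 : (A.filter (fun f => Z f < m)).card = 0
        · exact Or.inl e1
        by_cases e2 : (A.filter (fun f => m + 1 ≤ Z f)).card = 0
        · exact Or.inr (Or.inl e2)
        right; right
        have n1 := Finset.card_pos.1 (Nat.pos_of_ne_zero e1)
        have n2 := Finset.card_pos.1 (Nat.pos_of_ne_zero e2)
        refine lt_of_le_of_lt (add_le_add ?_ ?_) (h m h1 h2 (n1.mono s1) (n2.mono s2))
        · exact Real.sqrt_le_sqrt (by exact_mod_cast Finset.card_le_card s1)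
        · exact Real.sqrt_le_sqrt (by exact_mod_cast Finset.card_le_card s2)
      · right; left
        rw [Finset.card_eq_zero, Finset.filter_eq_empty_iff]
        intro f _ hf
        have h3 := (hZge f (m + 1)).1 hf
        have h4 : (K : ℝ) ≤ m := by exact_mod_cast (not_le.1 h2).le
        push_cast at h3
        have := hYle f
        nlinarith
    · left
      rw [Finset.card_eq_zero, Finset.filter_eq_empty_iff]
      intro f _ hf
      have h3 := (hZlt f m).1 hf
      have h4 : (m : ℝ) ≤ -(K : ℝ) := by exact_mod_cast (not_le.1 h1).le
      have := hYge f
      nlinarith)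
  refine le_trans ?_ hchain
  apply Finset.sum_le_sum; intro f _
  apply Finset.sum_le_sum; intro g _
  split_ifs with hfg
  · have hYX : ∀ f, |X f| ≤ K * τ → Y f = X f := by
      intro f hf
      have := abs_le.1 hf
      simp only [hY]
      rw [min_eq_right this.2, max_eq_right this.1]
    rw [← hYX f hfg.1, ← hYX g hfg.2]
    gcongr
    rw [← abs_of_pos hτ, ← abs_div, sub_div]
    have f1 := Int.floor_le (Y f / τ)
    have f2 := Int.lt_floor_add_one (Y f / τ)
    have g1 := Int.floor_le (Y g / τ)
    have g2 := Int.lt_floor_add_one (Y g / τ)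
    have e : ((Z f - Z g).natAbs : ℝ) = |(Z f : ℝ) - Z g| := by
      rw [Nat.cast_natAbs]; push_cast; rfl
    rw [e]
    have a1 := le_abs_self ((Z f : ℝ) - Z g)
    have a2 := neg_abs_le ((Z f : ℝ) - Z g)
    rw [abs_le]
    simp only [hZ] at a1 a2 ⊢
    constructor <;> linarith
  · positivity

noncomputable def psi (a : ℝ) (k : ℕ) (u : ℝ) : ℝ :=
  if a ^ (2 * k) / 2 ≤ u ∧ u < a ^ (2 * k + 2) / 2 then 4 * u ^ 2 / a ^ (4 * k + 4) else 0

lemma psi_nonneg {a : ℝ} (ha : 2 < a) (k : ℕ) (u : ℝ) : 0 ≤ psi a k u := by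
  unfold psi; split_ifs
  · have : 0 < a := by linarith
    positivity
  · exact le_rfl

lemma psi_le_one {a : ℝ} (ha : 2 < a) (k : ℕ) (u : ℝ) : psi a k u ≤ 1 := by
  have ha0 : 0 < a := by linarith
  unfold psi; split_ifs with h
  · rw [div_le_one (by positivity)]
    have h1 : 0 < a ^ (2 * k) := by positivity
    have h0 : 0 ≤ u := by linarith [h.1]
    have : u ^ 2 ≤ (a ^ (2 * k + 2) / 2) ^ 2 := by gcongr; exact h.2.le
    have e : (a ^ (2 * k + 2) / 2) ^ 2 = a ^ (4 * k + 4) / 4 := by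
      rw [div_pow, ← pow_mul]; norm_num; ring
    rw [e] at this; linarith
  · exact zero_le_one

lemma psi_le_six {a : ℝ} (ha : 2 < a) (k : ℕ) (u : ℝ) (_hu : 0 ≤ u) :
    psi a k u ≤ 64 * u ^ 6 / a ^ (12 * k + 4) := by
  have ha0 : 0 < a := by linarith
  unfold psi; split_ifs with h
  · rw [div_le_div_iff₀ (by positivity) (by positivity)]
    have h1 : a ^ (2 * k) ≤ 2 * u := by linarith [h.1]
    have h2 : (a ^ (2 * k)) ^ 4 ≤ (2 * u) ^ 4 := by gcongr
    have e : a ^ (12 * k + 4) = (a ^ (2 * k)) ^ 4 * a ^ (4 * k + 4) := by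
      rw [← pow_mul, ← pow_add]; congr 1; ring
    rw [e]
    calc 4 * u ^ 2 * ((a ^ (2 * k)) ^ 4 * a ^ (4 * k + 4))
        ≤ 4 * u ^ 2 * ((2 * u) ^ 4 * a ^ (4 * k + 4)) := by gcongr
      _ = _ := by ring
  · positivity

lemma layers {a : ℝ} (ha : 2 < a) (J : ℕ) (u : ℝ) (hu : 0 ≤ u) (h : u < a ^ (2 * J) / 2) :
    u ^ 2 ≤ 1 / 4 + ∑ k ∈ Finset.range J, a ^ (4 * k + 4) / 4 * psi a k u := by
  have ha0 : 0 < a := by linarith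
  induction J with
  | zero => simp at h ⊢; nlinarith
  | succ J ih =>
    rw [Finset.sum_range_succ]
    have hp := psi_nonneg ha J u
    by_cases h1 : u < a ^ (2 * J) / 2
    · have := ih h1
      have : 0 ≤ a ^ (4 * J + 4) / 4 * psi a J u := by positivity
      linarith
    · have h2 : psi a J u = 4 * u ^ 2 / a ^ (4 * J + 4) := by
        unfold psi; rw [if_pos]; exact ⟨not_lt.1 h1, h⟩
      have h3 : a ^ (4 * J + 4) / 4 * psi a J u = u ^ 2 := by
        rw [h2]; field_simp
      have h4 : 0 ≤ ∑ k ∈ Finset.range J, a ^ (4 * k + 4) / 4 * psi a k u :=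
        Finset.sum_nonneg fun k _ => mul_nonneg (by positivity) (psi_nonneg ha k u)
      linarith

lemma sum_half (J : ℕ) : ∑ k ∈ Finset.range J, (1 / 2 : ℝ) ^ k ≤ 2 := by
  rw [geom_sum_eq (by norm_num)]
  have : (0:ℝ) < (1 / 2) ^ J := by positivity
  rw [div_le_iff_of_neg (by norm_num)]
  linarith

noncomputable def pk (a : ℝ) (k : ℕ) : ℝ := 1 / (2 ^ k * a ^ (4 * k + 4))

lemma exists_type {Ω : Type*} (s : Finset Ω) (w : Ω → ℝ) (hw : ∀ x, 0 ≤ w x)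
    (hw1 : ∑ x ∈ s, w x = 1) {a : ℝ} (ha : 2 < a) (J : ℕ) (d : Ω → ℝ) (hd : ∀ x, 0 ≤ d x)
    (hdJ : ∀ x, d x < a ^ (2 * J) / 2) (h1 : 1 ≤ ∑ x ∈ s, w x * d x ^ 2) :
    ∃ k < J, pk a k ≤ ∑ x ∈ s, w x * psi a k (d x) := by
  have ha0 : 0 < a := by linarith
  by_contra hcon
  push Not at hcon
  have h2 : ∑ x ∈ s, w x * d x ^ 2 ≤ ∑ x ∈ s, w x * (1 / 4 +
      ∑ k ∈ Finset.range J, a ^ (4 * k + 4) / 4 * psi a k (d x)) := by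
    apply Finset.sum_le_sum; intro x _
    exact mul_le_mul_of_nonneg_left (layers ha J _ (hd x) (hdJ x)) (hw x)
  have h3 : ∑ x ∈ s, w x * (1 / 4 +
      ∑ k ∈ Finset.range J, a ^ (4 * k + 4) / 4 * psi a k (d x)) =
      1 / 4 + ∑ k ∈ Finset.range J, a ^ (4 * k + 4) / 4 * ∑ x ∈ s, w x * psi a k (d x) := by
    simp only [mul_add, Finset.sum_add_distrib, ← Finset.sum_mul, hw1, one_mul]
    congr 1
    simp only [Finset.mul_sum]
    rw [Finset.sum_comm]
    refine Finset.sum_congr rfl fun q _ => Finset.sum_congr rfl fun y _ => by ring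
  have h4 : ∑ k ∈ Finset.range J, a ^ (4 * k + 4) / 4 * ∑ x ∈ s, w x * psi a k (d x) ≤
      ∑ k ∈ Finset.range J, (1 / 4) * (1 / 2 : ℝ) ^ k := by
    apply Finset.sum_le_sum; intro k hk
    have := (hcon k (Finset.mem_range.1 hk)).le
    calc a ^ (4 * k + 4) / 4 * ∑ x ∈ s, w x * psi a k (d x) ≤ a ^ (4 * k + 4) / 4 * pk a k := by
          gcongr
      _ = _ := by unfold pk; rw [one_div_pow]; field_simp
  rw [← Finset.mul_sum] at h4
  have := sum_half J
  linarith

lemma trunc_bound {Ω : Type*} (s : Finset Ω) (w : Ω → ℝ) (hw : ∀ x, 0 ≤ w x)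
    {a : ℝ} (ha : 2 < a) (k : ℕ) (f g : Ω → ℝ)
    (hf : ∑ x ∈ s, w x * f x ^ 2 ≤ a ^ 2) (hg : ∑ x ∈ s, w x * g x ^ 2 ≤ a ^ 2) (B : ℝ)
    (hB : 2 ^ (k + 1) * a ^ (2 * k + 3) ≤ B)
    (h : pk a k ≤ ∑ x ∈ s, w x * psi a k |f x - g x|) :
    pk a k / 2 ≤ ∑ x ∈ s, w x * (if |f x| ≤ B ∧ |g x| ≤ B then psi a k |f x - g x| else 0) := by
  have ha0 : 0 < a := by linarith
  have hB0 : 0 < B := lt_of_lt_of_le (by positivity) hB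
  have hpt : ∀ x, psi a k |f x - g x| ≤
      (if |f x| ≤ B ∧ |g x| ≤ B then psi a k |f x - g x| else 0) + f x ^ 2 / B ^ 2 + g x ^ 2 / B ^ 2 := by
    intro x
    have n1 : 0 ≤ f x ^ 2 / B ^ 2 := by positivity
    have n2 : 0 ≤ g x ^ 2 / B ^ 2 := by positivity
    split_ifs with hc
    · linarith
    · have hp := psi_le_one ha k |f x - g x|
      have aux : ∀ y : ℝ, ¬ |y| ≤ B → 1 ≤ y ^ 2 / B ^ 2 := by
        intro y hy
        rw [le_div_iff₀ (by positivity), one_mul, ← sq_abs y]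
        gcongr; exact (not_le.1 hy).le
      by_cases h1 : |f x| ≤ B
      · have := aux (g x) (fun h2 => hc ⟨h1, h2⟩); linarith
      · have := aux (f x) h1; linarith
  have h2 : ∑ x ∈ s, w x * psi a k |f x - g x| ≤
      ∑ x ∈ s, w x * (if |f x| ≤ B ∧ |g x| ≤ B then psi a k |f x - g x| else 0) +
      (∑ x ∈ s, w x * f x ^ 2) / B ^ 2 + (∑ x ∈ s, w x * g x ^ 2) / B ^ 2 := by
    rw [Finset.sum_div, Finset.sum_div, ← Finset.sum_add_distrib, ← Finset.sum_add_distrib]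
    apply Finset.sum_le_sum; intro x _
    have := mul_le_mul_of_nonneg_left (hpt x) (hw x)
    refine this.trans (le_of_eq ?_)
    ring
  have h3 : a ^ 2 / B ^ 2 ≤ pk a k / 4 := by
    have e1 : (2 ^ (k + 1) * a ^ (2 * k + 3)) ^ 2 ≤ B ^ 2 := by gcongr
    have e2 : (1 : ℝ) ≤ 2 ^ k := one_le_pow₀ (by norm_num)
    unfold pk
    rw [div_div, div_le_div_iff₀ (by positivity) (by positivity)]
    have e3 : (2 ^ (k + 1) * a ^ (2 * k + 3)) ^ 2 = a ^ 2 * (2 ^ k * a ^ (4 * k + 4) * 4) * 2 ^ k := by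
      ring
    rw [e3] at e1
    have : a ^ 2 * (2 ^ k * a ^ (4 * k + 4) * 4) * 1 ≤ a ^ 2 * (2 ^ k * a ^ (4 * k + 4) * 4) * 2 ^ k := by
      gcongr
    linarith
  have h4 : (∑ x ∈ s, w x * f x ^ 2) / B ^ 2 ≤ a ^ 2 / B ^ 2 := by gcongr
  have h5 : (∑ x ∈ s, w x * g x ^ 2) / B ^ 2 ≤ a ^ 2 / B ^ 2 := by gcongr
  linarith

noncomputable def tau (a : ℝ) (k : ℕ) : ℝ := (1 / 136) * a ^ k

lemma tau_pos {a : ℝ} (ha : 2 < a) (k : ℕ) : 0 < tau a k := by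
  have : 0 < a := by linarith
  unfold tau; positivity

noncomputable def Zt {Ω : Type*} (a : ℝ) (k : ℕ) (B : ℝ) (f g : Ω → ℝ) (x : Ω) : ℝ :=
  if |f x| ≤ B ∧ |g x| ≤ B then psi a k |f x - g x| else 0

open Classical in
lemma node {Ω : Type*} (A : Finset (Ω → ℝ)) {a : ℝ} (ha : 2 < a) (J : ℕ) (n K : ℕ → ℕ)
    (hn : ∀ k, 0 < n k) (xs : ℕ → ℕ → Ω) (Ty : ℕ → (Ω → ℝ) → (Ω → ℝ) → Prop)
    (hT : ∀ f ∈ A, ∀ g ∈ A, f ≠ g → ∃ k < J, Ty k f g)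
    (hs : ∀ k < J, ∀ f ∈ A, ∀ g ∈ A, Ty k f g →
      n k * pk a k / 8 ≤ ∑ i ∈ Finset.range (n k), Zt a k (K k * tau a k) f g (xs k i))
    (hA : 2 ≤ A.card) :
    ∃ k < J, ∃ i < n k, ∃ m : ℤ, -(K k : ℤ) ≤ m ∧ m ≤ K k ∧
      (A.filter (fun f => f (xs k i) ≤ m * tau a k)).Nonempty ∧
      (A.filter (fun f => m * tau a k + tau a k ≤ f (xs k i))).Nonempty ∧
      √(A.card : ℝ) ≤ √((A.filter (fun f => f (xs k i) ≤ m * tau a k)).card : ℝ) +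
        √((A.filter (fun f => m * tau a k + tau a k ≤ f (xs k i))).card : ℝ) := by
  have ha0 : 0 < a := by linarith
  by_contra hcon
  push Not at hcon
  have hcoord : ∀ k < J, ∀ i < n k, ∑ f ∈ A, ∑ g ∈ A, Zt a k (K k * tau a k) f g (xs k i) ≤
      64 * (tau a k) ^ 6 / a ^ (12 * k + 4) * (17 ^ 6 * 25 * (A.card : ℝ) ^ 2) := by
    intro k hk i hi
    have h1 := coord_moment A (fun f => f (xs k i)) (tau a k) (tau_pos ha k) (K k)
      (fun m m1 m2 m3 m4 => hcon k hk i hi m m1 m2 m3 m4)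
    have hτ := tau_pos ha k
    refine le_trans ?_ (mul_le_mul_of_nonneg_left h1 (by positivity))
    rw [Finset.mul_sum]
    apply Finset.sum_le_sum; intro f _
    rw [Finset.mul_sum]
    apply Finset.sum_le_sum; intro g _
    unfold Zt
    split_ifs
    · refine (psi_le_six ha k _ (abs_nonneg _)).trans (le_of_eq ?_)
      field_simp
    · simp
  set T : ℕ → ℕ := fun k => ((A ×ˢ A).filter (fun q => Ty k q.1 q.2)).card with hTdef
  have hTk : ∀ k < J, (T k : ℝ) ≤ (1 / 8) * (1 / 2 : ℝ) ^ k * (A.card : ℝ) ^ 2 := by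
    intro k hk
    have hnk : (0 : ℝ) < n k := by exact_mod_cast hn k
    have hZ0 : ∀ f g x, 0 ≤ Zt a k (K k * tau a k) (Ω := Ω) f g x := by
      intro f g x; unfold Zt; split_ifs
      · exact psi_nonneg ha _ _
      · exact le_rfl
    have h1 : (T k : ℝ) * (n k * pk a k / 8) ≤
        ∑ i ∈ Finset.range (n k), ∑ f ∈ A, ∑ g ∈ A, Zt a k (K k * tau a k) f g (xs k i) := by
      calc (T k : ℝ) * (n k * pk a k / 8)
          = ∑ q ∈ (A ×ˢ A).filter (fun q => Ty k q.1 q.2), (n k * pk a k / 8) := by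
            simp [hTdef]
        _ ≤ ∑ q ∈ (A ×ˢ A).filter (fun q => Ty k q.1 q.2),
            ∑ i ∈ Finset.range (n k), Zt a k (K k * tau a k) q.1 q.2 (xs k i) := by
            apply Finset.sum_le_sum
            intro q hq
            rw [Finset.mem_filter, Finset.mem_product] at hq
            exact hs k hk _ hq.1.1 _ hq.1.2 hq.2
        _ ≤ ∑ q ∈ A ×ˢ A,
            ∑ i ∈ Finset.range (n k), Zt a k (K k * tau a k) q.1 q.2 (xs k i) := by
            apply Finset.sum_le_sum_of_subset_of_nonneg (Finset.filter_subset _ _)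
            intro q _ _
            exact Finset.sum_nonneg fun i _ => hZ0 _ _ _
        _ = _ := by
            rw [Finset.sum_comm]
            apply Finset.sum_congr rfl
            intro i _
            rw [Finset.sum_product]
    have h2 : ∑ i ∈ Finset.range (n k), ∑ f ∈ A, ∑ g ∈ A, Zt a k (K k * tau a k) f g (xs k i) ≤
        n k * (64 * (tau a k) ^ 6 / a ^ (12 * k + 4) * (17 ^ 6 * 25 * (A.card : ℝ) ^ 2)) := by
      have := Finset.sum_le_sum (fun i hi => hcoord k hk i (Finset.mem_range.1 hi))
      simpa using this
    have h3 : (T k : ℝ) * (pk a k / 8) ≤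
        64 * (tau a k) ^ 6 / a ^ (12 * k + 4) * (17 ^ 6 * 25 * (A.card : ℝ) ^ 2) := by
      have : n k * ((T k : ℝ) * (pk a k / 8)) ≤
        n k * (64 * (tau a k) ^ 6 / a ^ (12 * k + 4) * (17 ^ 6 * 25 * (A.card : ℝ) ^ 2)) := by
        linarith
      exact le_of_mul_le_mul_left this hnk
    have h4 : 64 * (tau a k) ^ 6 / a ^ (12 * k + 4) * (17 ^ 6 * 25 * (A.card : ℝ) ^ 2) =
        (12800 / 262144 * (2 ^ k / a ^ (2 * k)) * (A.card : ℝ) ^ 2) * (pk a k / 8) := by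
      unfold tau pk
      have e1 : a ^ (12 * k + 4) = a ^ (6 * k) * (a ^ (2 * k) * a ^ (4 * k + 4)) := by
        rw [← pow_add, ← pow_add]; congr 1; ring
      have e2 : (1 / 136 * a ^ k) ^ 6 = (1 / 136) ^ 6 * a ^ (6 * k) := by
        rw [mul_pow, ← pow_mul, mul_comm k]
      rw [e1, e2]
      field_simp
      norm_num
    have hpk : 0 < pk a k / 8 := by unfold pk; positivity
    rw [h4] at h3
    have h5 := le_of_mul_le_mul_right h3 hpk
    have h6 : (2 : ℝ) ^ k / a ^ (2 * k) ≤ (1 / 2) ^ k := by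
      rw [div_le_iff₀ (by positivity), pow_mul, ← mul_pow]
      gcongr
      nlinarith
    refine h5.trans ?_
    have h7 : (12800 / 262144 : ℝ) ≤ 1 / 8 := by norm_num
    gcongr
  have hcover : (A.card : ℝ) ^ 2 - A.card ≤ ∑ k ∈ Finset.range J, (T k : ℝ) := by
    have hsub : A.offDiag ⊆ (Finset.range J).biUnion
        (fun k => (A ×ˢ A).filter (fun q => Ty k q.1 q.2)) := by
      intro q hq
      rw [Finset.mem_offDiag] at hq
      obtain ⟨k, hk, hty⟩ := hT q.1 hq.1 q.2 hq.2.1 hq.2.2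
      simp only [Finset.mem_biUnion, Finset.mem_range, Finset.mem_filter, Finset.mem_product]
      exact ⟨k, hk, ⟨hq.1, hq.2.1⟩, hty⟩
    have h1 := (Finset.card_le_card hsub).trans Finset.card_biUnion_le
    have h2 : ((A.offDiag.card : ℕ) : ℝ) ≤ ∑ k ∈ Finset.range J, (T k : ℝ) := by
      exact_mod_cast h1
    have h3 : A.offDiag.card + A.card = A.card * A.card := by
      rw [Finset.offDiag_card]
      exact Nat.sub_add_cancel (Nat.le_mul_self _)
    have h3r : (A.offDiag.card : ℝ) + A.card = A.card * A.card := by exact_mod_cast h3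
    nlinarith
  have hup : ∑ k ∈ Finset.range J, (T k : ℝ) ≤ 1 / 4 * (A.card : ℝ) ^ 2 := by
    have h1 := Finset.sum_le_sum (fun k hk => hTk k (Finset.mem_range.1 hk))
    rw [← Finset.sum_mul, ← Finset.mul_sum] at h1
    have h2 := sum_half J
    have : (0:ℝ) ≤ (A.card : ℝ) ^ 2 := by positivity
    nlinarith
  have hAr : (2 : ℝ) ≤ A.card := by exact_mod_cast hA
  nlinarith

lemma cell_card {Ω ι : Type*} (F : Set (Ω → ℝ)) (S : Finset ι) (x : ι → Ω) (m : ι → ℝ) (τ : ℝ)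
    (hτ : 0 < τ)
    (h : ∀ U ⊆ S, ∃ f ∈ F, ∀ p ∈ S, (p ∈ U → m p + τ ≤ f (x p)) ∧ (p ∉ U → f (x p) ≤ m p)) :
    ∃ σ : Finset Ω, σ.card = S.card ∧ Shatters F τ σ := by
  classical
  have hinj : Set.InjOn x S := by
    intro p hp q hq hpq
    by_contra hne
    obtain ⟨f, _, hf⟩ := h {p} (by simpa using hp)
    obtain ⟨g, _, hg⟩ := h {q} (by simpa using hq)
    have f1 := (hf p hp).1 (by simp)
    have f2 := (hf q hq).2 (by simpa using fun e => hne e.symm)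
    have g1 := (hg q hq).1 (by simp)
    have g2 := (hg p hp).2 (by simpa using hne)
    rw [hpq] at f1 g2
    linarith
  refine ⟨S.image x, Finset.card_image_of_injOn hinj, ?_⟩
  have hh : ∃ h0 : Ω → ℝ, ∀ p ∈ S, h0 (x p) = m p := by
    refine ⟨fun y => if hy : ∃ p ∈ S, x p = y then m hy.choose else 0, fun p hp => ?_⟩
    have hy : ∃ q ∈ S, x q = x p := ⟨p, hp, rfl⟩
    simp only [dif_pos hy]
    rw [hinj hy.choose_spec.1 hp hy.choose_spec.2]
  obtain ⟨h0, hh0⟩ := hh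
  refine ⟨h0, fun t ht => ?_⟩
  obtain ⟨f, hf, hf2⟩ := h (S.filter (fun p => x p ∈ t)) (Finset.filter_subset _ _)
  refine ⟨f, hf, ?_, ?_⟩
  · intro y hy hyt
    obtain ⟨p, hp, rfl⟩ := Finset.mem_image.1 hy
    rw [hh0 p hp]
    exact (hf2 p hp).2 (by simp [hyt])
  · intro y hyt
    obtain ⟨p, hp, rfl⟩ := Finset.mem_image.1 (ht hyt)
    rw [hh0 p hp]
    exact (hf2 p hp).1 (by simp [hyt, hp])

lemma Klevels {a : ℝ} (ha : 2 < a) (k K : ℕ)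
    (hK : K = ⌈2 ^ (k + 1) * a ^ (2 * k + 3) / tau a k⌉₊) :
    2 ^ (k + 1) * a ^ (2 * k + 3) ≤ K * tau a k ∧ (2 * K + 1 : ℝ) ≤ a ^ (2 * k + 13) := by
  have ha0 : 0 < a := by linarith
  have hτ := tau_pos ha k
  have h2k : (2 : ℝ) ^ k ≤ a ^ k := by gcongr
  constructor
  · rw [← div_le_iff₀ hτ, hK]; exact Nat.le_ceil _
  · have h1 : (K : ℝ) < 2 ^ (k + 1) * a ^ (2 * k + 3) / tau a k + 1 := by
      rw [hK]; exact Nat.ceil_lt_add_one (by positivity)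
    have e : 2 ^ (k + 1) * a ^ (2 * k + 3) / tau a k = 272 * 2 ^ k * a ^ (k + 3) := by
      unfold tau; field_simp; ring
    rw [e] at h1
    have h3 : (1 : ℝ) ≤ a ^ (k + 3) := one_le_pow₀ (by linarith)
    have h4 : (1 : ℝ) ≤ 2 ^ k := one_le_pow₀ (by norm_num)
    have h5 : (1 : ℝ) ≤ 2 ^ k * a ^ (k + 3) := one_le_mul_of_one_le_of_one_le h4 h3
    have h6 : (2 * K + 1 : ℝ) ≤ 1024 * (2 ^ k * a ^ (k + 3)) := by linarith
    have h7 : (1024 : ℝ) ≤ a ^ 10 := by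
      calc (1024 : ℝ) = 2 ^ 10 := by norm_num
        _ ≤ a ^ 10 := by gcongr
    calc (2 * K + 1 : ℝ) ≤ 1024 * (2 ^ k * a ^ (k + 3)) := h6
      _ ≤ a ^ 10 * (a ^ k * a ^ (k + 3)) := by gcongr
      _ = _ := by rw [← pow_add, ← pow_add]; congr 1; ring

lemma cells_sub {α ι : Type*} (lo hi : ι → α → Prop) (P : Finset ι) (A : Finset α) :
    cells lo hi P A ⊆ P.powerset := by
  intro S hS
  simp only [cells, Finset.mem_filter] at hS
  exact hS.1

set_option maxHeartbeats 1000000 in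
theorem core {Ω : Type*} (G : Finset (Ω → ℝ)) (s : Finset Ω) (w : Ω → ℝ) (hw : ∀ x, 0 ≤ w x)
    (hw1 : ∑ x ∈ s, w x = 1) (a : ℝ) (ha : 2 < a) (v : ℕ → ℕ) (J : ℕ)
    (hv : ∀ j σ, Shatters (G : Set (Ω → ℝ)) ((1 / 136) * a ^ j) σ → σ.card ≤ v j)
    (hJ : ∀ j, J ≤ j → v j = 0)
    (hG : ∀ f ∈ G, ∑ x ∈ s, w x * f x ^ 2 ≤ a ^ 2)
    (hsep : ∀ f ∈ G, ∀ g ∈ G, f ≠ g → 1 ≤ ∑ x ∈ s, w x * (f x - g x) ^ 2) :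
    Real.log G.card ≤ 100 * Real.log a * ∑ j ∈ Finset.range J, 2 ^ j * (v j : ℝ) := by
  classical
  have ha0 : 0 < a := by linarith
  have hla : 0 ≤ Real.log a := Real.log_nonneg (by linarith)
  rcases Nat.lt_or_ge G.card 2 with h | hG2
  · have : Real.log G.card = 0 := by
      have : G.card = 0 ∨ G.card = 1 := by omega
      rcases this with h | h <;> simp [h]
    rw [this]
    exact mul_nonneg (by positivity) (Finset.sum_nonneg fun j _ => by positivity)
  set L := Real.log G.card with hL
  have hG2r : (2 : ℝ) ≤ G.card := by exact_mod_cast hG2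
  have hGpos : (0 : ℝ) < G.card := by linarith
  have hL2 : 1 / 2 ≤ L := by
    have h1 := Real.log_two_gt_d9
    have h2 : Real.log 2 ≤ L := Real.log_le_log (by norm_num) hG2r
    linarith
  -- small differences
  have hsmall : ∀ f ∈ G, ∀ g ∈ G, ∀ x, |f x - g x| < a ^ (2 * J) / 2 := by
    have key : ∀ f ∈ G, ∀ g ∈ G, ∀ x, f x - g x < (1 / 136) * a ^ J := by
      intro f hf g hg x
      by_contra hcon
      push Not at hcon
      have hsh : Shatters (G : Set (Ω → ℝ)) ((1 / 136) * a ^ J) {x} := by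
        refine ⟨g, fun t ht => ?_⟩
        by_cases hx : x ∈ t
        · refine ⟨f, hf, ?_, ?_⟩
          · intro y hy hyt
            rw [Finset.mem_singleton.1 hy] at hyt
            exact absurd hx hyt
          · intro y hy
            rw [Finset.mem_singleton.1 (ht hy)]; linarith
        · refine ⟨g, hg, fun y _ _ => le_rfl, ?_⟩
          intro y hy
          have := Finset.mem_singleton.1 (ht hy)
          rw [this] at hy
          exact absurd hy hx
      have := hv J _ hsh
      rw [hJ J le_rfl] at this
      simp at this
    intro f hf g hg x
    have h1 := key f hf g hg x
    have h2 := key g hg f hf x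
    have h3 : (1 : ℝ) ≤ a ^ J := one_le_pow₀ (by linarith)
    have h4 : a ^ (2 * J) = a ^ J * a ^ J := by rw [two_mul, pow_add]
    rw [abs_lt, h4]
    constructor <;> nlinarith
  set Ty : ℕ → (Ω → ℝ) → (Ω → ℝ) → Prop :=
    fun k f g => pk a k ≤ ∑ x ∈ s, w x * psi a k |f x - g x| with hTy
  have hTyex : ∀ f ∈ G, ∀ g ∈ G, f ≠ g → ∃ k < J, Ty k f g := by
    intro f hf g hg hne
    apply exists_type s w hw hw1 ha J (fun x => |f x - g x|) (fun x => abs_nonneg _)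
      (hsmall f hf g hg)
    simpa only [sq_abs] using hsep f hf g hg hne
  set K : ℕ → ℕ := fun k => ⌈2 ^ (k + 1) * a ^ (2 * k + 3) / tau a k⌉₊ with hK
  set n : ℕ → ℕ := fun k => ⌊16 * L / pk a k⌋₊ + 1 with hn
  have hpk : ∀ k, 0 < pk a k := fun k => by unfold pk; positivity
  have hsamp : ∀ k, ∃ x : ℕ → Ω, ∀ q ∈ (G ×ˢ G).filter (fun q => Ty k q.1 q.2),
      n k * (pk a k / 2) / 4 ≤ ∑ i ∈ Finset.range (n k), Zt a k (K k * tau a k) q.1 q.2 (x i) := by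
    intro k
    apply sampling_s3 s w hw hw1 _ (fun (q : (Ω → ℝ) × (Ω → ℝ)) x => Zt a k (K k * tau a k) q.1 q.2 x)
    · intro q x; unfold Zt; split_ifs
      · exact psi_nonneg ha _ _
      · exact le_rfl
    · intro q x; unfold Zt; split_ifs
      · exact psi_le_one ha _ _
      · exact zero_le_one
    · intro q hq
      rw [Finset.mem_filter, Finset.mem_product] at hq
      exact trunc_bound s w hw ha k q.1 q.2 (hG _ hq.1.1) (hG _ hq.1.2) _ (Klevels ha k _ rfl).1 hq.2
    · have h1 : (((G ×ˢ G).filter (fun q => Ty k q.1 q.2)).card : ℝ) ≤ Real.exp (2 * L) := by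
        have h2 : ((G ×ˢ G).filter (fun q => Ty k q.1 q.2)).card ≤ G.card * G.card := by
          rw [← Finset.card_product]; exact Finset.card_filter_le _ _
        have h3 : Real.exp (2 * L) = G.card * G.card := by
          rw [two_mul, Real.exp_add, hL, Real.exp_log hGpos]
        rw [h3]; exact_mod_cast h2
      have h2 : 2 * L < n k * (pk a k / 2) / 4 := by
        have h3 : 16 * L / pk a k < n k := by
          simp only [hn]; push_cast; exact Nat.lt_floor_add_one _
        rw [div_lt_iff₀ (hpk k)] at h3
        linarith
      calc _ ≤ Real.exp (2 * L) * Real.exp (-(n k * (pk a k / 2) / 4)) := by gcongr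
        _ = Real.exp (2 * L + -(n k * (pk a k / 2) / 4)) := by rw [Real.exp_add]
        _ < 1 := by rw [Real.exp_lt_one_iff]; linarith
  choose xs hxs using hsamp
  set P : Finset (Σ _ : ℕ, ℕ × ℤ) := (Finset.range J).sigma
    (fun k => Finset.range (n k) ×ˢ Finset.Icc (-(K k : ℤ)) (K k)) with hP
  set lo : (Σ _ : ℕ, ℕ × ℤ) → (Ω → ℝ) → Prop :=
    fun p f => f (xs p.1 p.2.1) ≤ p.2.2 * tau a p.1 with hlo
  set hi : (Σ _ : ℕ, ℕ × ℤ) → (Ω → ℝ) → Prop :=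
    fun p f => p.2.2 * tau a p.1 + tau a p.1 ≤ f (xs p.1 p.2.1) with hhi
  have htree : √(G.card : ℝ) ≤ ((cells lo hi P G).card : ℝ) := by
    refine tree_bound lo hi P ?_ G ?_ G.card G (Finset.Subset.refl _) rfl
    · intro p f h1 h2
      have := tau_pos ha p.1
      simp only [hlo, hhi] at h1 h2
      linarith
    · intro A hA hA2
      obtain ⟨k, hk, i, hi', m, hm1, hm2, h1, h2, h3⟩ := node A ha J n K (fun k => Nat.succ_pos _)
        xs Ty (fun f hf g hg => hTyex f (hA hf) g (hA hg))
        (by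
          intro k hk f hf g hg hty
          have := hxs k (f, g) (by
            rw [Finset.mem_filter, Finset.mem_product]
            exact ⟨⟨hA hf, hA hg⟩, hty⟩)
          refine le_trans (le_of_eq ?_) this
          ring) hA2
      refine ⟨⟨k, i, m⟩, ?_, h1, h2, h3⟩
      simp only [hP, Finset.mem_sigma, Finset.mem_product, Finset.mem_range, Finset.mem_Icc]
      exact ⟨hk, hi', hm1, hm2⟩
  set θ : ℕ → ℝ := fun k => 1 / a ^ (8 * k + 25) with hθ
  have hθ0 : ∀ k, 0 < θ k := fun k => by simp only [hθ]; positivity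
  have hθ1 : ∀ k, θ k ≤ 1 := fun k => by
    simp only [hθ]
    rw [div_le_one (by positivity)]
    exact one_le_pow₀ (by linarith)
  have hcells : ∀ S ∈ cells lo hi P G, ∏ k ∈ Finset.range J, θ k ^ v k ≤ ∏ p ∈ S, θ p.1 := by
    intro S hS
    simp only [cells, Finset.mem_filter, Finset.mem_powerset] at hS
    have hmaps : ∀ p ∈ S, p.1 ∈ Finset.range J := by
      intro p hp
      have := hS.1 hp
      rw [hP, Finset.mem_sigma] at this
      exact this.1
    rw [← Finset.prod_fiberwise_of_maps_to hmaps]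
    apply Finset.prod_le_prod
    · intro k _; exact (pow_pos (hθ0 k) _).le
    · intro k _
      have e : ∏ p ∈ S.filter (fun p => p.1 = k), θ p.1 = θ k ^ (S.filter (fun p => p.1 = k)).card := by
        rw [← Finset.prod_const]
        apply Finset.prod_congr rfl
        intro p hp
        rw [(Finset.mem_filter.1 hp).2]
      rw [e]
      apply pow_le_pow_of_le_one (hθ0 k).le (hθ1 k)
      obtain ⟨σ, hσ, hsh⟩ := cell_card (G : Set (Ω → ℝ)) (S.filter (fun p => p.1 = k))
        (fun p => xs p.1 p.2.1) (fun p => p.2.2 * tau a k) (tau a k) (tau_pos ha k) (by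
          intro U hU
          obtain ⟨f, hf, h2⟩ := hS.2 U (hU.trans (Finset.filter_subset _ _))
          refine ⟨f, hf, fun p hp => ?_⟩
          rw [Finset.mem_filter] at hp
          have := h2 p hp.1
          simp only [hlo, hhi, hp.2] at this
          rw [hp.2]
          exact this)
      rw [← hσ]
      exact hv k σ hsh
  have hcount := count_bound P (cells lo hi P G) (cells_sub lo hi P G) (fun p => θ p.1) (fun p => (hθ0 _).le) _ hcells
  have hsumθ : ∑ p ∈ P, θ p.1 ≤ L / 4 := by
    rw [hP, Finset.sum_sigma]
    have h1 : ∀ k ∈ Finset.range J, ∑ q ∈ Finset.range (n k) ×ˢ Finset.Icc (-(K k : ℤ)) (K k),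
        θ k ≤ L / 8 * (1 / 2 : ℝ) ^ k := by
      intro k _
      rw [Finset.sum_const, nsmul_eq_mul, Finset.card_product, Finset.card_range, Int.card_Icc]
      have e1 : ((K k : ℤ) + 1 - -(K k : ℤ)).toNat = 2 * K k + 1 := by omega
      rw [e1]
      have hk1 := (Klevels ha k (K k) rfl).2
      have hpk1 : pk a k ≤ 1 := by
        unfold pk
        rw [div_le_one (by positivity)]
        exact one_le_mul_of_one_le_of_one_le (one_le_pow₀ (by norm_num)) (one_le_pow₀ (by linarith))
      have hn1 : (n k : ℝ) ≤ 18 * L / pk a k := by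
        have h3 : (⌊16 * L / pk a k⌋₊ : ℝ) ≤ 16 * L / pk a k :=
          Nat.floor_le (div_nonneg (by linarith) (hpk k).le)
        simp only [hn]; push_cast
        have h4 : 1 ≤ 2 * L / pk a k := by
          rw [le_div_iff₀ (hpk k)]; linarith
        have h5 : 18 * L / pk a k = 16 * L / pk a k + 2 * L / pk a k := by ring
        linarith
      have hn2 : (n k : ℝ) ≤ L * a ^ (5 * k + 9) := by
        refine hn1.trans ?_
        have e2 : 18 * L / pk a k = L * (18 * (2 ^ k * a ^ (4 * k + 4))) := by
          unfold pk; field_simp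
        rw [e2]
        have h7 : (18 : ℝ) ≤ a ^ 5 := by
          calc (18 : ℝ) ≤ 2 ^ 5 := by norm_num
            _ ≤ a ^ 5 := by gcongr
        have h8 : (2 : ℝ) ^ k ≤ a ^ k := by gcongr
        have hL0 : 0 ≤ L := by linarith
        calc L * (18 * (2 ^ k * a ^ (4 * k + 4))) ≤ L * (a ^ 5 * (a ^ k * a ^ (4 * k + 4))) := by
              gcongr
          _ = _ := by rw [← pow_add, ← pow_add]; congr 2; ring
      push_cast
      have hL0 : 0 ≤ L := by linarith
      calc (n k : ℝ) * (2 * K k + 1) * θ k ≤ (L * a ^ (5 * k + 9)) * a ^ (2 * k + 13) * θ k := by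
            have := (hθ0 k).le
            gcongr
        _ = L * (1 / a ^ (k + 3)) := by
            simp only [hθ]
            have : a ^ (8 * k + 25) = a ^ (5 * k + 9) * a ^ (2 * k + 13) * a ^ (k + 3) := by
              rw [← pow_add, ← pow_add]; congr 1; ring
            rw [this]; field_simp
        _ ≤ L * (1 / 2 ^ (k + 3)) := by gcongr
        _ = _ := by rw [one_div_pow, pow_add]; ring
    have h2 := Finset.sum_le_sum h1
    rw [← Finset.mul_sum] at h2
    have h3 := sum_half J
    refine h2.trans ?_
    nlinarith
  have hprodpos : 0 < ∏ k ∈ Finset.range J, θ k ^ v k :=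
    Finset.prod_pos fun k _ => pow_pos (hθ0 k) _
  have hfin : √(G.card : ℝ) * ∏ k ∈ Finset.range J, θ k ^ v k ≤ Real.exp (L / 4) :=
    (mul_le_mul_of_nonneg_right htree hprodpos.le).trans
      (hcount.trans (Real.exp_le_exp.2 hsumθ))
  have hlog := Real.log_le_log (mul_pos (Real.sqrt_pos.2 hGpos) hprodpos) hfin
  rw [Real.log_exp, Real.log_mul (Real.sqrt_pos.2 hGpos).ne' hprodpos.ne', Real.log_sqrt hGpos.le,
    Real.log_prod (fun k _ => (pow_pos (hθ0 k) _).ne')] at hlog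
  have hterm : ∀ k ∈ Finset.range J, -(25 * Real.log a * (2 ^ k * (v k : ℝ))) ≤
      Real.log (θ k ^ v k) := by
    intro k _
    rw [Real.log_pow]
    have e : Real.log (θ k) = -((8 * k + 25 : ℕ) : ℝ) * Real.log a := by
      simp only [hθ]
      rw [one_div, Real.log_inv, Real.log_pow]; ring
    rw [e]
    have h1 : ((8 * k + 25 : ℕ) : ℝ) ≤ 25 * 2 ^ k := by
      have : k + 1 ≤ 2 ^ k := Nat.lt_two_pow_self
      have h2 : 8 * k + 25 ≤ 25 * 2 ^ k := by omega
      exact_mod_cast h2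
    have h3 : 0 ≤ (v k : ℝ) * Real.log a := by positivity
    nlinarith
  have h9 := Finset.sum_le_sum hterm
  rw [Finset.sum_neg_distrib, ← Finset.mul_sum] at h9
  linarith

lemma local_bound {Ω : Type*} (F : Set (Ω → ℝ)) (A : Finset (Ω → ℝ)) (hAF : ∀ f ∈ A, f ∈ F)
    (f0 : Ω → ℝ) (s : Finset Ω) (w : Ω → ℝ) (hw : ∀ x, 0 ≤ w x)
    (hw1 : ∑ x ∈ s, w x = 1) (a : ℝ) (ha : 2 < a) (t : ℝ) (ht : 0 < t) (v : ℕ → ℕ) (J : ℕ)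
    (hv : ∀ j σ, Shatters F ((1 / 136) * a ^ j * t) σ → σ.card ≤ v j)
    (hJ : ∀ j, J ≤ j → v j = 0)
    (hA : ∀ f ∈ A, ∑ x ∈ s, w x * (f x - f0 x) ^ 2 ≤ (a * t) ^ 2)
    (hsep : ∀ f ∈ A, ∀ g ∈ A, f ≠ g → t ^ 2 ≤ ∑ x ∈ s, w x * (f x - g x) ^ 2) :
    Real.log A.card ≤ 100 * Real.log a * ∑ j ∈ Finset.range J, 2 ^ j * (v j : ℝ) := by
  classical
  set T : (Ω → ℝ) → (Ω → ℝ) := fun f x => (f x - f0 x) / t with hT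
  have hTinj : Function.Injective T := by
    intro f g hfg
    funext x
    have := congrFun hfg x
    simp only [hT] at this
    field_simp at this
    linarith
  rw [← Finset.card_image_of_injective A hTinj]
  apply core (A.image T) s w hw hw1 a ha v J _ hJ
  · intro f hf
    obtain ⟨g, hg, rfl⟩ := Finset.mem_image.1 hf
    have h1 : ∑ x ∈ s, w x * T g x ^ 2 = (∑ x ∈ s, w x * (g x - f0 x) ^ 2) / t ^ 2 := by
      rw [Finset.sum_div]
      refine Finset.sum_congr rfl fun x _ => ?_
      simp only [hT]; rw [div_pow]; ring
    rw [h1, div_le_iff₀ (by positivity), ← mul_pow]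
    exact hA g hg
  · intro f hf f' hf' hne
    obtain ⟨g, hg, rfl⟩ := Finset.mem_image.1 hf
    obtain ⟨g', hg', rfl⟩ := Finset.mem_image.1 hf'
    have h1 : ∑ x ∈ s, w x * (T g x - T g' x) ^ 2 = (∑ x ∈ s, w x * (g x - g' x) ^ 2) / t ^ 2 := by
      rw [Finset.sum_div]
      refine Finset.sum_congr rfl fun x _ => ?_
      simp only [hT]; rw [← sub_div, div_pow]; ring
    rw [h1, le_div_iff₀ (by positivity), one_mul]
    exact hsep g hg g' hg' (fun h => hne (by rw [h]))
  · intro j σ hσ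
    apply hv j σ
    obtain ⟨h, hh⟩ := hσ
    refine ⟨fun x => f0 x + t * h x, fun U hU => ?_⟩
    obtain ⟨f, hf, h1, h2⟩ := hh U hU
    obtain ⟨g, hg, rfl⟩ := Finset.mem_image.1 (Finset.mem_coe.1 hf)
    refine ⟨g, hAF g hg, ?_, ?_⟩
    · intro x hx hxU
      have := h1 x hx hxU
      simp only [hT] at this
      rw [div_le_iff₀ ht] at this
      linarith
    · intro x hx
      have := h2 x hx
      simp only [hT] at this
      rw [le_div_iff₀ ht] at this
      linarith

lemma sum_comb (y : ℕ → ℝ) (hy : ∀ j, 0 ≤ y j) (J : ℕ) :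
    ∑ j ∈ Finset.range (J + 1), 2 ^ j * y j + ∑ j ∈ Finset.range J, 4 ^ j * y (j + 1) ≤
      ∑ j ∈ Finset.range (J + 1), 4 ^ j * y j := by
  induction J with
  | zero => simp
  | succ J ih =>
    rw [Finset.sum_range_succ _ (J + 1), Finset.sum_range_succ (fun j => 4 ^ j * y (j + 1)),
      Finset.sum_range_succ (fun j => 4 ^ j * y j) (J + 1)]
    have h1 : (2 : ℝ) ^ (J + 1) + 4 ^ J ≤ 4 ^ (J + 1) := by
      have h2 : (2 : ℝ) ^ J ≤ 4 ^ J := by gcongr; norm_num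
      have h3 : (0 : ℝ) < 4 ^ J := by positivity
      rw [pow_succ, pow_succ]; linarith
    have := mul_le_mul_of_nonneg_right h1 (hy (J + 1))
    linarith

lemma global_bound {Ω : Type*} (F : Set (Ω → ℝ)) (s : Finset Ω) (w : Ω → ℝ) (hw : ∀ x, 0 ≤ w x)
    (hw1 : ∑ x ∈ s, w x = 1) (a : ℝ) (ha : 2 < a) (i : ℕ) :
    ∀ (t : ℝ), 0 < t → ∀ (v : ℕ → ℕ) (J : ℕ),
    (∀ j σ, Shatters F ((1 / 136) * a ^ j * t) σ → σ.card ≤ v j) →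
    (∀ j, J ≤ j → v j = 0) → ∀ A : Finset (Ω → ℝ), (∀ f ∈ A, f ∈ F) →
    (∀ f ∈ A, ∀ g ∈ A, f ≠ g → t ^ 2 ≤ ∑ x ∈ s, w x * (f x - g x) ^ 2) →
    (∀ f ∈ A, ∀ g ∈ A, ∑ x ∈ s, w x * (f x - g x) ^ 2 < (a ^ i * t) ^ 2) →
    Real.log A.card ≤ 100 * Real.log a * ∑ j ∈ Finset.range J, 4 ^ j * (v j : ℝ) := by
  classical
  have ha0 : 0 < a := by linarith
  have hla : 0 ≤ Real.log a := Real.log_nonneg (by linarith)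
  induction i with
  | zero =>
    intro t ht v J hv hJ A hAF hsep hdiam
    have hc : A.card ≤ 1 := by
      rw [Finset.card_le_one]
      intro f hf g hg
      by_contra hne
      have h1 := hsep f hf g hg hne
      have h2 := hdiam f hf g hg
      simp only [pow_zero, one_mul] at h2
      linarith
    have : Real.log A.card = 0 := by
      have : A.card = 0 ∨ A.card = 1 := by omega
      rcases this with h | h <;> simp [h]
    rw [this]
    exact mul_nonneg (by positivity) (Finset.sum_nonneg fun j _ => by positivity)
  | succ i ih =>
    intro t ht v J hv hJ A hAF hsep hdiam
    have hRHS : 0 ≤ 100 * Real.log a * ∑ j ∈ Finset.range J, 4 ^ j * (v j : ℝ) :=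
      mul_nonneg (by positivity) (Finset.sum_nonneg fun j _ => by positivity)
    rcases Finset.eq_empty_or_nonempty A with h0 | hA
    · subst h0; simpa using hRHS
    -- maximal separated subset
    set fam := A.powerset.filter (fun B => ∀ f ∈ B, ∀ g ∈ B, f ≠ g →
      (a * t) ^ 2 ≤ ∑ x ∈ s, w x * (f x - g x) ^ 2) with hfam
    have hfamne : fam.Nonempty := ⟨∅, by simp [hfam]⟩
    obtain ⟨B, hB, hBmax⟩ := Finset.exists_max_image fam Finset.card hfamne
    rw [hfam, Finset.mem_filter, Finset.mem_powerset] at hB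
    have hcov : ∀ f ∈ A, ∃ b ∈ B, ∑ x ∈ s, w x * (f x - b x) ^ 2 ≤ (a * t) ^ 2 := by
      intro f hf
      by_contra hcon
      push Not at hcon
      have hfB : f ∉ B := by
        intro hfB
        have := hcon f hfB
        simp at this
        have : 0 < (a * t) ^ 2 := by positivity
        linarith
      have hin : insert f B ∈ fam := by
        rw [hfam, Finset.mem_filter, Finset.mem_powerset]
        refine ⟨Finset.insert_subset hf hB.1, ?_⟩
        intro g hg g' hg' hne
        rcases Finset.mem_insert.1 hg with rfl | hg2 <;> rcases Finset.mem_insert.1 hg' with rfl | hg3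
        · exact absurd rfl hne
        · exact (hcon g' hg3).le
        · refine (hcon g hg2).le.trans (le_of_eq ?_)
          refine Finset.sum_congr rfl fun x _ => by ring
        · exact hB.2 g hg2 g' hg3 hne
      have := hBmax _ hin
      rw [Finset.card_insert_of_notMem hfB] at this
      omega
    have hlogB : Real.log B.card ≤ 100 * Real.log a * ∑ j ∈ Finset.range J, 4 ^ j * (v (j + 1) : ℝ) := by
      apply ih (a * t) (by positivity) (fun j => v (j + 1)) J
      · intro j σ hσ
        apply hv (j + 1) σ
        have e : (1 / 136) * a ^ (j + 1) * t = (1 / 136) * a ^ j * (a * t) := by ring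
        rw [e]; exact hσ
      · intro j hj; exact hJ _ (by omega)
      · intro f hf; exact hAF f (hB.1 hf)
      · exact hB.2
      · intro f hf g hg
        have e : a ^ i * (a * t) = a ^ (i + 1) * t := by ring
        rw [e]
        exact hdiam f (hB.1 hf) g (hB.1 hg)
    set Q := 100 * Real.log a * ∑ j ∈ Finset.range J, 2 ^ j * (v j : ℝ) with hQ
    have hball : ∀ b ∈ B, ((A.filter (fun f => ∑ x ∈ s, w x * (f x - b x) ^ 2 ≤ (a * t) ^ 2)).card : ℝ)
        ≤ Real.exp Q := by
      intro b _
      set A' := A.filter (fun f => ∑ x ∈ s, w x * (f x - b x) ^ 2 ≤ (a * t) ^ 2) with hA'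
      have h1 := local_bound F A' (fun f hf => hAF f (Finset.mem_filter.1 hf).1) b s w hw hw1 a ha t ht
        v J hv hJ (fun f hf => (Finset.mem_filter.1 hf).2)
        (fun f hf g hg => hsep f (Finset.mem_filter.1 hf).1 g (Finset.mem_filter.1 hg).1)
      exact (Real.le_exp_log _).trans (Real.exp_le_exp.2 h1)
    have hcard : (A.card : ℝ) ≤ B.card * Real.exp Q := by
      have hsub : A ⊆ B.biUnion
          (fun b => A.filter (fun f => ∑ x ∈ s, w x * (f x - b x) ^ 2 ≤ (a * t) ^ 2)) := by
        intro f hf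
        obtain ⟨b, hb, hfb⟩ := hcov f hf
        exact Finset.mem_biUnion.2 ⟨b, hb, Finset.mem_filter.2 ⟨hf, hfb⟩⟩
      have h1 := (Finset.card_le_card hsub).trans Finset.card_biUnion_le
      have h2 : (A.card : ℝ) ≤ ∑ b ∈ B,
          ((A.filter (fun f => ∑ x ∈ s, w x * (f x - b x) ^ 2 ≤ (a * t) ^ 2)).card : ℝ) := by
        exact_mod_cast h1
      refine h2.trans ((Finset.sum_le_sum hball).trans ?_)
      simp
    have hApos : (0 : ℝ) < A.card := by exact_mod_cast Finset.card_pos.2 hA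
    have hBpos : (0 : ℝ) < B.card := by
      obtain ⟨f, hf⟩ := hA
      obtain ⟨b, hb, _⟩ := hcov f hf
      exact_mod_cast Finset.card_pos.2 ⟨b, hb⟩
    have hlog := Real.log_le_log hApos hcard
    rw [Real.log_mul hBpos.ne' (Real.exp_pos _).ne', Real.log_exp] at hlog
    have hcomb := sum_comb (fun j => (v j : ℝ)) (fun j => Nat.cast_nonneg _) J
    rw [Finset.sum_range_succ, Finset.sum_range_succ (fun j => 4 ^ j * (v j : ℝ)), hJ J le_rfl] at hcomb
    simp only [Nat.cast_zero, mul_zero, add_zero] at hcomb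
    have := mul_le_mul_of_nonneg_left hcomb (by positivity : 0 ≤ 100 * Real.log a)
    rw [mul_add] at this
    linarith

lemma exists_dim {Ω : Type*} (F : Set (Ω → ℝ)) (t : ℝ) (h : combDim F t ≠ ⊤) :
    ∃ v : ℕ, (∀ σ, Shatters F t σ → σ.card ≤ v) ∧ (v : ℝ≥0∞) ≤ combDim F t := by
  classical
  have hle : ∀ σ, Shatters F t σ → (σ.card : ℝ≥0∞) ≤ combDim F t := fun σ hσ =>
    le_iSup₂ (f := fun (σ : Finset Ω) (_ : Shatters F t σ) => (σ.card : ℝ≥0∞)) σ hσ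
  have hex : ∃ n : ℕ, ∀ σ, Shatters F t σ → σ.card ≤ n := by
    obtain ⟨n, hn⟩ := ENNReal.exists_nat_gt h
    exact ⟨n, fun σ hσ => by exact_mod_cast (hle σ hσ).trans hn.le⟩
  refine ⟨Nat.find hex, Nat.find_spec hex, ?_⟩
  rcases Nat.eq_zero_or_pos (Nat.find hex) with h0 | h0
  · rw [h0]; simp
  · have := Nat.find_min hex (m := Nat.find hex - 1) (by omega)
    push Not at this
    obtain ⟨σ, hσ, hlt⟩ := this
    refine le_trans ?_ (hle σ hσ)
    have : Nat.find hex ≤ σ.card := by omega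
    exact_mod_cast this

/-- For `a > 2` and every class `F` and `t > 0`,
`D(F,t) ≤ C·(log a)·Σ_{j=0}^∞ 4^j·v(F, c·a^j·t)`. -/
theorem entropy_le_sum_dimension :
    ∃ C > (0 : ℝ), ∃ c > (0 : ℝ), ∀ (Ω : Type) (F : Set (Ω → ℝ)) (a : ℝ), 2 < a →
      ∀ t : ℝ, 0 < t →
        KPentropy F t ≤
          ENNReal.ofReal (C * Real.log a) * ∑' j : ℕ, 4 ^ j * combDim F (c * a ^ j * t) := by
  refine ⟨100, by norm_num, 1 / 136, by norm_num, ?_⟩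
  intro Ω F a ha t ht
  classical
  have hla : 0 < Real.log a := Real.log_pos (by linarith)
  by_cases htop : ∑' j : ℕ, 4 ^ j * combDim F (1 / 136 * a ^ j * t) = ⊤
  · rw [htop, ENNReal.mul_top]
    · exact le_top
    · rw [Ne, ENNReal.ofReal_eq_zero, not_le]; positivity
  have hfin : ∀ j : ℕ, combDim F (1 / 136 * a ^ j * t) ≠ ⊤ := by
    intro j hj
    have := ENNReal.ne_top_of_tsum_ne_top htop j
    rw [hj, ENNReal.mul_top (by positivity)] at this
    exact this rfl
  choose v hv hv2 using fun j => exists_dim F _ (hfin j)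
  obtain ⟨J, hJ⟩ : ∃ J : ℕ, ∀ j, J ≤ j → v j = 0 := by
    have h1 := ENNReal.tendsto_atTop_zero_of_tsum_ne_top htop
    have h2 := (h1.eventually_lt_const (by norm_num : (0 : ℝ≥0∞) < 1))
    obtain ⟨J, hJ⟩ := eventually_atTop.1 h2
    refine ⟨J, fun j hj => ?_⟩
    by_contra hne
    have h3 := hJ j hj
    have h4 : (1 : ℝ≥0∞) ≤ v j := by exact_mod_cast Nat.one_le_iff_ne_zero.2 hne
    have h5 : (1 : ℝ≥0∞) ≤ 4 ^ j := one_le_pow₀ (by norm_num)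
    have h6 : (1 : ℝ≥0∞) ≤ 4 ^ j * combDim F (1 / 136 * a ^ j * t) := by
      calc (1 : ℝ≥0∞) = 1 * 1 := by simp
        _ ≤ _ := mul_le_mul' h5 (h4.trans (hv2 j))
    exact absurd h3 (not_lt.2 h6)
  apply iSup₂_le
  intro m hm
  obtain ⟨s, w, f, hw, hw1, hfF, hsep⟩ := hm
  have hsep' : ∀ i j, i ≠ j → t ^ 2 ≤ ∑ x ∈ s, w x * (f i x - f j x) ^ 2 := by
    intro i j hij
    rcases lt_or_gt_of_ne hij with h | h
    · exact hsep i j h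
    · refine (hsep j i h).trans (le_of_eq ?_)
      refine Finset.sum_congr rfl fun x _ => by ring
  have hinj : Function.Injective f := by
    intro i j hij
    by_contra hne
    have := hsep' i j hne
    rw [hij] at this
    simp at this
    have : 0 < t ^ 2 := by positivity
    linarith
  set A := Finset.univ.image f with hA
  have hAc : A.card = m := by rw [hA, Finset.card_image_of_injective _ hinj]; simp
  have ha1 : 1 < a := by linarith
  obtain ⟨R, hR⟩ : ∃ R : ℝ, ∀ f ∈ A, ∀ g ∈ A, ∑ x ∈ s, w x * (f x - g x) ^ 2 ≤ R := by
    obtain ⟨R, hR⟩ := ((A ×ˢ A).image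
      (fun q => ∑ x ∈ s, w x * (q.1 x - q.2 x) ^ 2)).bddAbove
    refine ⟨R, fun f hf g hg => hR ?_⟩
    exact Finset.mem_coe.2 (Finset.mem_image.2 ⟨(f, g), Finset.mem_product.2 ⟨hf, hg⟩, rfl⟩)
  obtain ⟨i, hi⟩ := pow_unbounded_of_one_lt (R / t ^ 2 + 1) ha1
  have hdiam : R < (a ^ i * t) ^ 2 := by
    have h1 : (1 : ℝ) ≤ a ^ i := one_le_pow₀ ha1.le
    have h2 : R / t ^ 2 < (a ^ i) ^ 2 := by nlinarith
    rw [div_lt_iff₀ (by positivity)] at h2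
    rw [mul_pow]; exact h2
  have hmain := global_bound F s w hw hw1 a ha i t ht v J hv hJ A
    (by intro g hg; obtain ⟨i, _, rfl⟩ := Finset.mem_image.1 hg; exact hfF i)
    (by
      intro g hg g' hg' hne
      obtain ⟨i, _, rfl⟩ := Finset.mem_image.1 hg
      obtain ⟨j, _, rfl⟩ := Finset.mem_image.1 hg'
      exact hsep' i j (fun h => hne (by rw [h])))
    (fun g hg g' hg' => (hR g hg g' hg').trans_lt hdiam)
  rw [hAc] at hmain
  refine (ENNReal.ofReal_le_ofReal hmain).trans ?_
  rw [ENNReal.ofReal_mul (by positivity)]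
  gcongr
  rw [ENNReal.ofReal_sum_of_nonneg (fun j _ => by positivity)]
  refine le_trans (Finset.sum_le_sum fun j _ => ?_) (ENNReal.sum_le_tsum (Finset.range J))
  rw [ENNReal.ofReal_mul (by positivity), ENNReal.ofReal_natCast,
    ENNReal.ofReal_pow (by norm_num)]
  have : ENNReal.ofReal 4 = 4 := by norm_num
  rw [this]
  gcongr
  exact hv2 j
end

section
/- For every set F in ℝ^n and every α ≥ 2, N(F, Tower^α) ≤ Σ(C·F)^α, where C is an absolute constant and C·F = { C·x : x ∈ F }. -/
open MeasureTheory Filter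
open scoped ENNReal NNReal Pointwise BigOperators

/-- The closed octant in `ℝ^n` with vertex `z` and signs `θ`. -/
def octant {n : ℕ} (θ z : Fin n → ℝ) : Set (Fin n → ℝ) :=
  {x | ∀ i, 0 ≤ (x i - z i) * θ i}

/-- The coordinate convex hull of `A`: what remains of `ℝ^n` after removing all closed
octants disjoint from `A`; equivalently, the points `x` such that every octant containing `x`
intersects `A`. -/
def cconv {n : ℕ} (A : Set (Fin n → ℝ)) : Set (Fin n → ℝ) :=
  {x | ∀ θ z : Fin n → ℝ, (∀ i, θ i = 1 ∨ θ i = -1) → x ∈ octant θ z →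
    (octant θ z ∩ A).Nonempty}

/-- The coordinate projection of `ℝ^n` onto `ℝ^σ`. -/
def coordProj {n : ℕ} (σ : Finset (Fin n)) (x : Fin n → ℝ) : Fin n → ℝ :=
  fun i => if i ∈ σ then x i else 0

/-- The integer cell `a + [0,1]^σ` in `ℝ^σ` (realized inside `ℝ^n` with zero coordinates
off `σ`). -/
def intCell {n : ℕ} (σ : Finset (Fin n)) (a : Fin n → ℤ) : Set (Fin n → ℝ) :=
  {x | (∀ i ∈ σ, (a i : ℝ) ≤ x i ∧ x i ≤ (a i : ℝ) + 1) ∧ ∀ i ∉ σ, x i = 0}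

/-- The cell content `Σ(A)`: the total number of integer cells contained in the coordinate
convex hulls of all coordinate projections of `A` (the summand for `σ = ∅` equals `1`
exactly when `A` is nonempty). -/
noncomputable def cellContent {n : ℕ} (A : Set (Fin n → ℝ)) : ℝ≥0∞ :=
  ∑ σ : Finset (Fin n),
    (({a : Fin n → ℤ | (∀ i ∉ σ, a i = 0) ∧ intCell σ a ⊆ cconv (coordProj σ '' A)}.encard :
      ℕ∞) : ℝ≥0∞)

/-- The covering number `N(K,D)`: the minimal number of translates of `D` needed to cover
`K`. -/
noncomputable def coveringNumber {n : ℕ} (K D : Set (Fin n → ℝ)) : ℕ∞ :=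
  ⨅ (m : ℕ) (_ : ∃ x : Fin m → Fin n → ℝ, K ⊆ ⋃ j, (fun y => x j + y) '' D), (m : ℕ∞)

/-- The generating function `θ_α(t) = e^{α^t - α}` for `t ≥ 1` (and `t` for `0 ≤ t < 1`). -/
noncomputable def towerGen (α : ℝ) (t : ℝ) : ℝ :=
  if t < 1 then t else Real.exp (α ^ t - α)

/-- The Lorentz norm with generating function `φ` of `x ∈ ℝ^n`, with respect to the uniform
probability measure on `{1,…,n}`. -/
noncomputable def lorentzNormFin {n : ℕ} (φ : ℝ → ℝ) (x : Fin n → ℝ) : ℝ :=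
  sInf {l : ℝ | 0 < l ∧ ∀ t : ℝ, 0 < t →
    ((Finset.univ.filter fun i => t ≤ |x i| / l).card : ℝ) / n ≤ 1 / φ t}

/-- `Tower^α`: the unit ball of the tower norm in `ℝ^n`. -/
noncomputable def towerBall (n : ℕ) (α : ℝ) : Set (Fin n → ℝ) :=
  {x | lorentzNormFin (towerGen α) x ≤ 1}

def cellSet {n : ℕ} (A : Set (Fin n → ℝ)) : Set (Finset (Fin n) × (Fin n → ℤ)) :=
  {p | (∀ i ∉ p.1, p.2 i = 0) ∧ intCell p.1 p.2 ⊆ cconv (coordProj p.1 '' A)}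

lemma sum_encard_aux {β γ : Type*} [DecidableEq β] (P : β → γ → Prop) (s : Finset β) :
    ∑ b ∈ s, (({c | P b c}.encard : ℕ∞) : ℝ≥0∞)
      = (({p : β × γ | p.1 ∈ s ∧ P p.1 p.2}.encard : ℕ∞) : ℝ≥0∞) := by
  induction s using Finset.induction_on with
  | empty => simp
  | insert b s hb ih =>
    rw [Finset.sum_insert hb, ih]
    have h1 : {p : β × γ | p.1 ∈ insert b s ∧ P p.1 p.2}
        = (fun c => (b, c)) '' {c | P b c} ∪ {p : β × γ | p.1 ∈ s ∧ P p.1 p.2} := by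
      ext ⟨x, y⟩
      simp only [Finset.mem_insert, Set.mem_ofPred_eq, Set.mem_union, Set.mem_image, Prod.mk.injEq]
      constructor
      · rintro ⟨rfl | h, h2⟩
        · exact Or.inl ⟨y, h2, rfl, rfl⟩
        · exact Or.inr ⟨h, h2⟩
      · rintro (⟨c, h, rfl, rfl⟩ | ⟨h, h2⟩)
        · exact ⟨Or.inl rfl, h⟩
        · exact ⟨Or.inr h, h2⟩
    rw [h1, Set.encard_union_eq, Function.Injective.encard_image]
    · simp
    · intro x y h
      simpa using h
    · rw [Set.disjoint_left]
      rintro ⟨x, y⟩ ⟨c, _, h⟩ ⟨h2, _⟩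
      simp only [Prod.mk.injEq] at h
      exact hb (h.1 ▸ h2)

lemma cellContent_eq {n : ℕ} (A : Set (Fin n → ℝ)) :
    cellContent A = (((cellSet A).encard : ℕ∞) : ℝ≥0∞) := by
  classical
  unfold cellContent
  rw [sum_encard_aux (fun (σ : Finset (Fin n)) (a : Fin n → ℤ) =>
    (∀ i ∉ σ, a i = 0) ∧ intCell σ a ⊆ cconv (coordProj σ '' A))]
  simp [cellSet]

lemma cconv_mono {n : ℕ} {A B : Set (Fin n → ℝ)} (h : A ⊆ B) : cconv A ⊆ cconv B := by
  intro x hx θ z h1 h2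
  exact (hx θ z h1 h2).mono (Set.inter_subset_inter_right _ h)

lemma cellSet_mono {n : ℕ} {A B : Set (Fin n → ℝ)} (h : A ⊆ B) : cellSet A ⊆ cellSet B := by
  rintro p ⟨h1, h2⟩
  exact ⟨h1, h2.trans (cconv_mono (Set.image_mono h))⟩

lemma cellContent_mono {n : ℕ} {A B : Set (Fin n → ℝ)} (h : A ⊆ B) :
    cellContent A ≤ cellContent B := by
  rw [cellContent_eq, cellContent_eq]
  exact_mod_cast Set.encard_le_encard (cellSet_mono h)

lemma one_le_cellContent {n : ℕ} {A : Set (Fin n → ℝ)} (h : A.Nonempty) :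
    1 ≤ cellContent A := by
  rw [cellContent_eq]
  have : (1 : ℕ∞) ≤ (cellSet A).encard := by
    rw [Set.one_le_encard_iff_nonempty]
    refine ⟨(∅, 0), by simp, ?_⟩
    intro x hx θ z h1 h2
    obtain ⟨y, hy⟩ := h
    refine ⟨x, h2, y, hy, ?_⟩
    funext i
    simp [coordProj, hx.2 i]
  exact_mod_cast this

lemma cell_upper {n : ℕ} {A : Set (Fin n → ℝ)} {i : Fin n} {b : ℤ} (h : ∀ x ∈ A, x i ≤ b)
    {p} (hp : p ∈ cellSet A) (hi : i ∈ p.1) : p.2 i + 1 ≤ b := by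
  obtain ⟨_, h2⟩ := hp
  have hx : (fun j => if j ∈ p.1 then (p.2 j : ℝ) + 1 else 0) ∈ intCell p.1 p.2 := by
    constructor
    · intro j hj; simp [hj]
    · intro j hj; simp [hj]
  obtain ⟨y, hy, w, hw, rfl⟩ := h2 hx (fun _ => 1) (fun j => if j ∈ p.1 then (p.2 j : ℝ) + 1 else 0)
    (by simp) (by intro j; simp)
  have := hy i
  simp [coordProj, hi] at this
  have h3 := h w hw
  have : ((p.2 i + 1 : ℤ) : ℝ) ≤ b := by push_cast; linarith
  exact_mod_cast this

lemma cell_lower {n : ℕ} {A : Set (Fin n → ℝ)} {i : Fin n} {b : ℤ} (h : ∀ x ∈ A, (b : ℝ) ≤ x i)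
    {p} (hp : p ∈ cellSet A) (hi : i ∈ p.1) : b ≤ p.2 i := by
  obtain ⟨_, h2⟩ := hp
  have hx : (fun j => if j ∈ p.1 then (p.2 j : ℝ) else 0) ∈ intCell p.1 p.2 := by
    constructor
    · intro j hj; simp [hj]
    · intro j hj; simp [hj]
  obtain ⟨y, hy, w, hw, rfl⟩ := h2 hx (fun _ => -1) (fun j => if j ∈ p.1 then (p.2 j : ℝ) else 0)
    (by simp) (by intro j; simp)
  have := hy i
  simp [coordProj, hi] at this
  have h3 := h w hw
  have : (b : ℝ) ≤ (p.2 i : ℝ) := by linarith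
  exact_mod_cast this

lemma cell_glue {n : ℕ} {S T U : Set (Fin n → ℝ)} (hSU : S ⊆ U) (hTU : T ⊆ U) {i : Fin n} {b : ℤ}
    (hS : ∀ x ∈ S, x i ≤ b) (hT : ∀ x ∈ T, (b : ℝ) + 1 ≤ x i)
    {σ : Finset (Fin n)} {a : Fin n → ℤ} (hi : i ∉ σ) (h1 : (σ, a) ∈ cellSet S)
    (h2 : (σ, a) ∈ cellSet T) : (insert i σ, Function.update a i b) ∈ cellSet U := by
  refine ⟨?_, ?_⟩
  · intro j hj
    simp only [Finset.mem_insert, not_or] at hj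
    have h3 := h1.1 j hj.2
    simpa [Function.update_of_ne hj.1] using h3
  · rintro x ⟨hx1, hx2⟩ θ z hθ hz
    have hne : ∀ j ∈ σ, j ≠ i := fun j hj h => hi (h ▸ hj)
    have hx' : Function.update x i 0 ∈ intCell σ a := by
      constructor
      · intro j hj
        have := hx1 j (by simp [hj])
        simpa [Function.update_of_ne (hne j hj)] using this
      · intro j hj
        by_cases hji : j = i
        · subst hji; simp
        · rw [Function.update_of_ne hji]; exact hx2 j (by simp [hji, hj])
    have hz' : Function.update x i 0 ∈ octant θ (Function.update z i 0) := by
      intro j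
      by_cases hji : j = i
      · subst hji; simp
      · simpa [Function.update_of_ne hji] using hz j
    have hxi := hx1 i (by simp)
    simp only [Function.update_self] at hxi
    have hzi := hz i
    have fin : ∀ w ∈ U, coordProj σ w ∈ octant θ (Function.update z i 0) →
        0 ≤ (w i - z i) * θ i → (octant θ z ∩ coordProj (insert i σ) '' U).Nonempty := by
      intro w hw hwo hwi
      refine ⟨_, ?_, w, hw, rfl⟩
      intro j
      by_cases hji : j = i
      · subst hji; simpa [coordProj] using hwi
      · have := hwo j
        simpa [coordProj, hji, Function.update_of_ne hji] using this
    rcases hθ i with h | h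
    · obtain ⟨y, hy, w, hw, rfl⟩ := h2.2 hx' θ _ hθ hz'
      refine fin w (hTU hw) hy ?_
      have := hT w hw
      rw [h] at hzi ⊢
      linarith
    · obtain ⟨y, hy, w, hw, rfl⟩ := h1.2 hx' θ _ hθ hz'
      refine fin w (hSU hw) hy ?_
      have := hS w hw
      rw [h] at hzi ⊢
      linarith

lemma cellContent_split {n : ℕ} {S T U : Set (Fin n → ℝ)} (hSU : S ⊆ U) (hTU : T ⊆ U) {i : Fin n}
    {b : ℤ} (hS : ∀ x ∈ S, x i ≤ b) (hT : ∀ x ∈ T, (b : ℝ) + 1 ≤ x i) :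
    cellContent S + cellContent T ≤ cellContent U := by
  rw [cellContent_eq, cellContent_eq, cellContent_eq]
  have hT' : ∀ x ∈ T, ((b + 1 : ℤ) : ℝ) ≤ x i := by simpa using hT
  set φ : Finset (Fin n) × (Fin n → ℤ) → Finset (Fin n) × (Fin n → ℤ) :=
    fun p => (insert i p.1, Function.update p.2 i b) with hφ
  have hni : ∀ p ∈ cellSet S ∩ cellSet T, i ∉ p.1 := by
    rintro p ⟨h1, h2⟩ hi
    have := cell_upper hS h1 hi
    have := cell_lower hT' h2 hi
    omega
  have hinj : Set.InjOn φ (cellSet S ∩ cellSet T) := by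
    rintro ⟨σ, a⟩ hp ⟨τ, c⟩ hq h
    have hi1 := hni _ hp
    have hi2 := hni _ hq
    simp only [hφ, Prod.mk.injEq] at h hi1 hi2
    have e1 : σ = τ := by
      have := congrArg (fun s => s.erase i) h.1
      simpa [hi1, hi2] using this
    have e2 : a = c := by
      funext j
      by_cases hj : j = i
      · subst hj
        have h3 := hp.1.1 j hi1
        have h4 := hq.1.1 j hi2
        simp only at h3 h4
        rw [h3, h4]
      · have := congrFun h.2 j
        simpa [Function.update_of_ne hj] using this
    rw [e1, e2]
  have hdisj : Disjoint (cellSet S ∪ cellSet T) (φ '' (cellSet S ∩ cellSet T)) := by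
    rw [Set.disjoint_left]
    rintro q hq ⟨p, hp, rfl⟩
    rcases hq with hq | hq
    · have := cell_upper hS hq (by simp [hφ])
      simp [hφ] at this
    · have := cell_lower hT' hq (by simp [hφ])
      simp [hφ] at this
  have : (cellSet S).encard + (cellSet T).encard ≤ (cellSet U).encard := by
    rw [← Set.encard_union_add_encard_inter, ← hinj.encard_image, ← Set.encard_union_eq hdisj]
    apply Set.encard_le_encard
    apply Set.union_subset (Set.union_subset (cellSet_mono hSU) (cellSet_mono hTU))
    rintro q ⟨⟨σ, a⟩, hp, rfl⟩
    exact cell_glue hSU hTU hS hT (hni _ hp) hp.1 hp.2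
  exact_mod_cast this

lemma analytic_step {N p q α : ℝ} (hN : 0 < N) (hq : 0 ≤ q) (hp : 0 ≤ p) (hpN : 2 * p ≤ N)
    (hα : 2 ≤ α) (h : (N - p) ^ (1 / α) + q ^ (1 / α) ≤ N ^ (1 / α)) :
    q ≤ N * (2 * (p / N) / α) ^ α := by
  have hα0 : 0 < α := by linarith
  set P := p / N with hP
  set Q := q / N with hQ
  have hP0 : 0 ≤ P := by positivity
  have hQ0 : 0 ≤ Q := by positivity
  have hP2 : P ≤ 1 / 2 := by rw [hP, div_le_iff₀ hN]; linarith
  have e1 : N - p = N * (1 - P) := by rw [hP]; field_simp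
  have e2 : q = N * Q := by rw [hQ]; field_simp
  rw [e1, e2, Real.mul_rpow hN.le (by linarith), Real.mul_rpow hN.le hQ0] at h
  have hNpos : 0 < N ^ (1 / α) := by positivity
  have h1 : (1 - P) ^ (1 / α) + Q ^ (1 / α) ≤ 1 := by
    by_contra hc
    push Not at hc
    have := mul_lt_mul_of_pos_left hc hNpos
    linarith
  have h2 : 1 - 2 * P / α ≤ (1 - P) ^ (1 / α) := by
    rw [Real.rpow_def_of_pos (by linarith)]
    have h3 := Real.one_sub_inv_le_log_of_pos (show 0 < 1 - P by linarith)
    have h4 : -(2 * P) ≤ 1 - (1 - P)⁻¹ := by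
      have : (1 - P)⁻¹ ≤ 1 + 2 * P := by
        rw [inv_le_iff_one_le_mul₀ (by linarith)]
        nlinarith
      linarith
    have h5 : -(2 * P) * (1 / α) ≤ Real.log (1 - P) * (1 / α) :=
      mul_le_mul_of_nonneg_right (h4.trans h3) (by positivity)
    have h6 := Real.add_one_le_exp (Real.log (1 - P) * (1 / α))
    have h7 : -(2 * P) * (1 / α) = - (2 * P / α) := by ring
    linarith
  have h8 : Q ^ (1 / α) ≤ 2 * P / α := by linarith
  have h9 : Q ≤ (2 * P / α) ^ α := by
    have := Real.rpow_le_rpow (by positivity) h8 hα0.le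
    rwa [← Real.rpow_mul hQ0, one_div_mul_cancel hα0.ne', Real.rpow_one] at this
  rw [e2]
  exact mul_le_mul_of_nonneg_left h9 hN.le

lemma tail_step {ι : Type*} (A : Finset ι) (h : ι → ℝ) (g α a : ℝ) (hA : A.Nonempty)
    (hα : 2 ≤ α)
    (hs : ∀ S T : Finset ι, S ⊆ A → T ⊆ A → S.Nonempty → T.Nonempty →
      (∀ x ∈ S, ∀ y ∈ T, h x + g ≤ h y) →
      (S.card : ℝ) ^ (1 / α) + (T.card : ℝ) ^ (1 / α) < (A.card : ℝ) ^ (1 / α))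
    (hp : 2 * ((A.filter fun x => a ≤ h x).card : ℝ) ≤ A.card) :
    ((A.filter fun x => a + g ≤ h x).card : ℝ)
      ≤ A.card * (2 * (((A.filter fun x => a ≤ h x).card : ℝ) / A.card) / α) ^ α := by
  have hN : (0 : ℝ) < A.card := by exact_mod_cast hA.card_pos
  rcases (A.filter fun x => a + g ≤ h x).eq_empty_or_nonempty with he | hne
  · rw [he]; simp; positivity
  · have hc : ((A.filter fun x => a ≤ h x).card : ℝ) + (A.filter fun x => ¬ a ≤ h x).card = A.card := by
      exact_mod_cast Finset.card_filter_add_card_filter_not (s := A) (fun x => a ≤ h x)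
    refine analytic_step hN (by positivity) (by positivity) hp hα ?_
    have e : (A.card : ℝ) - (A.filter fun x => a ≤ h x).card = (A.filter fun x => ¬ a ≤ h x).card := by
      linarith
    rw [e]
    refine (hs _ _ (Finset.filter_subset _ _) (Finset.filter_subset _ _) ?_ hne ?_).le
    · rw [← Finset.card_pos]
      have : (0 : ℝ) < (A.filter fun x => ¬ a ≤ h x).card := by linarith
      exact_mod_cast this
    · intro x hx y hy
      simp only [Finset.mem_filter] at hx hy
      linarith [hx.2, hy.2]

lemma tail_bound {ι : Type*} (A : Finset ι) (h : ι → ℝ) (g α M : ℝ) (hA : A.Nonempty) (hg : 0 < g)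
    (hα : 2 ≤ α)
    (hM : 2 * ((A.filter fun x => M < h x).card : ℝ) ≤ A.card)
    (hs : ∀ S T : Finset ι, S ⊆ A → T ⊆ A → S.Nonempty → T.Nonempty →
      (∀ x ∈ S, ∀ y ∈ T, h x + g ≤ h y) →
      (S.card : ℝ) ^ (1 / α) + (T.card : ℝ) ^ (1 / α) < (A.card : ℝ) ^ (1 / α)) (k : ℕ) :
    ((A.filter fun x => M + ((k : ℝ) + 2) * g ≤ h x).card : ℝ)
      ≤ A.card * α ^ (-(α ^ (k + 1))) := by
  have hN : (0 : ℝ) < A.card := by exact_mod_cast hA.card_pos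
  have hα0 : 0 < α := by linarith
  induction k with
  | zero =>
    have h1 : ((A.filter fun x => M + g ≤ h x).card : ℝ) ≤ (A.filter fun x => M < h x).card := by
      exact_mod_cast Finset.card_le_card (Finset.monotone_filter_right _ (by
        intro x _ hx
        have : M + g ≤ h x := hx
        show M < h x
        linarith))
    have h2 := tail_step A h g α (M + g) hA hα hs (by linarith)
    have e : M + (((0 : ℕ) : ℝ) + 2) * g = M + g + g := by push_cast; ring
    rw [e]
    refine h2.trans (mul_le_mul_of_nonneg_left ?_ hN.le)
    rw [zero_add, pow_one, Real.rpow_neg hα0.le, ← Real.inv_rpow hα0.le]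
    apply Real.rpow_le_rpow (by positivity) _ hα0.le
    rw [← one_div]
    apply div_le_div_of_nonneg_right _ hα0.le
    rw [← mul_div_assoc, div_le_one hN]
    linarith
  | succ k ih =>
    set p := ((A.filter fun x => M + ((k : ℝ) + 2) * g ≤ h x).card : ℝ) with hp
    have h0 : α ^ (-(α ^ (k + 1))) ≤ 1 / 2 := by
      calc α ^ (-(α ^ (k + 1))) ≤ α ^ (-1 : ℝ) := by
            apply Real.rpow_le_rpow_of_exponent_le (by linarith)
            have : 1 ≤ α ^ (k + 1) := one_le_pow₀ (by linarith)
            linarith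
        _ ≤ 1 / 2 := by
            rw [Real.rpow_neg_one, ← one_div]
            exact one_div_le_one_div_of_le (by norm_num) hα
    have h1 : p / A.card ≤ α ^ (-(α ^ (k + 1))) := by
      rw [div_le_iff₀ hN]; linarith
    have h2 := tail_step A h g α (M + ((k : ℝ) + 2) * g) hA hα hs (by
      rw [← hp]; nlinarith)
    have e : M + (((k + 1 : ℕ) : ℝ) + 2) * g = M + ((k : ℝ) + 2) * g + g := by push_cast; ring
    rw [e]
    refine h2.trans (mul_le_mul_of_nonneg_left ?_ hN.le)
    rw [← hp]
    have e2 : α ^ (-(α ^ (k + 1 + 1))) = (α ^ (-(α ^ (k + 1)))) ^ α := by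
      rw [← Real.rpow_mul hα0.le]; congr 1; ring
    rw [e2]
    apply Real.rpow_le_rpow (by positivity) _ hα0.le
    have hp0 : 0 ≤ p / A.card := by positivity
    rw [div_le_iff₀ hα0]
    nlinarith

lemma exists_median {ι : Type*} (A : Finset ι) (h : ι → ℝ) (hA : A.Nonempty) :
    ∃ M : ℝ, 2 * ((A.filter fun x => M < h x).card : ℝ) ≤ A.card ∧
      2 * ((A.filter fun x => h x < M).card : ℝ) ≤ A.card := by
  classical
  set B := A.filter (fun y => 2 * (A.filter fun x => h y < h x).card ≤ A.card) with hB
  have hBn : B.Nonempty := by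
    obtain ⟨y, hy, hmax⟩ := A.exists_max_image h hA
    refine ⟨y, ?_⟩
    rw [hB, Finset.mem_filter]
    refine ⟨hy, ?_⟩
    rw [Finset.filter_eq_empty_iff.2]
    · simp
    · intro x hx; exact not_lt.2 (hmax x hx)
  obtain ⟨y, hy, hmin⟩ := B.exists_min_image h hBn
  have hy' := (Finset.mem_filter.1 hy)
  refine ⟨h y, by exact_mod_cast hy'.2, ?_⟩
  rcases (A.filter fun x => h x < h y).eq_empty_or_nonempty with he | hne
  · rw [he]; simp
  · obtain ⟨w, hw, hwmax⟩ := Finset.exists_max_image _ h hne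
    have hw' := Finset.mem_filter.1 hw
    have hwB : ¬ (2 * (A.filter fun x => h w < h x).card ≤ A.card) := by
      intro hc
      have : w ∈ B := Finset.mem_filter.2 ⟨hw'.1, hc⟩
      exact absurd (hmin w this) (not_le.2 hw'.2)
    have hd : Disjoint (A.filter fun x => h w < h x) (A.filter fun x => h x < h y) := by
      rw [Finset.disjoint_left]
      intro x h1 h2
      have := hwmax x h2
      have := (Finset.mem_filter.1 h1).2
      linarith
    have hu := Finset.card_le_card (Finset.union_subset
      (Finset.filter_subset (fun x => h w < h x) A) (Finset.filter_subset (fun x => h x < h y) A))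
    rw [Finset.card_union_of_disjoint hd] at hu
    have : 2 * (A.filter fun x => h x < h y).card ≤ A.card := by omega
    exact_mod_cast this

lemma numeric_bound {α : ℝ} (hα : 2 ≤ α) (m : ℕ) (hm : 6 ≤ m) :
    4 * α ^ (-(α ^ (m + 1))) ≤
      1 / 8 * (1 / 2) ^ (m + 2) * Real.exp (α - α ^ (((m : ℝ) + 3) / 8)) := by
  have hα0 : 0 < α := by linarith
  have hm' : (6 : ℝ) ≤ m := by exact_mod_cast hm
  set u := α ^ (m + 1) with hu
  have hu0 : 0 < u := by positivity
  have h1 : α ^ (((m : ℝ) + 3) / 8) ≤ u / 4 := by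
    have h2 : α ^ (((m : ℝ) + 3) / 8) ≤ α ^ ((m : ℝ) - 1) :=
      Real.rpow_le_rpow_of_exponent_le (by linarith) (by linarith)
    have h3 : u = α ^ ((m : ℝ) - 1) * α ^ 2 := by
      rw [hu, ← Real.rpow_natCast, ← Real.rpow_natCast, ← Real.rpow_add hα0]
      congr 1; push_cast; ring
    have h4 : 0 < α ^ ((m : ℝ) - 1) := by positivity
    have h5 : 4 ≤ α ^ 2 := by nlinarith
    nlinarith
  have hlog : 1 / 2 ≤ Real.log α := by
    have := Real.log_two_gt_d9
    have := Real.log_le_log (by norm_num) hα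
    linarith
  have h6 : (m : ℝ) + 7 ≤ u / 4 := by
    have h7 : (2 : ℝ) ^ (m + 1) ≤ u := pow_le_pow_left₀ (by norm_num) hα _
    have h8 : 4 * (m + 7) ≤ 2 ^ (m + 1) := by
      clear_value u
      induction m, hm using Nat.le_induction with
      | base => norm_num
      | succ k hk ih =>
        have ih' : 4 * (k + 7) ≤ 2 ^ (k + 1) := by
          have h9 : ∀ j, 6 ≤ j → 4 * (j + 7) ≤ 2 ^ (j + 1) := by
            intro j hj
            induction j, hj using Nat.le_induction with
            | base => norm_num
            | succ k hk ih => rw [pow_succ]; omega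
          exact h9 k hk
        rw [pow_succ]; omega
    have h8' : (4 : ℝ) * (m + 7) ≤ 2 ^ (m + 1) := by exact_mod_cast h8
    linarith
  have h10 : (2 : ℝ) ^ (m + 7) ≤ Real.exp (u / 4) := by
    calc (2 : ℝ) ^ (m + 7) ≤ (Real.exp 1) ^ (m + 7) := by
          apply pow_le_pow_left₀ (by norm_num)
          have := Real.exp_one_gt_d9
          linarith
      _ = Real.exp ((m : ℝ) + 7) := by
          rw [← Real.exp_nat_mul]; congr 1; push_cast; ring
      _ ≤ _ := Real.exp_le_exp.2 h6
  have h11 : α ^ (-u) ≤ Real.exp (-(u / 2)) := by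
    rw [Real.rpow_def_of_pos hα0]
    apply Real.exp_le_exp.2
    nlinarith
  have h12 : Real.exp (-(u / 4)) ≤ Real.exp (α - α ^ (((m : ℝ) + 3) / 8)) :=
    Real.exp_le_exp.2 (by linarith)
  have h13 : Real.exp (-(u / 4)) = Real.exp (-(u / 2)) * Real.exp (u / 4) := by
    rw [← Real.exp_add]; congr 1; ring
  have h14 : 0 < Real.exp (-(u / 2)) := Real.exp_pos _
  have h15 : (1 : ℝ) / 8 * (1 / 2) ^ (m + 2) * 2 ^ (m + 7) = 4 := by
    rw [pow_add (2:ℝ), pow_add, div_pow]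
    field_simp
    norm_num
  calc 4 * α ^ (-u) ≤ 4 * Real.exp (-(u / 2)) := by linarith
    _ = 1 / 8 * (1 / 2) ^ (m + 2) * (Real.exp (-(u / 2)) * 2 ^ (m + 7)) := by
        rw [← h15]; ring
    _ ≤ 1 / 8 * (1 / 2) ^ (m + 2) * (Real.exp (-(u / 2)) * Real.exp (u / 4)) := by gcongr
    _ = 1 / 8 * (1 / 2) ^ (m + 2) * Real.exp (-(u / 4)) := by rw [h13]
    _ ≤ _ := by gcongr

lemma mem_towerBall_of {n : ℕ} {α : ℝ} {x : Fin n → ℝ}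
    (h : ∀ t : ℝ, 1 ≤ t → ((Finset.univ.filter fun i => t ≤ |x i|).card : ℝ)
      ≤ n * Real.exp (α - α ^ t)) : x ∈ towerBall n α := by
  show lorentzNormFin (towerGen α) x ≤ 1
  apply csInf_le
  · exact ⟨0, fun l hl => hl.1.le⟩
  · refine ⟨one_pos, fun t ht => ?_⟩
    simp only [div_one]
    unfold towerGen
    split_ifs with h1
    · have h2 : (1 : ℝ) ≤ 1 / t := by rw [le_div_iff₀ ht]; linarith
      refine le_trans ?_ h2
      apply div_le_one_of_le₀ _ (by positivity)
      have := Finset.card_le_univ (Finset.univ.filter fun i => t ≤ |x i|)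
      rw [Fintype.card_fin] at this
      exact_mod_cast this
    · rw [one_div, ← Real.exp_neg, neg_sub]
      rcases Nat.eq_zero_or_pos n with hn | hn
      · subst hn; simp; positivity
      · rw [div_le_iff₀ (by exact_mod_cast hn), mul_comm]
        exact h t (not_lt.1 h1)

lemma mem_towerBall_of_good {n : ℕ} {α : ℝ} (hα : 2 ≤ α) {f f' M : Fin n → ℝ}
    (h : ∀ m : ℕ, 6 ≤ m → ((Finset.univ.filter fun i => ((m : ℝ) + 2) * (1 / 16) ≤ |f i - M i|).card : ℝ)
      ≤ n * (Real.exp (α - α ^ (((m : ℝ) + 3) / 8)) / 2))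
    (h' : ∀ m : ℕ, 6 ≤ m → ((Finset.univ.filter fun i => ((m : ℝ) + 2) * (1 / 16) ≤ |f' i - M i|).card : ℝ)
      ≤ n * (Real.exp (α - α ^ (((m : ℝ) + 3) / 8)) / 2)) : f - f' ∈ towerBall n α := by
  apply mem_towerBall_of
  intro t ht
  have hk8 : 8 ≤ ⌊8 * t⌋₊ := Nat.le_floor (by push_cast; linarith)
  obtain ⟨m, hm⟩ := Nat.exists_eq_add_of_le' (show 2 ≤ ⌊8 * t⌋₊ by omega)
  have hm6 : 6 ≤ m := by omega
  have h1 : (m : ℝ) + 2 ≤ 8 * t := by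
    have := Nat.floor_le (show 0 ≤ 8 * t by linarith)
    rw [hm] at this; push_cast at this; exact this
  have h2 : 8 * t < (m : ℝ) + 3 := by
    have := Nat.lt_floor_add_one (8 * t)
    rw [hm] at this; push_cast at this; linarith
  have hsub : (Finset.univ.filter fun i => t ≤ |(f - f') i|) ⊆
      (Finset.univ.filter fun i => ((m : ℝ) + 2) * (1 / 16) ≤ |f i - M i|) ∪
      (Finset.univ.filter fun i => ((m : ℝ) + 2) * (1 / 16) ≤ |f' i - M i|) := by
    intro i hi
    simp only [Finset.mem_filter, Finset.mem_univ, true_and, Finset.mem_union, Pi.sub_apply] at hi ⊢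
    by_contra hc
    push Not at hc
    have h3 : |f i - f' i| ≤ |f i - M i| + |f' i - M i| := by
      have := abs_sub (f i - M i) (f' i - M i)
      have e : f i - M i - (f' i - M i) = f i - f' i := by ring
      rwa [e] at this
    linarith [hc.1, hc.2]
  have h4 := (Finset.card_le_card hsub).trans (Finset.card_union_le _ _)
  have h5 : ((Finset.univ.filter fun i => t ≤ |(f - f') i|).card : ℝ) ≤
      (Finset.univ.filter fun i => ((m : ℝ) + 2) * (1 / 16) ≤ |f i - M i|).card +
      (Finset.univ.filter fun i => ((m : ℝ) + 2) * (1 / 16) ≤ |f' i - M i|).card := by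
    exact_mod_cast h4
  have h6 := h m hm6
  have h7 := h' m hm6
  have h8 : Real.exp (α - α ^ (((m : ℝ) + 3) / 8)) ≤ Real.exp (α - α ^ t) := by
    apply Real.exp_le_exp.2
    have := Real.rpow_le_rpow_of_exponent_le (show 1 ≤ α by linarith)
      (show t ≤ ((m : ℝ) + 3) / 8 by linarith)
    linarith
  have h9 : (n : ℝ) * Real.exp (α - α ^ (((m : ℝ) + 3) / 8)) ≤ n * Real.exp (α - α ^ t) := by gcongr
  linarith

/-- two-sided tails under the no-split hypothesis -/
lemma two_sided {ι : Type*} (A : Finset ι) (h : ι → ℝ) (g α : ℝ) (hA : A.Nonempty) (hg : 0 < g)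
    (hα : 2 ≤ α)
    (hs : ∀ S T : Finset ι, S ⊆ A → T ⊆ A → S.Nonempty → T.Nonempty →
      (∀ x ∈ S, ∀ y ∈ T, h x + g ≤ h y) →
      (S.card : ℝ) ^ (1 / α) + (T.card : ℝ) ^ (1 / α) < (A.card : ℝ) ^ (1 / α)) :
    ∃ M : ℝ, ∀ k : ℕ, ((A.filter fun x => ((k : ℝ) + 2) * g ≤ |h x - M|).card : ℝ)
      ≤ 2 * (A.card * α ^ (-(α ^ (k + 1)))) := by
  classical
  obtain ⟨M, h1, h2⟩ := exists_median A h hA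
  refine ⟨M, fun k => ?_⟩
  have t1 := tail_bound A h g α M hA hg hα h1 hs k
  have t2 := tail_bound A (fun x => - h x) g α (-M) hA hg hα (by simpa using h2) (by
    intro S T hS hT hSn hTn hST
    rw [add_comm]
    exact hs T S hT hS hTn hSn (fun x hx y hy => by have := hST y hy x hx; linarith)) k
  have hsub : (A.filter fun x => ((k : ℝ) + 2) * g ≤ |h x - M|) ⊆
      (A.filter fun x => M + ((k : ℝ) + 2) * g ≤ h x) ∪
      (A.filter fun x => -M + ((k : ℝ) + 2) * g ≤ -h x) := by
    intro x hx
    simp only [Finset.mem_filter, Finset.mem_union] at hx ⊢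
    rcases le_abs.1 hx.2 with h | h
    · exact Or.inl ⟨hx.1, by linarith⟩
    · exact Or.inr ⟨hx.1, by linarith⟩
  have h4 := (Finset.card_le_card hsub).trans (Finset.card_union_le _ _)
  have h5 : ((A.filter fun x => ((k : ℝ) + 2) * g ≤ |h x - M|).card : ℝ) ≤
      (A.filter fun x => M + ((k : ℝ) + 2) * g ≤ h x).card +
      (A.filter fun x => -M + ((k : ℝ) + 2) * g ≤ -h x).card := by exact_mod_cast h4
  linarith

lemma exists_split {n : ℕ} (A : Finset (Fin n → ℝ)) (α : ℝ) (hα : 2 ≤ α) (hA : 2 ≤ A.card)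
    (hsep : ∀ f ∈ A, ∀ f' ∈ A, f ≠ f' → f - f' ∉ towerBall n α) :
    ∃ (i : Fin n) (S T : Finset (Fin n → ℝ)), S ⊆ A ∧ T ⊆ A ∧ S.Nonempty ∧ T.Nonempty ∧
      (∀ x ∈ S, ∀ y ∈ T, x i + 1 / 16 ≤ y i) ∧
      (A.card : ℝ) ^ (1 / α) ≤ (S.card : ℝ) ^ (1 / α) + (T.card : ℝ) ^ (1 / α) := by
  classical
  by_contra hno
  push Not at hno
  have hAn : A.Nonempty := by rw [← Finset.card_pos]; omega
  have hN : (0 : ℝ) < A.card := by exact_mod_cast hAn.card_pos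
  have hn : 0 < n := by
    rcases Nat.eq_zero_or_pos n with hn | hn
    · subst hn
      have := Finset.card_le_one_of_subsingleton A
      omega
    · exact hn
  have hn' : (0 : ℝ) < n := by exact_mod_cast hn
  have hM : ∀ i : Fin n, ∃ M : ℝ, ∀ k : ℕ,
      ((A.filter fun x => ((k : ℝ) + 2) * (1 / 16) ≤ |x i - M|).card : ℝ)
      ≤ 2 * (A.card * α ^ (-(α ^ (k + 1)))) := fun i =>
    two_sided A (fun x => x i) (1 / 16) α hAn (by norm_num) hα
      (fun S T a b c d e => hno i S T a b c d e)
  choose M hM using hM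
  let E : ℕ → ℝ := fun m => Real.exp (α - α ^ (((m : ℝ) + 3) / 8)) / 2
  have hE0 : ∀ m, 0 < E m := fun m => by positivity
  let c : (Fin n → ℝ) → ℕ → ℕ := fun f m =>
    (Finset.univ.filter fun i => ((m : ℝ) + 2) * (1 / 16) ≤ |f i - M i|).card
  let bad : (Fin n → ℝ) → Prop := fun f => ∃ m : ℕ, 6 ≤ m ∧ n * E m < (c f m : ℝ)
  -- number of functions that are bad at level m
  have hbm : ∀ m, 6 ≤ m → ((A.filter fun f => n * E m < (c f m : ℝ)).card : ℝ)
      ≤ A.card * (1 / 8 * (1 / 2) ^ m) := by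
    intro m hm
    have h1 : ((A.filter fun f => n * E m < (c f m : ℝ)).card : ℝ) * (n * E m) ≤
        ∑ f ∈ A, (c f m : ℝ) := by
      calc ((A.filter fun f => n * E m < (c f m : ℝ)).card : ℝ) * (n * E m)
          = ∑ f ∈ A.filter (fun f => n * E m < (c f m : ℝ)), (n * E m) := by
            rw [Finset.sum_const, nsmul_eq_mul]
        _ ≤ ∑ f ∈ A.filter (fun f => n * E m < (c f m : ℝ)), (c f m : ℝ) :=
            Finset.sum_le_sum (fun f hf => (Finset.mem_filter.1 hf).2.le)
        _ ≤ _ := Finset.sum_le_sum_of_subset_of_nonneg (Finset.filter_subset _ _)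
            (fun _ _ _ => by positivity)
    have h2 : ∑ f ∈ A, (c f m : ℝ) = ∑ i : Fin n,
        ((A.filter fun x => ((m : ℝ) + 2) * (1 / 16) ≤ |x i - M i|).card : ℝ) := by
      have := Finset.sum_card_bipartiteAbove_eq_sum_card_bipartiteBelow
        (s := A) (t := (Finset.univ : Finset (Fin n)))
        (fun f i => ((m : ℝ) + 2) * (1 / 16) ≤ |f i - M i|)
      simp only [Finset.bipartiteAbove, Finset.bipartiteBelow] at this
      simp only [c]
      exact_mod_cast this
    have h3 : ∑ f ∈ A, (c f m : ℝ) ≤ n * (2 * (A.card * α ^ (-(α ^ (m + 1))))) := by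
      rw [h2]
      refine (Finset.sum_le_sum (fun i _ => hM i m)).trans ?_
      simp
    have h4 := numeric_bound hα m hm
    have h5 : 2 * α ^ (-(α ^ (m + 1))) ≤ 1 / 8 * (1 / 2) ^ m * E m := by
      have e : (1 : ℝ) / 8 * (1 / 2) ^ (m + 2) * Real.exp (α - α ^ (((m : ℝ) + 3) / 8))
        = 1 / 8 * (1 / 2) ^ m * E m * (1 / 2) := by
        simp only [E]; ring
      rw [e] at h4
      have : 0 < 1 / 8 * (1 / 2) ^ m * E m := by have := hE0 m; positivity
      linarith
    have h6 : 0 < n * E m := mul_pos hn' (hE0 m)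
    refine le_of_mul_le_mul_right ?_ h6
    calc _ ≤ _ := h1
      _ ≤ n * (2 * (A.card * α ^ (-(α ^ (m + 1))))) := h3
      _ = n * A.card * (2 * α ^ (-(α ^ (m + 1)))) := by ring
      _ ≤ n * A.card * (1 / 8 * (1 / 2) ^ m * E m) := by gcongr
      _ = _ := by ring
  have hlev : ∀ f : Fin n → ℝ, ∃ m : ℕ, bad f → (6 ≤ m ∧ n * E m < (c f m : ℝ)) := by
    intro f
    by_cases hb : bad f
    · obtain ⟨m, hm⟩ := hb
      exact ⟨m, fun _ => hm⟩
    · exact ⟨0, fun h => absurd h hb⟩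
  choose lev hlev using hlev
  let B := A.filter bad
  let K := B.image lev
  have hBK : B ⊆ K.biUnion (fun m => A.filter fun f => n * E m < (c f m : ℝ)) := by
    intro f hf
    rw [Finset.mem_biUnion]
    have hf' := Finset.mem_filter.1 hf
    exact ⟨lev f, Finset.mem_image_of_mem _ hf, Finset.mem_filter.2 ⟨hf'.1, (hlev f hf'.2).2⟩⟩
  have hK6 : ∀ m ∈ K, 6 ≤ m := by
    intro m hm
    obtain ⟨f, hf, rfl⟩ := Finset.mem_image.1 hm
    exact (hlev f (Finset.mem_filter.1 hf).2).1
  have hBcard : (B.card : ℝ) ≤ A.card / 4 := by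
    have h1 : (B.card : ℝ) ≤ ∑ m ∈ K, ((A.filter fun f => n * E m < (c f m : ℝ)).card : ℝ) := by
      exact_mod_cast (Finset.card_le_card hBK).trans Finset.card_biUnion_le
    have h2 : ∑ m ∈ K, ((A.filter fun f => n * E m < (c f m : ℝ)).card : ℝ)
        ≤ ∑ m ∈ K, (A.card : ℝ) * (1 / 8 * (1 / 2) ^ m) :=
      Finset.sum_le_sum (fun m hm => hbm m (hK6 m hm))
    have h3 : ∑ m ∈ K, ((1 : ℝ) / 2) ^ m ≤ 2 := by
      have h5 := summable_geometric_two.sum_le_tsum K (fun _ _ => by positivity)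
      rwa [tsum_geometric_two] at h5
    have h4 : ∑ m ∈ K, (A.card : ℝ) * (1 / 8 * (1 / 2) ^ m)
        = A.card * (1 / 8) * ∑ m ∈ K, ((1 : ℝ) / 2) ^ m := by
      rw [Finset.mul_sum]; exact Finset.sum_congr rfl (fun _ _ => by ring)
    rw [h4] at h2
    nlinarith
  have hgood : 1 < (A.filter fun f => ¬ bad f).card := by
    have h1 := Finset.card_filter_add_card_filter_not (s := A) bad
    have h2 : 4 * B.card ≤ A.card := by
      have : 4 * (B.card : ℝ) ≤ A.card := by linarith
      exact_mod_cast this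
    change B.card + _ = _ at h1
    omega
  obtain ⟨f, hf, f', hf', hne⟩ := Finset.one_lt_card.1 hgood
  rw [Finset.mem_filter] at hf hf'
  have key : ∀ f, ¬ bad f → ∀ m : ℕ, 6 ≤ m → (c f m : ℝ) ≤ n * E m := by
    intro f hf m hm
    by_contra hc
    exact hf ⟨m, hm, not_le.1 hc⟩
  exact hsep f hf.1 f' hf'.1 hne
    (mem_towerBall_of_good hα (key f hf.2) (key f' hf'.2))

lemma card_le_cellContent {n : ℕ} (α : ℝ) (hα : 2 ≤ α) (N : ℕ) : ∀ A : Finset (Fin n → ℝ),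
    A.card = N → A.Nonempty →
    (∀ f ∈ A, ∀ f' ∈ A, f ≠ f' → f - f' ∉ towerBall n α) →
    ENNReal.ofReal ((A.card : ℝ) ^ (1 / α)) ≤ cellContent ((32 : ℝ) • (A : Set (Fin n → ℝ))) := by
  induction N using Nat.strong_induction_on with
  | _ N ih =>
    intro A hAN hAn hsep
    by_cases h2 : 2 ≤ A.card
    · obtain ⟨i, S, T, hS, hT, hSn, hTn, hgap, hcard⟩ := exists_split A α hα h2 hsep
      have hdisj : Disjoint S T := by
        rw [Finset.disjoint_left]
        intro x h1 h2
        have := hgap x h1 x h2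
        linarith
      have hu : S.card + T.card ≤ A.card := by
        classical
        rw [← Finset.card_union_of_disjoint hdisj]
        exact Finset.card_le_card (Finset.union_subset hS hT)
      have hSp := hSn.card_pos
      have hTp := hTn.card_pos
      have iS := ih S.card (by omega) S rfl hSn
        (fun f hf f' hf' => hsep f (hS hf) f' (hS hf'))
      have iT := ih T.card (by omega) T rfl hTn
        (fun f hf f' hf' => hsep f (hT hf) f' (hT hf'))
      obtain ⟨w, hw, hwmax⟩ := S.exists_max_image (fun x => x i) hSn
      have hsplit : cellContent ((32 : ℝ) • (S : Set (Fin n → ℝ))) +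
          cellContent ((32 : ℝ) • (T : Set (Fin n → ℝ))) ≤
          cellContent ((32 : ℝ) • (A : Set (Fin n → ℝ))) := by
        refine cellContent_split (i := i) (b := ⌈32 * w i⌉)
          (Set.smul_set_mono (Finset.coe_subset.2 hS))
          (Set.smul_set_mono (Finset.coe_subset.2 hT)) ?_ ?_
        · rintro _ ⟨x, hx, rfl⟩
          have h1 := hwmax x hx
          have h3 := Int.le_ceil (32 * w i)
          simp only [Pi.smul_apply, smul_eq_mul]
          linarith
        · rintro _ ⟨y, hy, rfl⟩
          have h1 := hgap w hw y hy
          have h3 := Int.ceil_lt_add_one (32 * w i)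
          simp only [Pi.smul_apply, smul_eq_mul]
          linarith
      calc ENNReal.ofReal ((A.card : ℝ) ^ (1 / α))
          ≤ ENNReal.ofReal ((S.card : ℝ) ^ (1 / α) + (T.card : ℝ) ^ (1 / α)) :=
            ENNReal.ofReal_le_ofReal hcard
        _ = ENNReal.ofReal ((S.card : ℝ) ^ (1 / α)) + ENNReal.ofReal ((T.card : ℝ) ^ (1 / α)) :=
            ENNReal.ofReal_add (by positivity) (by positivity)
        _ ≤ _ := add_le_add iS iT
        _ ≤ _ := hsplit
    · have h1 : A.card = 1 := by have := hAn.card_pos; omega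
      rw [h1]
      simp only [Nat.cast_one, Real.one_rpow, ENNReal.ofReal_one]
      apply one_le_cellContent
      exact (Finset.coe_nonempty.2 hAn).smul_set

lemma sep_card_le {n : ℕ} (α : ℝ) (hα : 2 ≤ α) (F : Set (Fin n → ℝ)) (A : Finset (Fin n → ℝ))
    (hAF : (A : Set (Fin n → ℝ)) ⊆ F)
    (hsep : ∀ f ∈ A, ∀ f' ∈ A, f ≠ f' → f - f' ∉ towerBall n α) :
    (A.card : ℝ≥0∞) ≤ cellContent ((32 : ℝ) • F) ^ α := by
  have hα0 : 0 < α := by linarith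
  rcases A.eq_empty_or_nonempty with he | hne
  · simp [he]
  · have h1 := (card_le_cellContent α hα _ A rfl hne hsep).trans
      (cellContent_mono (Set.smul_set_mono hAF))
    have h2 := ENNReal.rpow_le_rpow h1 hα0.le
    rw [ENNReal.ofReal_rpow_of_nonneg (by positivity) hα0.le, ← Real.rpow_mul (by positivity),
      one_div_mul_cancel hα0.ne', Real.rpow_one, ENNReal.ofReal_natCast] at h2
    exact h2

lemma towerBall_neg {n : ℕ} {α : ℝ} {x : Fin n → ℝ} (h : -x ∈ towerBall n α) :
    x ∈ towerBall n α := by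
  have : lorentzNormFin (towerGen α) (-x) = lorentzNormFin (towerGen α) x := by
    unfold lorentzNormFin
    simp
  have h' : lorentzNormFin (towerGen α) (-x) ≤ 1 := h
  rw [this] at h'
  exact h'

lemma cover_of_max {n : ℕ} {α : ℝ} {F : Set (Fin n → ℝ)} {A : Finset (Fin n → ℝ)}
    (hcov : ∀ x ∈ F, ∃ f ∈ A, x - f ∈ towerBall n α) :
    coveringNumber F (towerBall n α) ≤ A.card := by
  unfold coveringNumber
  refine iInf₂_le_of_le A.card ⟨fun j => (A.equivFin.symm j : Fin n → ℝ), ?_⟩ le_rfl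
  intro x hx
  obtain ⟨f, hf, hxf⟩ := hcov x hx
  rw [Set.mem_iUnion]
  refine ⟨A.equivFin ⟨f, hf⟩, x - f, hxf, ?_⟩
  simp

lemma zero_mem_towerBall {n : ℕ} {α : ℝ} : (0 : Fin n → ℝ) ∈ towerBall n α := by
  apply mem_towerBall_of
  intro t ht
  rw [Finset.filter_eq_empty_iff.2]
  · simp; positivity
  · intro i _
    simp
    linarith

lemma exists_sep {n : ℕ} (α : ℝ) (F : Set (Fin n → ℝ)) (m : ℕ)
    (hm : (m : ℕ∞) ≤ coveringNumber F (towerBall n α)) :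
    ∃ A : Finset (Fin n → ℝ), (A : Set (Fin n → ℝ)) ⊆ F ∧
      (∀ f ∈ A, ∀ f' ∈ A, f ≠ f' → f - f' ∉ towerBall n α) ∧ A.card = m := by
  classical
  induction m with
  | zero => exact ⟨∅, by simp, by simp, by simp⟩
  | succ m ih =>
    obtain ⟨A, hAF, hsep, hc⟩ := ih (le_trans (by exact_mod_cast Nat.le_succ m) hm)
    have : ∃ x ∈ F, ∀ f ∈ A, x - f ∉ towerBall n α := by
      by_contra hcon
      push Not at hcon
      have := hm.trans (cover_of_max hcon)
      rw [hc] at this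
      have : m + 1 ≤ m := by exact_mod_cast this
      omega
    obtain ⟨x, hx, hxA⟩ := this
    have hxn : x ∉ A := fun h => hxA x h (by rw [sub_self]; exact zero_mem_towerBall)
    refine ⟨insert x A, ?_, ?_, by rw [Finset.card_insert_of_notMem hxn, hc]⟩
    · rw [Finset.coe_insert]
      exact Set.insert_subset hx hAF
    · intro f hf f' hf' hne
      rw [Finset.mem_insert] at hf hf'
      rcases hf with rfl | hf
      · rcases hf' with rfl | hf'
        · exact absurd rfl hne
        · exact hxA f' hf'
      · rcases hf' with rfl | hf'
        · intro h
          exact hxA f hf (towerBall_neg (by rwa [neg_sub]))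
        · exact hsep f hf f' hf' hne

/-- For every set `F` in `ℝ^n` and every `α ≥ 2`,
`N(F, Tower^α) ≤ Σ(C·F)^α`, where `C` is an absolute constant. -/
theorem covering_by_tower :
    ∃ C > (0 : ℝ), ∀ (n : ℕ) (F : Set (Fin n → ℝ)) (α : ℝ), 2 ≤ α →
      ((coveringNumber F (towerBall n α) : ℕ∞) : ℝ≥0∞) ≤ (cellContent (C • F)) ^ α := by
  refine ⟨32, by norm_num, fun n F α hα => ?_⟩
  have key : ∀ m : ℕ, (m : ℕ∞) ≤ coveringNumber F (towerBall n α) →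
      (m : ℝ≥0∞) ≤ cellContent ((32 : ℝ) • F) ^ α := by
    intro m hm
    obtain ⟨A, hAF, hsep, hc⟩ := exists_sep α F m hm
    rw [← hc]
    exact sep_card_le α hα F A hAF hsep
  cases hcov : coveringNumber F (towerBall n α) with
  | top =>
    have : cellContent ((32 : ℝ) • F) ^ α = ⊤ := by
      apply ENNReal.eq_top_of_forall_nnreal_le
      intro r
      obtain ⟨m, hm⟩ := exists_nat_ge r
      refine le_trans ?_ (key m (by rw [hcov]; exact le_top))
      exact_mod_cast hm
    rw [this]
    exact le_top
  | coe m =>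
    have := key m (by rw [hcov])
    simpa using this
end
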